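/- Let K be a field, R = K[x_1,…,x_d] a polynomial ring in d > 0 indeterminates, and n ≥ 2 an integer. Let A be an n×n matrix over R such that I = I_{n−1}(A) is of generic height (that is, ht I = 4), and suppose ht I_j(A) ≥ (n−j+1)^2 for all 1 ≤ j ≤ n−2 (i.e. I satisfies G_∞). Then I is of linear type. -/

import Mathlib

open Matrix

/-- The ideal generated by the `t × t` minors of a matrix. -/
noncomputable def minorsIdeal {R : Type*} [CommRing R] {α β : Type*}
    (t : ℕ) (A : Matrix α β R) : Ideal R :=
  Ideal.span {d : R | ∃ (f : Fin t → α) (g : Fin t → β),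
    Function.Injective f ∧ Function.Injective g ∧ d = (A.submatrix f g).det}

/-- The height of an ideal: the infimum of the heights of primes containing it. -/
noncomputable def idealHeight {R : Type*} [CommRing R] (I : Ideal R) : ℕ∞ :=
  ⨅ p ∈ {p : PrimeSpectrum R | I ≤ p.asIdeal}, Order.height p

/-- The minimal number of generators of an ideal. -/
noncomputable def mu {R : Type*} [CommRing R] (I : Ideal R) : ℕ :=
  sInf {n : ℕ | ∃ s : Finset R, s.card = n ∧ Ideal.span (s : Set R) = I}

/-- The condition `G_s`. -/
def SatisfiesG {R : Type*} [CommRing R] (I : Ideal R) (s : ℕ) : Prop :=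
  ∀ (p : Ideal R) (hp : p.IsPrime), I ≤ p →
    haveI := hp
    ringKrullDim (Localization.AtPrime p) ≤ ((s - 1 : ℕ) : WithBot ℕ∞) →
    (mu (I.map (algebraMap R (Localization.AtPrime p))) : WithBot ℕ∞) ≤
      ringKrullDim (Localization.AtPrime p)

/-- The defining ideal of the Rees algebra of the ideal generated by the family `f`:
the kernel of the map `R[Tᵢ] → R[u]`, `Tᵢ ↦ fᵢ·u`. -/
noncomputable def reesDefIdeal {R : Type*} [CommRing R] {ι : Type*} (f : ι → R) :
    Ideal (MvPolynomial ι R) :=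
  RingHom.ker (MvPolynomial.aeval fun i => Polynomial.C (f i) * Polynomial.X :
    MvPolynomial ι R →ₐ[R] Polynomial R)

/-- An ideal, presented by a generating family `f`, is of linear type if the defining ideal
of its Rees algebra is generated by elements homogeneous of degree `1` in the variables `Tᵢ`. -/
def IsLinearType {R : Type*} [CommRing R] {ι : Type*} (f : ι → R) : Prop :=
  reesDefIdeal f = Ideal.span
    {p : MvPolynomial ι R | p ∈ reesDefIdeal f ∧ p.IsHomogeneous 1}

/-- An ideal of a `K`-algebra, presented by a generating family `f`, is of fiber type if the
defining ideal of its Rees algebra is generated by its elements homogeneous of degree `1` in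
the variables `Tᵢ` together with its elements lying in the subring `K[Tᵢ]`. -/
def IsFiberType (K : Type*) [CommSemiring K] {R : Type*} [CommRing R] [Algebra K R]
    {ι : Type*} (f : ι → R) : Prop :=
  reesDefIdeal f = Ideal.span
    ({p : MvPolynomial ι R | p ∈ reesDefIdeal f ∧ p.IsHomogeneous 1} ∪
     {p : MvPolynomial ι R | p ∈ reesDefIdeal f ∧
        ∃ q : MvPolynomial ι K, MvPolynomial.map (algebraMap K R) q = p})

universe u

theorem AlternatingMap.mul_eq_zero_of_shuffle {Q M ι κ : Type*} [CommRing Q] [AddCommGroup M]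
    [Module Q M] [Fintype ι] [Fintype κ] [DecidableEq ι] [DecidableEq κ]
    (α : M [⋀^ι]→ₗ[Q] Q) (β : M [⋀^κ]→ₗ[Q] Q) (v : ι ⊕ κ → M)
    (hv : ∀ γ : M [⋀^ι ⊕ κ]→ₗ[Q] Q, γ v = 0)
    (hα : ∀ σ : Equiv.Perm (ι ⊕ κ), (∃ i k, σ (Sum.inl i) = Sum.inr k) →
      α (fun i => v (σ (Sum.inl i))) = 0) :
    α (fun i => v (Sum.inl i)) * β (fun k => v (Sum.inr k)) = 0 := by
  have h := hv ((LinearMap.mul' Q Q).compAlternatingMap (α.domCoprod β))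
  rw [LinearMap.compAlternatingMap_apply, AlternatingMap.domCoprod_apply,
    _root_.sum_apply, map_sum] at h
  have h1 := Finset.sum_eq_single (s := Finset.univ)
    (f := fun x => (LinearMap.mul' Q Q) ((AlternatingMap.domCoprod.summand α β x) v))
    (Quotient.mk'' (1 : Equiv.Perm (ι ⊕ κ))) ?_ ?_
  · replace h := h1.symm.trans h
    simp only [AlternatingMap.domCoprod.summand_mk''] at h
    simpa using h
  · intro σ _ hσ
    induction σ using Quotient.inductionOn' with
    | h σ =>
    rw [AlternatingMap.domCoprod.summand_mk'']
    have : ∃ i k, σ (Sum.inl i) = Sum.inr k := by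
      by_contra! hcon
      apply hσ
      have hmem : σ ∈ (Equiv.Perm.sumCongrHom ι κ).range := by
        apply Equiv.Perm.mem_sumCongrHom_range_of_perm_mapsTo_inl
        rintro _ ⟨i, rfl⟩
        rcases hh : σ (Sum.inl i) with a | a
        · exact ⟨a, rfl⟩
        · exact absurd hh (hcon i a)
      symm
      apply Quotient.sound'
      rw [QuotientGroup.leftRel_apply]
      simpa using hmem
    have h0 := hα σ this
    simp [h0]
  · simp

theorem AlternatingMap.apply_eq_zero_of_minors {Q ι : Type*} [CommRing Q] [Fintype ι] {n : ℕ}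
    (γ : (Fin n → Q) [⋀^ι]→ₗ[Q] Q) (v : ι → Fin n → Q)
    (hv : ∀ (e : ι ≃ Fin (Fintype.card ι)) (r : Fin (Fintype.card ι) → Fin n),
      Function.Injective r →
      (Matrix.of fun x y => v (e.symm x) (r y)).det = 0) : γ v = 0 := by
  classical
  set s := Fintype.card ι
  let e : ι ≃ Fin s := Fintype.equivFin ι
  have key : exteriorPower.ιMulti Q s (fun x => v (e.symm x)) = 0 := by
    apply (Module.Basis.exteriorPower s (Pi.basisFun Q (Fin n))).ext_elem
    intro S
    rw [LinearEquiv.map_zero, Finsupp.zero_apply, exteriorPower.basis_repr_apply,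
      exteriorPower.ιMultiDual_apply_ιMulti]
    rw [← hv e (Set.powersetCard.ofFinEmbEquiv.symm S) (RelEmbedding.injective _)]
    rfl
  have h2 : (γ.domDomCongr e) (fun x => v (e.symm x)) = 0 := by
    rw [← exteriorPower.alternatingMapLinearEquiv_apply_ιMulti, key, LinearMap.map_zero]
  rw [AlternatingMap.domDomCongr_apply] at h2
  simpa [Function.comp_def] using h2

/-- The columns of the matrix `[Y | 1]`. -/
def Matrix.augCol {Q : Type*} [CommRing Q] {n : ℕ} (Y : Matrix (Fin n) (Fin n) Q) :
    Fin n ⊕ Fin n → Fin n → Q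
  | Sum.inl j => fun i => Y i j
  | Sum.inr e => fun i => if i = e then 1 else 0

theorem Matrix.det_submatrix_equiv_equiv {Q ι κ : Type*} [CommRing Q] [Fintype ι] [Fintype κ]
    [DecidableEq ι] [DecidableEq κ] (D : Matrix ι ι Q) (e₁ e₂ : κ ≃ ι) :
    ∃ ε : ℤˣ, D.det = ε • (D.submatrix e₁ e₂).det := by
  refine ⟨Equiv.Perm.sign (e₂.symm.trans e₁), ?_⟩
  have h : D.submatrix e₁ e₂ = (D.submatrix (e₂.symm.trans e₁) id).submatrix e₂ e₂ := by
    ext i j; simp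
  rw [h, Matrix.det_submatrix_equiv_self, Matrix.det_permute, Units.smul_def, zsmul_eq_mul,
    ← mul_assoc, ← Int.cast_mul, ← Units.val_mul, Int.units_mul_self]
  simp

theorem Matrix.det_augCol {Q ι κ : Type*} [CommRing Q] [Fintype ι] [Fintype κ]
    [DecidableEq ι] [DecidableEq κ] {n : ℕ} (Y : Matrix (Fin n) (Fin n) Q)
    (r : ι → Fin n) (c : ι → Fin n ⊕ Fin n) (hr : Function.Injective r)
    (hc : Function.Injective c) (a b : κ → Fin n) (ha : Function.Injective a)
    (hb : Function.Injective b)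
    (hE : ∀ e, Sum.inr e ∈ Set.range c → e ∈ Set.range r)
    (har : ∀ i, i ∈ Set.range a ↔ i ∈ Set.range r ∧ Sum.inr i ∉ Set.range c)
    (hbc : ∀ j, j ∈ Set.range b ↔ Sum.inl j ∈ Set.range c) :
    ∃ ε : ℤˣ, (Matrix.of fun x y => Y.augCol (c y) (r x)).det = ε • (Y.submatrix a b).det := by
  classical
  let E : Type _ := {e : Fin n // Sum.inr e ∈ Set.range c}
  have hb' : ∀ k, ∃ y, c y = Sum.inl (b k) := fun k => (hbc _).1 ⟨k, rfl⟩
  have ha' : ∀ k, ∃ x, r x = a k := fun k => ((har _).1 ⟨k, rfl⟩).1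
  choose cb hcb using hb'
  choose ra hra using ha'
  have hcE : ∀ e : E, ∃ y, c y = Sum.inr e.1 := fun e => e.2
  have hrE : ∀ e : E, ∃ x, r x = e.1 := fun e => hE _ e.2
  choose cE hcE using hcE
  choose rE hrE using hrE
  have bij₂ : Function.Bijective (Sum.elim cb cE : κ ⊕ E → ι) := by
    constructor
    · rintro (k | e) (k' | e') h
      · have h1 := congrArg c h
        simp only [Sum.elim_inl, hcb] at h1
        rw [hb (Sum.inl_injective h1)]
      · have h1 := congrArg c h
        simp [hcb, hcE] at h1
      · have h1 := congrArg c h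
        simp [hcb, hcE] at h1
      · have h1 := congrArg c h
        simp only [Sum.elim_inr, hcE] at h1
        rw [Subtype.ext (Sum.inr_injective h1)]
    · intro y
      rcases hy : c y with j | e
      · obtain ⟨k, hk⟩ := (hbc j).2 ⟨y, hy⟩
        exact ⟨Sum.inl k, hc (by simp [hcb, hk, hy])⟩
      · exact ⟨Sum.inr ⟨e, y, hy⟩, hc (by simp [hcE, hy])⟩
  have bij₁ : Function.Bijective (Sum.elim ra rE : κ ⊕ E → ι) := by
    constructor
    · rintro (k | e) (k' | e') h
      · have h1 := congrArg r h
        simp only [Sum.elim_inl, hra] at h1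
        rw [ha h1]
      · have h1 := congrArg r h
        simp only [Sum.elim_inl, Sum.elim_inr, hra, hrE] at h1
        exact absurd e'.2 (h1 ▸ ((har _).1 ⟨k, rfl⟩).2)
      · have h1 := congrArg r h
        simp only [Sum.elim_inl, Sum.elim_inr, hra, hrE] at h1
        exact absurd e.2 (h1 ▸ ((har _).1 ⟨k', rfl⟩).2)
      · have h1 := congrArg r h
        simp only [Sum.elim_inr, hrE] at h1
        rw [Subtype.ext h1]
    · intro x
      by_cases hx : Sum.inr (r x) ∈ Set.range c
      · exact ⟨Sum.inr ⟨r x, hx⟩, hr (by simp [hrE])⟩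
      · obtain ⟨k, hk⟩ := (har (r x)).2 ⟨⟨x, rfl⟩, hx⟩
        exact ⟨Sum.inl k, hr (by simp [hra, hk])⟩
  obtain ⟨ε, hε⟩ := Matrix.det_submatrix_equiv_equiv
    (Matrix.of fun x y => Y.augCol (c y) (r x)) (Equiv.ofBijective _ bij₁)
    (Equiv.ofBijective _ bij₂)
  refine ⟨ε, hε.trans ?_⟩
  congr 1
  have hblock : (Matrix.of fun x y => Y.augCol (c y) (r x)).submatrix
      (Equiv.ofBijective _ bij₁) (Equiv.ofBijective _ bij₂) =
      Matrix.fromBlocks (Y.submatrix a b) 0 (Matrix.of fun (e : E) (k : κ) => Y e.1 (b k)) 1 := by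
    ext (k | e) (k' | e')
    · simp [Matrix.augCol, hcb, hra]
    · have : a k ≠ e'.1 := fun h => ((har _).1 ⟨k, rfl⟩).2 (h ▸ e'.2)
      simp [Matrix.augCol, hcE, hra, this]
    · simp [Matrix.augCol, hcb, hrE]
    · by_cases hee : e = e'
      · simp [Matrix.augCol, hcE, hrE, hee]
      · have : e.1 ≠ e'.1 := fun h => hee (Subtype.ext h)
        simp [Matrix.augCol, hcE, hrE, hee, this]
  rw [hblock, Matrix.det_fromBlocks_zero₁₂, Matrix.det_one, mul_one]

theorem Matrix.det_submatrix_range {Q ι κ : Type*} [CommRing Q] [Fintype ι] [Fintype κ]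
    [DecidableEq ι] [DecidableEq κ] {n : ℕ} (Y : Matrix (Fin n) (Fin n) Q)
    {a b : ι → Fin n} {a' b' : κ → Fin n} (ha : Function.Injective a) (hb : Function.Injective b)
    (ha' : Function.Injective a') (hb' : Function.Injective b')
    (haa : Set.range a = Set.range a') (hbb : Set.range b = Set.range b') :
    ∃ ε : ℤˣ, (Y.submatrix a b).det = ε • (Y.submatrix a' b').det :=
  Matrix.det_augCol Y a (Sum.inl ∘ b) ha (Sum.inl_injective.comp hb) a' b' ha' hb' (by simp)
    (by simp [← haa]) (by intro j; rw [← hbb]; simp)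

theorem Matrix.det_augCol_eq_zero {Q ι : Type*} [CommRing Q] [Fintype ι]
    [DecidableEq ι] {n : ℕ} (Y : Matrix (Fin n) (Fin n) Q)
    (r : ι → Fin n) (c : ι → Fin n ⊕ Fin n)
    (h : ∀ (k : ℕ) (a b : Fin k → Fin n), Function.Injective r → Function.Injective c →
      (∀ e, Sum.inr e ∈ Set.range c → e ∈ Set.range r) →
      Function.Injective a → Function.Injective b →
      (∀ i, i ∈ Set.range a ↔ i ∈ Set.range r ∧ Sum.inr i ∉ Set.range c) →
      (∀ j, j ∈ Set.range b ↔ Sum.inl j ∈ Set.range c) → (Y.submatrix a b).det = 0) :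
    (Matrix.of fun x y => Y.augCol (c y) (r x)).det = 0 := by
  classical
  by_cases hr : Function.Injective r
  swap
  · simp only [Function.Injective, not_forall] at hr
    obtain ⟨x, x', hxx, hne⟩ := hr
    exact Matrix.det_zero_of_row_eq hne (by ext y; simp [hxx])
  by_cases hc : Function.Injective c
  swap
  · simp only [Function.Injective, not_forall] at hc
    obtain ⟨x, x', hxx, hne⟩ := hc
    exact Matrix.det_zero_of_column_eq hne (by intro y; simp [hxx])
  by_cases hE : ∀ e, Sum.inr e ∈ Set.range c → e ∈ Set.range r
  swap
  · push Not at hE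
    obtain ⟨e, ⟨y, hy⟩, he⟩ := hE
    refine Matrix.det_eq_zero_of_column_eq_zero y fun x => ?_
    have : r x ≠ e := fun h => he ⟨x, h⟩
    simp [hy, Matrix.augCol, this]
  let S : Finset (Fin n) := Finset.univ.filter fun i => i ∈ Set.range r ∧ Sum.inr i ∉ Set.range c
  let S' : Finset (Fin n) := Finset.univ.filter fun j => Sum.inl j ∈ Set.range c
  let E : Finset (Fin n) := Finset.univ.filter fun j => Sum.inr j ∈ Set.range c
  have h1 : S.card + E.card = Fintype.card ι := by
    rw [← Finset.card_union_of_disjoint]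
    · rw [← Finset.card_univ, ← Finset.card_image_of_injective _ hr]
      congr 1
      ext i
      simp only [S, E, Finset.mem_union, Finset.mem_filter, Finset.mem_univ, true_and,
        Finset.mem_image]
      have := hE i
      simp only [Set.mem_range] at this ⊢
      tauto
    · rw [Finset.disjoint_left]
      intro i hi hi'
      simp only [S, E, Finset.mem_filter] at hi hi'
      exact hi.2.2 hi'.2
  have h2 : S'.card + E.card = Fintype.card ι := by
    rw [← Finset.card_disjSum, ← Finset.card_univ, ← Finset.card_image_of_injective _ hc]
    congr 1
    ext (i | i) <;> simp [S', E]
  have hcard : S'.card = S.card := by omega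
  obtain ⟨ε, hε⟩ := Matrix.det_augCol Y r c hr hc (S.orderEmbOfFin rfl) (S'.orderEmbOfFin hcard)
    (RelEmbedding.injective _) (RelEmbedding.injective _) hE
    (by intro i; rw [Finset.range_orderEmbOfFin]; simp [S])
    (by intro i; rw [Finset.range_orderEmbOfFin]; simp [S'])
  rw [hε, h _ _ _ hr hc hE (RelEmbedding.injective _) (RelEmbedding.injective _)
    (by intro i; rw [Finset.range_orderEmbOfFin]; simp [S])
    (by intro i; rw [Finset.range_orderEmbOfFin]; simp [S']), smul_zero]

/-- The number of elements of `B` below `j`. -/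
def cntLt {n : ℕ} (B : Finset (Fin n)) (j : ℕ) : ℕ := (B.filter fun b => b.val < j).card

/-- The number of elements of `B` not below `i`. -/
def cntGe {n : ℕ} (B : Finset (Fin n)) (i : ℕ) : ℕ := (B.filter fun b => i ≤ b.val).card

/-- The number of elements of the interval `[i, i')` outside `B`. -/
def cntGap {n : ℕ} (B : Finset (Fin n)) (i i' : ℕ) : ℕ :=
  (Finset.univ.filter fun b : Fin n => i ≤ b.val ∧ b.val < i' ∧ b ∉ B).card

theorem cntLt_add_cntGe {n : ℕ} (B : Finset (Fin n)) (j : ℕ) :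
    cntLt B j + cntGe B j = B.card := by
  unfold cntLt cntGe
  simp_rw [← not_lt]
  exact Finset.card_filter_add_card_filter_not _

/-- The minors of `Y` with rows `P` and columns `R` vanish. -/
def Matrix.MinorVanish {Q : Type*} [CommRing Q] {n : ℕ} (Y : Matrix (Fin n) (Fin n) Q)
    (P R : Finset (Fin n)) : Prop :=
  ∀ (m : ℕ) (p q : Fin m → Fin n), Function.Injective p → Function.Injective q →
    Set.range p = P → Set.range q = R → (Y.submatrix p q).det = 0

theorem Matrix.of_elim_update {Q φ ι : Type*} [CommRing Q] [DecidableEq ι]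
    [DecidableEq φ] {n : ℕ} (r : φ ⊕ ι → Fin n) (F : φ → Fin n → Q) (v : ι → Fin n → Q) (i : ι)
    (z : Fin n → Q) : (Matrix.of fun x y => Sum.elim F (Function.update v i z) y (r x)) =
        (Matrix.of fun x y => Sum.elim F v y (r x)).updateCol (Sum.inr i) (fun x => z (r x)) := by
  ext x (y | y)
  · simp only [Matrix.of_apply, Sum.elim_inl, Matrix.updateCol_apply, reduceCtorEq, if_false]
  · by_cases hy : y = i
    · subst hy
      simp only [Matrix.of_apply, Sum.elim_inr, Matrix.updateCol_apply, if_true,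
        Function.update_self]
    · simp only [Matrix.of_apply, Sum.elim_inr, Matrix.updateCol_apply, Sum.inr.injEq, hy, if_false,
        Function.update_of_ne, ne_eq, not_false_eq_true]

/-- The alternating form obtained from a minor by letting some of its columns vary. -/
def Matrix.colForm {Q φ ι : Type*} [CommRing Q] [Fintype ι] [Fintype φ] [dι : DecidableEq ι]
    [DecidableEq φ] {n : ℕ} (r : φ ⊕ ι → Fin n) (F : φ → Fin n → Q) :
    (Fin n → Q) [⋀^ι]→ₗ[Q] Q where
  toFun v := (Matrix.of fun x y => Sum.elim F v y (r x)).det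
  map_update_add' := by
    intro dι' v i x y
    obtain rfl : dι' = dι := Subsingleton.elim _ _
    rw [Matrix.of_elim_update, Matrix.of_elim_update, Matrix.of_elim_update,
      ← Matrix.det_updateCol_add]
    rfl
  map_update_smul' := by
    intro dι' v i c y
    obtain rfl : dι' = dι := Subsingleton.elim _ _
    rw [Matrix.of_elim_update, Matrix.of_elim_update, smul_eq_mul, ← Matrix.det_updateCol_smul]
    rfl
  map_eq_zero_of_eq' := by
    intro v i j hij hne
    refine Matrix.det_zero_of_column_eq (i := Sum.inr i) (j := Sum.inr j) (by simpa using hne) ?_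
    intro x
    simp [hij]

theorem Matrix.colForm_apply {Q φ ι : Type*} [CommRing Q] [Fintype ι] [Fintype φ] [DecidableEq ι]
    [DecidableEq φ] {n : ℕ} (r : φ ⊕ ι → Fin n) (F : φ → Fin n → Q) (v : ι → Fin n → Q) :
    Matrix.colForm r F v = (Matrix.of fun x y => Sum.elim F v y (r x)).det := rfl

theorem Matrix.colForm_augCol {Q φ ι : Type*} [CommRing Q] [Fintype ι] [Fintype φ] [DecidableEq ι]
    [DecidableEq φ] {n : ℕ} (Y : Matrix (Fin n) (Fin n) Q) (r : φ ⊕ ι → Fin n)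
    (f : φ → Fin n ⊕ Fin n) (c : ι → Fin n ⊕ Fin n) :
    Matrix.colForm r (fun x => Y.augCol (f x)) (fun x => Y.augCol (c x)) =
      (Matrix.of fun x y => Y.augCol (Sum.elim f c y) (r x)).det := by
  rw [Matrix.colForm_apply]
  congr 1
  ext x (y | y) <;> rfl

open Classical in
/-- Straightening in the columns: a product of minors vanishes if the second minor has too many
columns among the first ones, provided the minors smaller than the first factor vanish. -/
theorem Matrix.minor_mul_minor_eq_zero_of_col {Q : Type*} [CommRing Q] {n : ℕ}
    (X : Matrix (Fin n) (Fin n) Q) {k k' : ℕ} (a b : Fin k → Fin n) (a' b' : Fin k' → Fin n)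
    (ha : Function.Injective a) (hb : Function.Injective b) (ha' : Function.Injective a')
    (hb' : Function.Injective b') (A B B' : Finset (Fin n)) (hA : Set.range a = A)
    (hB : Set.range b = B) (hB' : Set.range b' = B') (j : ℕ) (hj : cntLt B j < cntLt B' j)
    (H : ∀ P R : Finset (Fin n), P.card = R.card → A ⊆ P → (∀ i, cntLt B i ≤ cntLt R i) →
      R ≠ B → X.MinorVanish P R) :
    (X.submatrix a b).det * (X.submatrix a' b').det = 0 := by
  obtain ⟨A', hA'⟩ : ∃ A' : Finset (Fin n), Set.range a' = A' :=
    ⟨Finset.univ.image a', by simp⟩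
  have cardA : ∀ {l : ℕ} (f : Fin l → Fin n) (S : Finset (Fin n)), Function.Injective f →
      Set.range f = S → S.card = l := by
    intro l f S hf hS
    have : S = Finset.univ.image f := by
      apply Finset.coe_injective; rw [← hS]; simp
    rw [this, Finset.card_image_of_injective _ hf, Finset.card_univ, Fintype.card_fin]
  have cA := cardA a A ha hA
  have cB := cardA b B hb hB
  have cA' := cardA a' A' ha' hA'
  have cB' := cardA b' B' hb' hB'
  let B0 := B.filter fun x => x.val < j
  let B1 := B.filter fun x => ¬ x.val < j
  let B0' := B'.filter fun x => x.val < j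
  let B1' := B'.filter fun x => ¬ x.val < j
  have hB01 : B0.card + B1.card = B.card := Finset.card_filter_add_card_filter_not _
  have hB01' : B0'.card + B1'.card = B'.card := Finset.card_filter_add_card_filter_not _
  have hAc : A.card + Aᶜ.card = n := by simp
  have hAc' : A'.card + A'ᶜ.card = n := by simp
  have hj' : B0.card < B0'.card := hj
  let e : B0 ⊕ (B1 ⊕ (Aᶜ : Finset (Fin n))) ≃ Fin n := Fintype.equivOfCardEq (by
    simp only [Fintype.card_sum, Fintype.card_coe, Fintype.card_fin]; omega)
  let e' : (B1' ⊕ (A'ᶜ : Finset (Fin n))) ⊕ B0' ≃ Fin n := Fintype.equivOfCardEq (by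
    simp only [Fintype.card_sum, Fintype.card_coe, Fintype.card_fin]; omega)
  let f : B0 → Fin n ⊕ Fin n := fun x => Sum.inl x.1
  let f' : B1' ⊕ (A'ᶜ : Finset (Fin n)) → Fin n ⊕ Fin n := Sum.map Subtype.val Subtype.val
  let c : (B1 ⊕ (Aᶜ : Finset (Fin n))) ⊕ B0' → Fin n ⊕ Fin n :=
    Sum.elim (Sum.map Subtype.val Subtype.val) (fun x => Sum.inl x.1)
  have key := AlternatingMap.mul_eq_zero_of_shuffle (Matrix.colForm e (fun x => X.augCol (f x)))
    (Matrix.colForm e' (fun x => X.augCol (f' x))) (fun x => X.augCol (c x)) ?_ ?_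
  · rw [Matrix.colForm_augCol, Matrix.colForm_augCol] at key
    obtain ⟨ε, hε⟩ := Matrix.det_augCol X e (Sum.elim f fun i => c (Sum.inl i)) e.injective
      (by
        rintro (x | x | x) (y | y | y) hxy <;> simp [f, c] at hxy ⊢
        · exact hxy
        · have h1 := (Finset.mem_filter.1 x.2).2
          have h2 := (Finset.mem_filter.1 y.2).2
          rw [hxy] at h1; exact h2 h1
        · have h1 := (Finset.mem_filter.1 x.2).2
          have h2 := (Finset.mem_filter.1 y.2).2
          rw [hxy] at h1; exact h1 h2
        · exact hxy
        · exact hxy) a b ha hb (by simp)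
      (by
        intro i
        rw [hA]
        simp [f, c])
      (by
        intro i
        rw [hB]
        simp only [Finset.mem_coe, Set.mem_range, Sum.exists, Sum.elim_inl, Sum.elim_inr, f, c,
          Sum.map_inl, Sum.map_inr, Sum.inl.injEq, reduceCtorEq, exists_false, or_false,
          Subtype.exists, exists_prop, exists_eq_right, B0, B1, Finset.mem_filter]
        tauto)
    obtain ⟨ε', hε'⟩ := Matrix.det_augCol X e' (Sum.elim f' fun i => c (Sum.inr i)) e'.injective
      (by
        rintro ((x | x) | x) ((y | y) | y) hxy <;> simp [f', c] at hxy ⊢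
        · exact hxy
        · have h1 := (Finset.mem_filter.1 x.2).2
          have h2 := (Finset.mem_filter.1 y.2).2
          rw [hxy] at h1; exact h1 h2
        · exact hxy
        · have h1 := (Finset.mem_filter.1 x.2).2
          have h2 := (Finset.mem_filter.1 y.2).2
          rw [hxy] at h1; exact h2 h1
        · exact hxy) a' b' ha' hb' (by simp)
      (by
        intro i
        rw [hA']
        simp [f', c])
      (by
        intro i
        rw [hB']
        simp only [Finset.mem_coe, Set.mem_range, Sum.exists, Sum.elim_inl, Sum.elim_inr, f', c,
          Sum.map_inl, Sum.map_inr, Sum.inl.injEq, reduceCtorEq, exists_false, or_false,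
          Subtype.exists, exists_prop, exists_eq_right, B0', B1', Finset.mem_filter]
        tauto)
    rw [hε, hε', smul_mul_smul_comm] at key
    exact (smul_eq_zero_iff_eq _).1 key
  · intro γ
    apply AlternatingMap.apply_eq_zero_of_minors
    intro e r hr
    have := Fintype.card_le_of_injective r hr
    simp only [Fintype.card_sum, Fintype.card_coe, Fintype.card_fin] at this
    omega
  · rintro σ ⟨i₀, w₀, hw₀⟩
    rw [Matrix.colForm_augCol X e f (fun i => c (σ (Sum.inl i)))]
    apply Matrix.det_augCol_eq_zero
    intro m p q _ hc _ hp hq hpr hqr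
    obtain ⟨P, hP⟩ : ∃ P : Finset (Fin n), Set.range p = P := ⟨Finset.univ.image p, by simp⟩
    obtain ⟨R, hR⟩ : ∃ R : Finset (Fin n), Set.range q = R := ⟨Finset.univ.image q, by simp⟩
    have cP := cardA p P hp hP
    have cR := cardA q R hq hR
    have hAP : A ⊆ P := by
      intro x hx
      rw [← Finset.mem_coe, ← hP, hpr]
      refine ⟨⟨e.symm x, by simp⟩, ?_⟩
      rintro ⟨y | y, hy⟩
      · simp [f] at hy
      · rcases hs : σ (Sum.inl y) with (z | z) | z <;> simp [hs, c] at hy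
        exact (Finset.mem_compl.1 z.2) (hy ▸ hx)
    have hw₀R : w₀.1 ∈ R := by
      rw [← Finset.mem_coe, ← hR, hqr]
      exact ⟨Sum.inr i₀, by simp [hw₀, c]⟩
    have hw₀B : w₀.1 ∉ B := by
      intro hw
      have h1 := (Finset.mem_filter.1 w₀.2).2
      have : (Sum.elim f fun i => c (σ (Sum.inl i))) (Sum.inl ⟨w₀.1, Finset.mem_filter.2 ⟨hw, h1⟩⟩)
          = (Sum.elim f fun i => c (σ (Sum.inl i))) (Sum.inr i₀) := by
        simp [f, c, hw₀]
      simpa using hc this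
    have hB0R : B0 ⊆ R := by
      intro x hx
      rw [← Finset.mem_coe, ← hR, hqr]
      exact ⟨Sum.inl ⟨x, hx⟩, rfl⟩
    have hRB : ∀ x ∈ R, x ∈ B ∨ x.val < j := by
      intro x hx
      rw [← Finset.mem_coe, ← hR, hqr] at hx
      obtain ⟨y | y, hy⟩ := hx
      · simp only [f, Sum.elim_inl, Sum.inl.injEq] at hy
        exact Or.inl (hy ▸ (Finset.mem_filter.1 y.2).1)
      · rcases hs : σ (Sum.inl y) with (z | z) | z <;> simp [hs, c] at hy
        · exact Or.inl (hy ▸ (Finset.mem_filter.1 z.2).1)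
        · exact Or.inr (hy ▸ (Finset.mem_filter.1 z.2).2)
    refine H P R (cP.trans cR.symm) hAP ?_ ?_ m p q hp hq hP hR
    · intro i
      by_cases hij : i ≤ j
      · apply Finset.card_le_card
        intro x hx
        rw [Finset.mem_filter] at hx ⊢
        exact ⟨hB0R (Finset.mem_filter.2 ⟨hx.1, by omega⟩), hx.2⟩
      · have h1 := cntLt_add_cntGe B i
        have h2 := cntLt_add_cntGe R i
        have h3 : cntGe R i ≤ cntGe B i := by
          apply Finset.card_le_card
          intro x hx
          rw [Finset.mem_filter] at hx ⊢
          refine ⟨(hRB x hx.1).resolve_right (by omega), hx.2⟩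
        have h4 := Finset.card_le_card hAP
        omega
    · intro h
      exact hw₀B (h ▸ hw₀R)

theorem card_eq_of_range_eq {n l : ℕ} {f : Fin l → Fin n} {S : Finset (Fin n)}
    (hf : Function.Injective f) (hS : Set.range f = S) : S.card = l := by
  have : S = Finset.univ.image f := by
    apply Finset.coe_injective; rw [← hS]; simp
  rw [this, Finset.card_image_of_injective _ hf, Finset.card_univ, Fintype.card_fin]

theorem cntLt_le_of_exchange {n : ℕ} {B R : Finset (Fin n)} {j : ℕ} (hcard : B.card ≤ R.card)
    (hBR : ∀ x ∈ B, x.val < j → x ∈ R) (hRB : ∀ x ∈ R, x ∈ B ∨ x.val < j) (i : ℕ) :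
    cntLt B i ≤ cntLt R i := by
  by_cases hij : i ≤ j
  · apply Finset.card_le_card
    intro x hx
    rw [Finset.mem_filter] at hx ⊢
    exact ⟨hBR x hx.1 (by omega), hx.2⟩
  · have h1 := cntLt_add_cntGe B i
    have h2 := cntLt_add_cntGe R i
    have h3 : cntGe R i ≤ cntGe B i := by
      apply Finset.card_le_card
      intro x hx
      rw [Finset.mem_filter] at hx ⊢
      refine ⟨(hRB x hx.1).resolve_right (by omega), hx.2⟩
    omega

theorem Matrix.mulVec_augCol_inr {Q : Type*} [CommRing Q] {n : ℕ} (X Y : Matrix (Fin n) (Fin n) Q)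
    (e : Fin n) : X *ᵥ Y.augCol (Sum.inr e) = X.augCol (Sum.inl e) := by
  ext i
  simp [Matrix.augCol, Matrix.mulVec, dotProduct]

theorem Matrix.mulVec_augCol_inl {Q : Type*} [CommRing Q] {n : ℕ} (X Y : Matrix (Fin n) (Fin n) Q)
    (h : X * Y = 0) (e : Fin n) : X *ᵥ Y.augCol (Sum.inl e) = 0 := by
  ext i
  exact congrFun (congrFun h i) e

open Classical in
/-- A product of a minor of `X` and a minor of `T` with `X * T = 0` vanishes if the second minor
has too many rows among the last ones. -/
theorem Matrix.minor_mul_minor_eq_zero_of_mul {Q : Type*} [CommRing Q] {n : ℕ}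
    (X T : Matrix (Fin n) (Fin n) Q) (hXT : X * T = 0) {k k' : ℕ} (a b : Fin k → Fin n)
    (a' b' : Fin k' → Fin n) (ha : Function.Injective a) (hb : Function.Injective b)
    (ha' : Function.Injective a') (hb' : Function.Injective b') (A B A' B' : Finset (Fin n))
    (hA : Set.range a = A) (hB : Set.range b = B) (hA' : Set.range a' = A')
    (hB' : Set.range b' = B') (i i' t : ℕ) (ht : t + cntGap B i i' < cntGe B' i)
    (H : ∀ R : Finset (Fin n), R.card = B.card → (∀ i, cntLt B i ≤ cntLt R i) →
      R ≠ B → X.MinorVanish A R)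
    (HT : ∀ P : Finset (Fin n), P.card = B'.card → t < cntGe P i' → T.MinorVanish P A') :
    (X.submatrix a b).det * (T.submatrix b' a').det = 0 := by
  have cA := card_eq_of_range_eq ha hA
  have cB := card_eq_of_range_eq hb hB
  have cA' := card_eq_of_range_eq ha' hA'
  have cB' := card_eq_of_range_eq hb' hB'
  let Bm := B.filter fun x => i ≤ x.val ∧ x.val < i'
  let Bo := B.filter fun x => ¬ (i ≤ x.val ∧ x.val < i')
  let Lo : Finset (Fin n) := Finset.univ.filter fun x => x.val < i ∧ x ∉ B'
  have hBmo : Bm.card + Bo.card = B.card := Finset.card_filter_add_card_filter_not _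
  let e : Bo ⊕ Bm ≃ Fin k := Fintype.equivOfCardEq (by
    simp only [Fintype.card_sum, Fintype.card_coe, Fintype.card_fin]; omega)
  let e' : Fin 0 ⊕ (A' ⊕ Lo) ≃ B' ⊕ Lo := Fintype.equivOfCardEq (by
    simp only [Fintype.card_sum, Fintype.card_coe, Fintype.card_fin]; omega)
  let r' : Fin 0 ⊕ (A' ⊕ Lo) → Fin n := Sum.elim Subtype.val Subtype.val ∘ e'
  let f : Bo → Fin n ⊕ Fin n := fun x => Sum.inl x.1
  let f' : Fin 0 → Fin n ⊕ Fin n := fun x => x.elim0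
  let c : Bm ⊕ (A' ⊕ Lo) → Fin n ⊕ Fin n :=
    Sum.elim (fun x => Sum.inr x.1) (Sum.map Subtype.val Subtype.val)
  have hr' : Function.Injective r' := by
    refine Function.Injective.comp ?_ e'.injective
    rintro (x | x) (y | y) hxy <;> simp at hxy ⊢
    · exact hxy
    · exact (Finset.mem_filter.1 y.2).2.2 (hxy ▸ x.2)
    · exact (Finset.mem_filter.1 x.2).2.2 (hxy ▸ y.2)
    · exact hxy
  have hr'mem : ∀ x, x ∈ Set.range r' ↔ x ∈ B' ∨ x ∈ Lo := by
    intro x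
    rw [e'.surjective.range_comp]
    simp
  have hdet : ∀ g : Bm → Fin n, Matrix.colForm (a ∘ e) (fun x => X.augCol (f x))
      (fun z => X.augCol (Sum.inl (g z))) = (Matrix.of fun x y =>
        X.augCol (Sum.elim f (fun z => Sum.inl (g z)) y) ((a ∘ e) x)).det :=
    fun g => Matrix.colForm_augCol X (a ∘ e) f (fun z => Sum.inl (g z))
  have hrange : Set.range (a ∘ e) = A := by rw [e.surjective.range_comp, hA]
  have key := AlternatingMap.mul_eq_zero_of_shuffle
    ((Matrix.colForm (a ∘ e) (fun x => X.augCol (f x))).compLinearMap X.mulVecLin)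
    (Matrix.colForm r' (fun x => T.augCol (f' x))) (fun x => T.augCol (c x)) ?_ ?_
  · rw [Matrix.colForm_augCol, AlternatingMap.compLinearMap_apply] at key
    have h1 : (fun z : Bm => X.mulVecLin (T.augCol (c (Sum.inl z)))) =
        fun z => X.augCol (Sum.inl z.1) := by
      funext z
      rw [Matrix.mulVecLin_apply]
      exact Matrix.mulVec_augCol_inr X T z.1
    rw [h1, hdet (fun z => z.1)] at key
    obtain ⟨ε, hε⟩ := Matrix.det_augCol X (a ∘ e) (Sum.elim f (fun z : Bm => Sum.inl z.1))
      (ha.comp e.injective)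
      (by
        rintro (x | x) (y | y) hxy <;> simp [f] at hxy ⊢
        · exact hxy
        · have h1 := (Finset.mem_filter.1 x.2).2
          have h2 := (Finset.mem_filter.1 y.2).2
          rw [hxy] at h1; exact h1 h2
        · have h1 := (Finset.mem_filter.1 x.2).2
          have h2 := (Finset.mem_filter.1 y.2).2
          rw [hxy] at h1; exact h2 h1
        · exact hxy) a b ha hb (by simp [f])
      (by
        intro x
        rw [hA, hrange]
        simp [f])
      (by
        intro x
        rw [hB]
        simp only [Finset.mem_coe, Set.mem_range, Sum.exists, Sum.elim_inl, Sum.elim_inr, f,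
          Sum.inl.injEq, Subtype.exists, exists_prop, exists_eq_right, Bm, Bo, Finset.mem_filter]
        tauto)
    obtain ⟨ε', hε'⟩ := Matrix.det_augCol T r' (Sum.elim f' fun z => c (Sum.inr z)) hr'
      (by
        rintro (x | x | x) (y | y | y) hxy
        · exact x.elim0
        · exact x.elim0
        · exact x.elim0
        · exact y.elim0
        · simpa [c] using hxy
        · simp [c] at hxy
        · exact y.elim0
        · simp [c] at hxy
        · simpa [c] using hxy) b' a' hb' ha'
      (by
        rintro y ⟨x | x | x, hx⟩
        · exact x.elim0
        · simp [c] at hx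
        · simp only [c, Sum.elim_inr, Sum.map_inr, Sum.inr.injEq] at hx
          exact (hr'mem y).2 (Or.inr (hx ▸ x.2)))
      (by
        intro x
        rw [hB', hr'mem]
        simp only [Finset.mem_coe, Set.mem_range, Sum.exists, Sum.elim_inr, c, Sum.map_inl,
          Sum.map_inr, reduceCtorEq, exists_false, false_or, Sum.inr.injEq, Subtype.exists,
          exists_prop, exists_eq_right, IsEmpty.exists_iff]
        have : x ∈ Lo → x ∉ B' := fun h => (Finset.mem_filter.1 h).2.2
        tauto)
      (by
        intro x
        rw [hA']
        simp [c])
    rw [hε, hε', smul_mul_smul_comm] at key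
    exact (smul_eq_zero_iff_eq _).1 key
  · intro γ
    apply AlternatingMap.apply_eq_zero_of_minors
    intro e₀ r hr
    rw [← Matrix.det_transpose]
    refine Matrix.det_augCol_eq_zero T r (fun y => c (e₀.symm y)) ?_
    intro m p q _ _ _ hp hq hpr hqr
    obtain ⟨P, hP⟩ : ∃ P : Finset (Fin n), Set.range p = P := ⟨Finset.univ.image p, by simp⟩
    have hc : Set.range (fun y => c (e₀.symm y)) = Set.range c :=
      e₀.symm.surjective.range_comp c
    rw [hc] at hpr hqr
    have hqA' : Set.range q = A' := by
      ext x
      rw [hqr]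
      simp [c]
    have cP := card_eq_of_range_eq hp hP
    have cm := card_eq_of_range_eq hq hqA'
    refine HT P (by omega) ?_ m p q hp hq hP hqA'
    have hsub : cntLt P i' ≤ cntLt B' i + cntGap B i i' := by
      refine le_trans (Finset.card_le_card ?_) (Finset.card_union_le _ _)
      intro x hx
      rw [Finset.mem_filter] at hx
      have hxP := hx.1
      rw [← Finset.mem_coe, hP.symm, hpr] at hxP
      have h1 : x ∉ Bm := fun h => hxP.2 ⟨Sum.inl ⟨x, h⟩, rfl⟩
      have h2 : x ∉ Lo := fun h => hxP.2 ⟨Sum.inr (Sum.inr ⟨x, h⟩), rfl⟩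
      simp only [Bm, Lo, Finset.mem_filter, Finset.mem_univ, true_and] at h1 h2
      simp only [Finset.mem_union, Finset.mem_filter, Finset.mem_univ, true_and]
      by_cases hxi : x.val < i
      · left; exact ⟨by tauto, hxi⟩
      · right; exact ⟨by omega, hx.2, fun h => h1 ⟨h, by omega, hx.2⟩⟩
    have h1 := cntLt_add_cntGe P i'
    have h2 := cntLt_add_cntGe B' i
    omega
  · rintro σ ⟨i₀, w₀, hw₀⟩
    rw [AlternatingMap.compLinearMap_apply]
    by_cases hz : ∃ z x, c (σ (Sum.inl z)) = Sum.inl x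
    · obtain ⟨z, x, hx⟩ := hz
      apply AlternatingMap.map_coord_zero _ z
      simp only [hx, Matrix.mulVecLin_apply]
      exact Matrix.mulVec_augCol_inl X T hXT x
    · have hz' : ∀ z, ∃ x, c (σ (Sum.inl z)) = Sum.inr x := by
        intro z
        rcases hs : c (σ (Sum.inl z)) with x | x
        · exact absurd ⟨z, x, hs⟩ hz
        · exact ⟨x, rfl⟩
      choose g hg using hz'
      have h1 : (fun z : Bm => X.mulVecLin (T.augCol (c (σ (Sum.inl z))))) =
          fun z => X.augCol (Sum.inl (g z)) := by
        funext z
        simp only [hg, Matrix.mulVecLin_apply]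
        exact Matrix.mulVec_augCol_inr X T _
      rw [h1, hdet g]
      apply Matrix.det_augCol_eq_zero
      intro m p q _ hc _ hp hq hpr hqr
      have hpA : Set.range p = A := by
        ext x
        rw [hpr, hrange]
        simp [f]
      obtain ⟨R, hR⟩ : ∃ R : Finset (Fin n), Set.range q = R := ⟨Finset.univ.image q, by simp⟩
      have cP := card_eq_of_range_eq hp hpA
      have cR := card_eq_of_range_eq hq hR
      have hgmem : ∀ z, g z ∈ Bm ∨ g z ∈ Lo := by
        intro z
        have := hg z
        rcases hs : σ (Sum.inl z) with y | y | y <;> simp [hs, c] at this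
        · exact Or.inl (this ▸ y.2)
        · exact Or.inr (this ▸ y.2)
      have hg₀ : g i₀ ∈ Lo := by
        have := hg i₀
        rw [hw₀] at this
        rcases w₀ with y | y <;> simp [c] at this
        exact this ▸ y.2
      have hgR : ∀ z, g z ∈ R := by
        intro z
        rw [← Finset.mem_coe, ← hR, hqr]
        exact ⟨Sum.inr z, rfl⟩
      have hBoR : ∀ x ∈ Bo, x ∈ R := by
        intro x hx
        rw [← Finset.mem_coe, ← hR, hqr]
        exact ⟨Sum.inl ⟨x, hx⟩, rfl⟩
      have hg₀lt : (g i₀).val < i := (Finset.mem_filter.1 hg₀).2.1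
      have hg₀B : g i₀ ∉ B := by
        intro hw
        have h2 : g i₀ ∈ Bo := Finset.mem_filter.2 ⟨hw, by omega⟩
        have : (Sum.elim f fun z : Bm => Sum.inl (g z)) (Sum.inl ⟨g i₀, h2⟩)
            = (Sum.elim f fun z : Bm => Sum.inl (g z)) (Sum.inr i₀) := by
          simp [f]
        simpa using hc this
      refine H R (by omega) (cntLt_le_of_exchange (j := i) (by omega) ?_ ?_) ?_ m p q hp hq hpA hR
      · intro x hx hxi
        exact hBoR x (Finset.mem_filter.2 ⟨hx, by omega⟩)
      · intro x hx
        rw [← Finset.mem_coe, ← hR, hqr] at hx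
        obtain ⟨y | y, hy⟩ := hx
        · simp only [f, Sum.elim_inl, Sum.inl.injEq] at hy
          exact Or.inl (hy ▸ (Finset.mem_filter.1 y.2).1)
        · simp only [Sum.elim_inr, Sum.inl.injEq] at hy
          rw [← hy]
          rcases hgmem y with h | h
          · exact Or.inl (Finset.mem_filter.1 h).1
          · exact Or.inr (Finset.mem_filter.1 h).2.1
      · intro h
        exact hg₀B (h ▸ hgR i₀)

/-- The partial order on minors: `[A|B] ≤ [A'|B']`. -/
def MinorLe {n : ℕ} (d d' : Finset (Fin n) × Finset (Fin n)) : Prop :=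
  ∀ j, cntLt d'.1 j ≤ cntLt d.1 j ∧ cntLt d'.2 j ≤ cntLt d.2 j

theorem MinorLe.trans {n : ℕ} {d d' d'' : Finset (Fin n) × Finset (Fin n)} (h : MinorLe d d')
    (h' : MinorLe d' d'') : MinorLe d d'' :=
  fun j => ⟨(h' j).1.trans (h j).1, (h' j).2.trans (h j).2⟩

theorem cntLt_mono {n : ℕ} {A P : Finset (Fin n)} (h : A ⊆ P) (j : ℕ) : cntLt A j ≤ cntLt P j :=
  Finset.card_le_card (Finset.filter_subset_filter _ h)

/-- The sharpest rank bounds compatible with a pivot set `B`. -/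
noncomputable def rhoStar {n : ℕ} (B : Finset (Fin n)) (ρ : ℕ → ℕ) (i : ℕ) : ℕ :=
  sInf {t | ∃ i', i ≤ i' ∧ t = ρ i' + cntGap B i i'}

theorem rhoStar_spec {n : ℕ} (B : Finset (Fin n)) (ρ : ℕ → ℕ) (i : ℕ) :
    ∃ i', i ≤ i' ∧ rhoStar B ρ i = ρ i' + cntGap B i i' :=
  Nat.sInf_mem (s := {t | ∃ i', i ≤ i' ∧ t = ρ i' + cntGap B i i'}) ⟨_, i, le_rfl, rfl⟩

theorem rhoStar_le_of_le {n : ℕ} (B : Finset (Fin n)) (ρ : ℕ → ℕ) {i i' : ℕ} (h : i ≤ i') :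
    rhoStar B ρ i ≤ ρ i' + cntGap B i i' :=
  Nat.sInf_le ⟨i', h, rfl⟩

theorem cntGap_self {n : ℕ} (B : Finset (Fin n)) (i : ℕ) : cntGap B i i = 0 := by
  unfold cntGap
  rw [Finset.card_eq_zero, Finset.filter_eq_empty_iff]
  intro x _ h
  omega

theorem rhoStar_le {n : ℕ} (B : Finset (Fin n)) (ρ : ℕ → ℕ) (i : ℕ) :
    rhoStar B ρ i ≤ ρ i := by
  simpa [cntGap_self] using rhoStar_le_of_le B ρ (le_refl i)

theorem cntGap_add {n : ℕ} (B : Finset (Fin n)) {i j k : ℕ} :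
    cntGap B i k ≤ cntGap B i j + cntGap B j k := by
  unfold cntGap
  refine le_trans (Finset.card_le_card ?_) (Finset.card_union_le _ _)
  intro x hx
  simp only [Finset.mem_filter, Finset.mem_univ, true_and, Finset.mem_union] at hx ⊢
  by_cases h : x.val < j
  · exact Or.inl ⟨hx.1, h, hx.2.2⟩
  · exact Or.inr ⟨by omega, hx.2⟩

theorem rhoStar_admissible {n : ℕ} (B : Finset (Fin n)) (ρ : ℕ → ℕ) {i i' : ℕ} (h : i ≤ i') :
    rhoStar B ρ i ≤ rhoStar B ρ i' + cntGap B i i' := by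
  obtain ⟨k, hk, hk'⟩ := rhoStar_spec B ρ i'
  have h1 := rhoStar_le_of_le B ρ (h.trans hk)
  have h2 := cntGap_add B (i := i) (j := i') (k := k)
  omega

/-- The ideal generated by the entries of `X * T` and `T * X`, the minors of `X` in `Ω` and the
minors of `T` violating the rank bounds `ρW` on the last rows or `ρV` on the last columns. -/
def pairIdeal {Q : Type*} [CommRing Q] {n : ℕ} (X T : Matrix (Fin n) (Fin n) Q)
    (Ω : Set (Finset (Fin n) × Finset (Fin n))) (ρW ρV : ℕ → ℕ) : Ideal Q :=
  Ideal.span ({p | ∃ i j, p = (X * T) i j} ∪ {p | ∃ i j, p = (T * X) i j} ∪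
    {p | ∃ (m : ℕ) (a b : Fin m → Fin n), Function.Injective a ∧ Function.Injective b ∧
      (Finset.univ.image a, Finset.univ.image b) ∈ Ω ∧ p = (X.submatrix a b).det} ∪
    {p | ∃ (m : ℕ) (b a : Fin m → Fin n), Function.Injective b ∧ Function.Injective a ∧
      (∃ i, ρW i < cntGe (Finset.univ.image b) i ∨ ρV i < cntGe (Finset.univ.image a) i) ∧
      p = (T.submatrix b a).det})

section pairIdeal
variable {Q : Type*} [CommRing Q] {n : ℕ} {X T : Matrix (Fin n) (Fin n) Q}
    {Ω : Set (Finset (Fin n) × Finset (Fin n))} {ρW ρV : ℕ → ℕ}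

theorem mul_mem_pairIdeal (i j) : (X * T) i j ∈ pairIdeal X T Ω ρW ρV :=
  Ideal.subset_span (Or.inl (Or.inl (Or.inl ⟨i, j, rfl⟩)))

theorem mul_mem_pairIdeal' (i j) : (T * X) i j ∈ pairIdeal X T Ω ρW ρV :=
  Ideal.subset_span (Or.inl (Or.inl (Or.inr ⟨i, j, rfl⟩)))

theorem minor_mem_pairIdeal {m : ℕ} {a b : Fin m → Fin n} (ha : Function.Injective a)
    (hb : Function.Injective b) (h : (Finset.univ.image a, Finset.univ.image b) ∈ Ω) :
    (X.submatrix a b).det ∈ pairIdeal X T Ω ρW ρV :=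
  Ideal.subset_span (Or.inl (Or.inr ⟨m, a, b, ha, hb, h, rfl⟩))

theorem minor_mem_pairIdeal' {m : ℕ} {b a : Fin m → Fin n} (hb : Function.Injective b)
    (ha : Function.Injective a)
    (h : ∃ i, ρW i < cntGe (Finset.univ.image b) i ∨ ρV i < cntGe (Finset.univ.image a) i) :
    (T.submatrix b a).det ∈ pairIdeal X T Ω ρW ρV :=
  Ideal.subset_span (Or.inr ⟨m, b, a, hb, ha, h, rfl⟩)

theorem pairIdeal_le {J : Ideal Q} (h1 : ∀ i j, (X * T) i j ∈ J) (h2 : ∀ i j, (T * X) i j ∈ J)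
    (h3 : ∀ (m : ℕ) (a b : Fin m → Fin n), Function.Injective a → Function.Injective b →
      (Finset.univ.image a, Finset.univ.image b) ∈ Ω → (X.submatrix a b).det ∈ J)
    (h4 : ∀ (m : ℕ) (b a : Fin m → Fin n), Function.Injective b → Function.Injective a →
      (∃ i, ρW i < cntGe (Finset.univ.image b) i ∨ ρV i < cntGe (Finset.univ.image a) i) →
      (T.submatrix b a).det ∈ J) : pairIdeal X T Ω ρW ρV ≤ J := by
  refine Ideal.span_le.2 ?_
  rintro p (((⟨i, j, rfl⟩ | ⟨i, j, rfl⟩) | ⟨m, a, b, ha, hb, h, rfl⟩) | ⟨m, a, b, ha, hb, h, rfl⟩)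
  · exact h1 i j
  · exact h2 i j
  · exact h3 m a b ha hb h
  · exact h4 m a b ha hb h

theorem map_pairIdeal_le {Q' : Type*} [CommRing Q'] (φ : Q →+* Q') :
    (pairIdeal X T Ω ρW ρV).map φ ≤ pairIdeal (X.map φ) (T.map φ) Ω ρW ρV := by
  rw [Ideal.map_le_iff_le_comap]
  refine pairIdeal_le ?_ ?_ ?_ ?_
  · intro i j
    rw [Ideal.mem_comap, ← Matrix.map_apply (M := X * T) (f := φ), Matrix.map_mul]
    exact mul_mem_pairIdeal i j
  · intro i j
    rw [Ideal.mem_comap, ← Matrix.map_apply (M := T * X) (f := φ), Matrix.map_mul]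
    exact mul_mem_pairIdeal' i j
  · intro m a b ha hb h
    rw [Ideal.mem_comap, RingHom.map_det]
    exact minor_mem_pairIdeal ha hb h
  · intro m a b ha hb h
    rw [Ideal.mem_comap, RingHom.map_det]
    exact minor_mem_pairIdeal' ha hb h

end pairIdeal

theorem coe_image_univ {n m : ℕ} (a : Fin m → Fin n) :
    Set.range a = ((Finset.univ.image a : Finset (Fin n)) : Set (Fin n)) := by simp

theorem image_univ_eq {n m : ℕ} {a : Fin m → Fin n} {A : Finset (Fin n)} (h : Set.range a = A) :
    Finset.univ.image a = A := by
  apply Finset.coe_injective; rw [← h]; simp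

theorem minor_mul_eq_zero {Q : Type*} [CommRing Q] {n : ℕ}
    {X T : Matrix (Fin n) (Fin n) Q} {Ω : Set (Finset (Fin n) × Finset (Fin n))} {ρW ρV : ℕ → ℕ}
    (hXT : pairIdeal X T Ω ρW ρV = ⊥) {k : ℕ} {a b : Fin k → Fin n} (ha : Function.Injective a)
    (hb : Function.Injective b) (A B : Finset (Fin n)) (hA : Set.range a = A)
    (hB : Set.range b = B)
    (hmin : ∀ d : Finset (Fin n) × Finset (Fin n), d.1.card = d.2.card → MinorLe d (A, B) →
      d ≠ (A, B) → d ∈ Ω) {y : Q}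
    (hy : y ∈ pairIdeal X T {d | ¬ MinorLe (A, B) d} (rhoStar B ρW) (rhoStar A ρV)) :
    (X.submatrix a b).det * y = 0 := by
  have cA := card_eq_of_range_eq ha hA
  have cB := card_eq_of_range_eq hb hB
  have e1 : X * T = 0 := by
    ext i j
    have := mul_mem_pairIdeal (X := X) (T := T) (Ω := Ω) (ρW := ρW) (ρV := ρV) i j
    rwa [hXT] at this
  have e2 : T * X = 0 := by
    ext i j
    have := mul_mem_pairIdeal' (X := X) (T := T) (Ω := Ω) (ρW := ρW) (ρV := ρV) i j
    rwa [hXT] at this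
  have e3 : ∀ P R, (P, R) ∈ Ω → X.MinorVanish P R := by
    intro P R h m p q hp hq hP hR
    have := minor_mem_pairIdeal (X := X) (T := T) (Ω := Ω) (ρW := ρW) (ρV := ρV) hp hq
      (by rwa [image_univ_eq hP, image_univ_eq hR])
    rwa [hXT] at this
  have e4 : ∀ P R, (∃ i, ρW i < cntGe P i ∨ ρV i < cntGe R i) → T.MinorVanish P R := by
    intro P R h m p q hp hq hP hR
    have := minor_mem_pairIdeal' (X := X) (T := T) (Ω := Ω) (ρW := ρW) (ρV := ρV) hp hq
      (by rwa [image_univ_eq hP, image_univ_eq hR])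
    rwa [hXT] at this
  have tr : ∀ (Y : Matrix (Fin n) (Fin n) Q) (P R : Finset (Fin n)), Y.MinorVanish P R →
      Yᵀ.MinorVanish R P := by
    intro Y P R h m p q hp hq hP hR
    rw [← Matrix.transpose_submatrix, Matrix.det_transpose]
    exact h m q p hq hp hR hP
  suffices pairIdeal X T {d | ¬ MinorLe (A, B) d} (rhoStar B ρW) (rhoStar A ρV) ≤
      LinearMap.ker (LinearMap.mulLeft Q (X.submatrix a b).det) from this hy
  refine pairIdeal_le ?_ ?_ ?_ ?_
  · simp [e1]
  · simp [e2]
  · intro m a' b' ha' hb' h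
    rw [LinearMap.mem_ker, LinearMap.mulLeft_apply]
    simp only [Set.mem_ofPred_eq, MinorLe, not_forall, not_and_or, not_le] at h
    obtain ⟨j, h | h⟩ := h
    · have := Matrix.minor_mul_minor_eq_zero_of_col Xᵀ b a b' a' hb ha hb' ha' B A _ hB hA
        (coe_image_univ a') j h (by
          intro P R hPR hBP hRA hne
          refine tr _ _ _ (e3 R P (hmin (R, P) hPR.symm ?_ ?_))
          · exact fun j => ⟨hRA j, cntLt_mono hBP j⟩
          · simp [hne])
      rwa [← Matrix.transpose_submatrix, ← Matrix.transpose_submatrix, Matrix.det_transpose,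
        Matrix.det_transpose] at this
    · refine Matrix.minor_mul_minor_eq_zero_of_col X a b a' b' ha hb ha' hb' A B _ hA hB
        (coe_image_univ b') j h ?_
      intro P R hPR hAP hRB hne
      refine e3 P R (hmin (P, R) hPR ?_ ?_)
      · exact fun j => ⟨cntLt_mono hAP j, hRB j⟩
      · simp [hne]
  · intro m b' a' hb' ha' h
    rw [LinearMap.mem_ker, LinearMap.mulLeft_apply]
    obtain ⟨i, h | h⟩ := h
    · obtain ⟨i', -, hi'⟩ := rhoStar_spec B ρW i
      rw [hi'] at h
      refine Matrix.minor_mul_minor_eq_zero_of_mul X T e1 a b a' b' ha hb ha' hb' A B _ _ hA hB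
        (coe_image_univ a') (coe_image_univ b') i i' _ h ?_ ?_
      · intro R hR hRB hne
        exact e3 A R (hmin (A, R) (by simp only; omega) (fun j => ⟨le_rfl, hRB j⟩) (by simp [hne]))
      · intro P _ hP
        exact e4 _ _ ⟨i', Or.inl hP⟩
    · obtain ⟨i', -, hi'⟩ := rhoStar_spec A ρV i
      rw [hi'] at h
      have := Matrix.minor_mul_minor_eq_zero_of_mul Xᵀ Tᵀ
        (by rw [← Matrix.transpose_mul, e2, Matrix.transpose_zero]) b a b' a' hb ha hb' ha' B A _ _
        hB hA (coe_image_univ b') (coe_image_univ a') i i' _ h (by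
          intro R hR hRA hne
          exact tr _ _ _ (e3 R B (hmin (R, B) (by simp only; omega) (fun j => ⟨hRA j, le_rfl⟩)
            (by simp [hne])))) (by
          intro P _ hP
          exact tr _ _ _ (e4 _ _ ⟨i', Or.inr hP⟩))
      rwa [← Matrix.transpose_submatrix, ← Matrix.transpose_submatrix, Matrix.det_transpose,
        Matrix.det_transpose] at this

theorem minor_mul_mem_pairIdeal {Q : Type*} [CommRing Q] {n : ℕ}
    {X T : Matrix (Fin n) (Fin n) Q} {Ω : Set (Finset (Fin n) × Finset (Fin n))} {ρW ρV : ℕ → ℕ}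
    {k : ℕ} {a b : Fin k → Fin n} (ha : Function.Injective a)
    (hb : Function.Injective b) (A B : Finset (Fin n)) (hA : Set.range a = A)
    (hB : Set.range b = B)
    (hmin : ∀ d : Finset (Fin n) × Finset (Fin n), d.1.card = d.2.card → MinorLe d (A, B) →
      d ≠ (A, B) → d ∈ Ω) {y : Q}
    (hy : y ∈ pairIdeal X T {d | ¬ MinorLe (A, B) d} (rhoStar B ρW) (rhoStar A ρV)) :
    (X.submatrix a b).det * y ∈ pairIdeal X T Ω ρW ρV := by
  set I := pairIdeal X T Ω ρW ρV with hI
  have hbot : pairIdeal (X.map (Ideal.Quotient.mk I)) (T.map (Ideal.Quotient.mk I)) Ω ρW ρV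
      = ⊥ := by
    rw [eq_bot_iff]
    have key : ∀ z ∈ I, Ideal.Quotient.mk I z = 0 := fun z hz => Ideal.Quotient.eq_zero_iff_mem.2 hz
    refine pairIdeal_le ?_ ?_ ?_ ?_
    · intro i j
      rw [← Matrix.map_mul, Matrix.map_apply]
      exact key _ (mul_mem_pairIdeal i j)
    · intro i j
      rw [← Matrix.map_mul, Matrix.map_apply]
      exact key _ (mul_mem_pairIdeal' i j)
    · intro m a b ha hb h
      rw [show (X.map (Ideal.Quotient.mk I)).submatrix a b =
        (Ideal.Quotient.mk I).mapMatrix (X.submatrix a b) from rfl, ← RingHom.map_det]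
      exact key _ (minor_mem_pairIdeal ha hb h)
    · intro m a b ha hb h
      rw [show (T.map (Ideal.Quotient.mk I)).submatrix a b =
        (Ideal.Quotient.mk I).mapMatrix (T.submatrix a b) from rfl, ← RingHom.map_det]
      exact key _ (minor_mem_pairIdeal' ha hb h)
  rw [← Ideal.Quotient.eq_zero_iff_mem, map_mul, RingHom.map_det]
  exact minor_mul_eq_zero hbot ha hb A B hA hB hmin
    (map_pairIdeal_le _ (Ideal.mem_map_of_mem _ hy))

theorem cntLt_insert {n : ℕ} {B : Finset (Fin n)} {x : Fin n} (hx : x ∉ B) (j : ℕ) :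
    cntLt (insert x B) j = cntLt B j + if x.val < j then 1 else 0 := by
  unfold cntLt
  rw [Finset.filter_insert]
  split_ifs with h
  · rw [Finset.card_insert_of_notMem (by simp [hx])]
  · rfl

theorem cntGe_insert {n : ℕ} {B : Finset (Fin n)} {x : Fin n} (hx : x ∉ B) (j : ℕ) :
    cntGe (insert x B) j = cntGe B j + if j ≤ x.val then 1 else 0 := by
  unfold cntGe
  rw [Finset.filter_insert]
  split_ifs with h
  · rw [Finset.card_insert_of_notMem (by simp [hx])]
  · rfl

theorem cntLt_erase {n : ℕ} {B : Finset (Fin n)} {x : Fin n} (hx : x ∈ B) (j : ℕ) :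
    cntLt B j = cntLt (B.erase x) j + if x.val < j then 1 else 0 := by
  rw [← cntLt_insert (by simp), Finset.insert_erase hx]

theorem cntGe_erase {n : ℕ} {B : Finset (Fin n)} {x : Fin n} (hx : x ∈ B) (j : ℕ) :
    cntGe B j = cntGe (B.erase x) j + if j ≤ x.val then 1 else 0 := by
  rw [← cntGe_insert (by simp), Finset.insert_erase hx]

theorem cntLt_le_cntLt {n : ℕ} (B : Finset (Fin n)) {i j : ℕ} (h : i ≤ j) :
    cntLt B i ≤ cntLt B j := by
  refine Finset.card_le_card fun x => ?_
  simp only [Finset.mem_filter]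
  exact fun hx => ⟨hx.1, hx.2.trans_le h⟩

theorem cntLt_eq_of_no_mem {n : ℕ} {B : Finset (Fin n)} {i j : ℕ} (h : i ≤ j)
    (hB : ∀ x ∈ B, i ≤ x.val → j ≤ x.val) : cntLt B i = cntLt B j := by
  refine le_antisymm (cntLt_le_cntLt B h) (Finset.card_le_card fun x => ?_)
  simp only [Finset.mem_filter]
  intro hx
  refine ⟨hx.1, ?_⟩
  by_contra hc
  have := hB x hx.1 (not_lt.1 hc)
  omega

theorem cntLt_succ_le {n : ℕ} {B : Finset (Fin n)} {x : Fin n} (hx : x ∈ B) {j : ℕ}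
    (h : x.val < j) : cntLt B x + 1 ≤ cntLt B j := by
  unfold cntLt
  rw [Nat.succ_le_iff]
  refine Finset.card_lt_card ?_
  rw [Finset.ssubset_iff]
  refine ⟨x, by simp, ?_⟩
  intro y hy
  simp only [Finset.mem_insert, Finset.mem_filter] at hy ⊢
  rcases hy with rfl | hy
  · exact ⟨hx, h⟩
  · exact ⟨hy.1, by omega⟩

/-- If `[x, k)` lies in `B₁` and `x ∈ B`, admissibility of `ρ` leaves room in `B₁` above `k`. -/
theorem cntGe_succ_le_of_admissible {n : ℕ} {B B₁ : Finset (Fin n)} {ρ : ℕ → ℕ}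
    (hadm : ∀ i i', i ≤ i' → ρ i ≤ ρ i' + cntGap B i i')
    {x : Fin n} (hx : x ∈ B) {k : ℕ} (hk : x.val < k)
    (hB₁ : ∀ y : Fin n, x ≤ y → y.val < k → y ∈ B₁) (hρ : cntGe B₁ x ≤ ρ x) :
    cntGe B₁ k + 1 ≤ ρ k := by
  have h1 := hadm x k hk.le
  suffices cntGap B x k + 1 + cntGe B₁ k ≤ cntGe B₁ x by omega
  unfold cntGap cntGe
  rw [← Finset.card_insert_of_notMem (a := x) (by simp [hx]), ← Finset.card_union_of_disjoint]
  · refine Finset.card_le_card fun y => ?_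
    simp only [Finset.mem_union, Finset.mem_insert, Finset.mem_filter, Finset.mem_univ, true_and]
    rintro ((rfl | h) | h)
    · exact ⟨hB₁ _ le_rfl hk, le_rfl⟩
    · exact ⟨hB₁ y h.1 h.2.1, h.1⟩
    · exact ⟨h.1, by omega⟩
  · rw [Finset.disjoint_left]
    intro y
    simp only [Finset.mem_insert, Finset.mem_filter, Finset.mem_univ, true_and]
    rintro (rfl | h) h' <;> omega

theorem exchange_induction {n : ℕ} (P : Finset (Fin n) → Finset (Fin n) → Prop)
    (hmove : ∀ (B₀ B₁ : Finset (Fin n)) (c c' : Fin n), c ∈ B₀ → c' < c → c' ∉ B₀ → c ∉ B₁ →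
      c' ∉ B₁ → P (insert c' (B₀.erase c)) B₁ → P B₀ B₁)
    (hswap : ∀ (B₀ B₁ : Finset (Fin n)) (c c' : Fin n), c ∈ B₀ → c' < c → c' ∉ B₀ → c ∉ B₁ →
      c' ∈ B₁ → P (insert c' (B₀.erase c)) (insert c (B₁.erase c')) → P B₀ B₁)
    (hmono : ∀ (B₀ C B₁ : Finset (Fin n)), B₀ ⊆ C → P C B₁ → P B₀ B₁)
    (B : Finset (Fin n)) (ρ : ℕ → ℕ) (hadm : ∀ i i', i ≤ i' → ρ i ≤ ρ i' + cntGap B i i')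
    (hρ : ρ n = 0)
    (hbase : ∀ B₁, Disjoint B B₁ → (∀ i, cntGe B₁ i ≤ ρ i) → P B B₁) (B₀ B₁ : Finset (Fin n))
    (hdisj : Disjoint B₀ B₁) (hle : ∀ j, cntLt B₀ j ≤ cntLt B j) (hB₁ : ∀ i, cntGe B₁ i ≤ ρ i) :
    P B₀ B₁ := by
  obtain ⟨N, hN⟩ : ∃ N, N = (∑ x : Fin n, (n - x.val)) - ∑ x ∈ B₀, (n - x.val) := ⟨_, rfl⟩
  induction N using Nat.strong_induction_on generalizing B₀ B₁ with
  | _ N ih =>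
  have bound : ∀ C : Finset (Fin n), ∑ x ∈ C, (n - x.val) ≤ ∑ x : Fin n, (n - x.val) :=
    fun C => Finset.sum_le_univ_sum_of_nonneg (by simp)
  by_cases hBB : B ⊆ B₀
  · have : B = B₀ := by
      refine Finset.eq_of_subset_of_card_le hBB ?_
      have := hle n
      unfold cntLt at this
      simpa using this
    subst this
    exact hbase _ hdisj hB₁
  obtain ⟨j, hjB, hjB₀⟩ := Finset.not_subset.1 hBB
  by_cases hc : (B₀.filter fun x => j < x).Nonempty
  · obtain ⟨c, hcmem, hcmin⟩ := Finset.exists_min_image _ id hc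
    simp only [Finset.mem_filter, id] at hcmem hcmin
    have hcB₁ : c ∉ B₁ := Finset.disjoint_left.1 hdisj hcmem.1
    have hno : ∀ x ∈ B₀, j ≤ x → c ≤ x := by
      intro x hx hjx
      refine hcmin x ⟨hx, lt_of_le_of_ne hjx ?_⟩
      rintro rfl; exact hjB₀ hx
    have hle' : ∀ c' : Fin n, j ≤ c' → c' < c → c' ∉ B₀ → ∀ i,
        cntLt (insert c' (B₀.erase c)) i ≤ cntLt B i := by
      intro c' h1 h2 h3 i
      rw [cntLt_insert (by simp [h3])]
      have e1 := cntLt_erase hcmem.1 i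
      have e2 := hle i
      have e3 := hle j
      by_cases hi : c'.val < i
      · by_cases hi' : c.val < i
        · simp only [hi, hi', if_true] at *; omega
        · have e4 := cntLt_eq_of_no_mem (B := B₀) (i := j) (j := i) (by omega) (by
            intro x hx hjx
            have := hno x hx hjx
            omega)
          have e5 := cntLt_succ_le hjB (j := i) (by omega)
          simp only [hi, hi', if_true, if_false] at *; omega
      · simp only [hi, if_false] at *; omega
    have hdec : ∀ c' : Fin n, c' < c → c' ∉ B₀ →
        (∑ x : Fin n, (n - x.val)) - ∑ x ∈ insert c' (B₀.erase c), (n - x.val) < N := by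
      intro c' h2 h3
      have e1 := bound (insert c' (B₀.erase c))
      have e2 : ∑ x ∈ insert c' (B₀.erase c), (n - x.val) =
          (n - c'.val) + ∑ x ∈ B₀.erase c, (n - x.val) := Finset.sum_insert (by simp [h3])
      have e3 := Finset.add_sum_erase B₀ (fun x => n - x.val) hcmem.1
      omega
    by_cases hx : ∃ x : Fin n, j ≤ x ∧ x < c ∧ x ∉ B₁
    · obtain ⟨x, h1, h2, h3⟩ := hx
      have h4 : x ∉ B₀ := fun h => absurd (hno x h h1) (not_le.2 h2)
      refine hmove B₀ B₁ c x hcmem.1 h2 h4 hcB₁ h3 (ih _ (hdec x h2 h4) _ _ ?_ (hle' x h1 h2 h4)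
        hB₁ rfl)
      rw [Finset.disjoint_insert_left]
      exact ⟨h3, hdisj.mono_left (Finset.erase_subset _ _)⟩
    · push Not at hx
      have hc0 : c.val - 1 < n := by omega
      have h1 : j ≤ (⟨c.val - 1, hc0⟩ : Fin n) := by
        have := hcmem.2
        rw [Fin.le_def]; simp only; omega
      have h2 : (⟨c.val - 1, hc0⟩ : Fin n) < c := by
        have := hcmem.2
        rw [Fin.lt_def]; simp only; omega
      generalize hc' : (⟨c.val - 1, hc0⟩ : Fin n) = c' at h1 h2
      have hc'' : c'.val = c.val - 1 := by rw [← hc']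
      have h3 := hx c' h1 h2
      have h4 : c' ∉ B₀ := fun h => absurd (hno c' h h1) (not_le.2 h2)
      refine hswap B₀ B₁ c c' hcmem.1 h2 h4 hcB₁ h3 (ih _ (hdec c' h2 h4) _ _ ?_ (hle' c' h1 h2 h4)
        ?_ rfl)
      · rw [Finset.disjoint_insert_left, Finset.disjoint_insert_right]
        refine ⟨by simp [h2.ne], by simp, hdisj.mono (Finset.erase_subset _ _)
          (Finset.erase_subset _ _)⟩
      · intro i
        rw [cntGe_insert (by simp [hcB₁])]
        have e1 := cntGe_erase h3 i
        have e2 := hB₁ i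
        by_cases hi : i = c.val
        · have := cntGe_succ_le_of_admissible hadm hjB (k := i) (by omega)
            (fun y hy hy' => hx y hy (by omega)) (hB₁ j)
          have h5 : ¬ i ≤ c'.val := by omega
          simp only [hi, le_refl, if_true] at *
          simp only [h5, if_false] at *
          omega
        · by_cases hi' : i ≤ c.val
          · have h5 : i ≤ c'.val := by omega
            simp only [hi', h5, if_true] at *
            omega
          · simp only [hi', if_false]
            omega
  · rw [Finset.not_nonempty_iff_eq_empty, Finset.filter_eq_empty_iff] at hc
    obtain ⟨x, hjx, hx⟩ : ∃ x : Fin n, j ≤ x ∧ x ∉ B₁ := by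
      by_contra hcon
      push Not at hcon
      have := cntGe_succ_le_of_admissible hadm hjB (k := n) (by omega)
            (fun y hy hy' => hcon y hy) (hB₁ j)
      omega
    have hxB₀ : x ∉ B₀ := by
      intro h
      have := hc h
      have : x = j := by omega
      subst this
      exact hjB₀ h
    refine hmono B₀ (insert x B₀) B₁ (Finset.subset_insert _ _) (ih _ ?_ _ _ ?_ ?_ hB₁ rfl)
    · have e1 := bound (insert x B₀)
      have e2 : ∑ x ∈ insert x B₀, (n - x.val) =
          (n - x.val) + ∑ x ∈ B₀, (n - x.val) := Finset.sum_insert hxB₀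
      omega
    · rw [Finset.disjoint_insert_left]
      exact ⟨hx, hdisj⟩
    · intro i
      rw [cntLt_insert hxB₀]
      have e2 := hle i
      have e3 := hle j
      by_cases hi : x.val < i
      · have e4 := cntLt_eq_of_no_mem (B := B₀) (i := j) (j := i) (by omega) (by
            intro x hx hjx
            have := hc hx
            have : x = j := by omega
            subst this
            exact absurd hx hjB₀)
        have e5 := cntLt_succ_le hjB (j := i) (by omega)
        simp only [hi, if_true] at *; omega
      · simp only [hi, if_false] at *; omega

/-- Evaluation of a polynomial in the entries of two matrices. -/
noncomputable def pairEval {K : Type*} [CommRing K] {n : ℕ} {F : Type*} [CommRing F] [Algebra K F]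
    (X T : Matrix (Fin n) (Fin n) F) :
    MvPolynomial ((Fin n × Fin n) ⊕ (Fin n × Fin n)) K →ₐ[K] F :=
  MvPolynomial.aeval (Sum.elim (fun p => X p.1 p.2) (fun p => T p.1 p.2))

theorem map_pairEval {K : Type*} [CommRing K] {n : ℕ} {F F' : Type*} [CommRing F] [Algebra K F]
    [CommRing F'] [Algebra K F'] (φ : F →ₐ[K] F') (X T : Matrix (Fin n) (Fin n) F)
    (f : MvPolynomial ((Fin n × Fin n) ⊕ (Fin n × Fin n)) K) :
    φ (pairEval X T f) = pairEval (X.map φ) (T.map φ) f := by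
  unfold pairEval
  rw [← AlgHom.comp_apply, MvPolynomial.comp_aeval]
  congr 2
  ext (p | p) <;> rfl

/-- The first generic matrix. -/
noncomputable def genX (K : Type*) [CommRing K] (n : ℕ) :
    Matrix (Fin n) (Fin n) (MvPolynomial ((Fin n × Fin n) ⊕ (Fin n × Fin n)) K) :=
  Matrix.of fun i j => MvPolynomial.X (Sum.inl (i, j))

/-- The second generic matrix. -/
noncomputable def genT (K : Type*) [CommRing K] (n : ℕ) :
    Matrix (Fin n) (Fin n) (MvPolynomial ((Fin n × Fin n) ⊕ (Fin n × Fin n)) K) :=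
  Matrix.of fun i j => MvPolynomial.X (Sum.inr (i, j))

section
variable {K : Type*} [CommRing K] {n : ℕ} {F : Type*} [CommRing F] [Algebra K F]
    (X T : Matrix (Fin n) (Fin n) F)

@[simp] theorem pairEval_genX (i j) : pairEval X T (genX K n i j) = X i j := by
  simp [pairEval, genX]

@[simp] theorem pairEval_genT (i j) : pairEval X T (genT K n i j) = T i j := by
  simp [pairEval, genT]

@[simp] theorem map_pairEval_genX : (genX K n).map (pairEval X T) = X := by
  ext i j; simp

@[simp] theorem map_pairEval_genT : (genT K n).map (pairEval X T) = T := by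
  ext i j; simp

theorem pairEval_gen (f : MvPolynomial ((Fin n × Fin n) ⊕ (Fin n × Fin n)) K) :
    pairEval (genX K n) (genT K n) f = f := by
  have : (pairEval (genX K n) (genT K n) :
      MvPolynomial ((Fin n × Fin n) ⊕ (Fin n × Fin n)) K →ₐ[K] _) = AlgHom.id K _ := by
    ext (p | p) <;> simp [pairEval, genX, genT]
  rw [this]; rfl

end

/-- Vanishing along a generic curve implies vanishing at its special point. -/
theorem pairEval_curve {K : Type*} [Field K] {n : ℕ} {F : Type*} [Field F] [Algebra K F]
    {f : MvPolynomial ((Fin n × Fin n) ⊕ (Fin n × Fin n)) K}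
    (X T : Matrix (Fin n) (Fin n) (Polynomial F))
    (h : pairEval (X.map (algebraMap _ (FractionRing (Polynomial F))))
      (T.map (algebraMap _ (FractionRing (Polynomial F)))) f = 0) :
    pairEval (X.map (Polynomial.eval 0)) (T.map (Polynomial.eval 0)) f = 0 := by
  have h1 := map_pairEval (IsScalarTower.toAlgHom K (Polynomial F) (FractionRing (Polynomial F)))
    X T f
  have h2 : pairEval X T f = 0 := by
    apply IsFractionRing.injective (Polynomial F) (FractionRing (Polynomial F))
    rw [map_zero]
    exact h1.trans h
  have h3 := map_pairEval ((Polynomial.aeval (0 : F)).restrictScalars K) X T f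
  rw [h2, map_zero] at h3
  refine Eq.trans ?_ h3.symm
  congr 2

/-- Vanishing of `g` on a stratum of pairs of matrices, given by supports up to the action of
triangular matrices. -/
def StratumVanish {K : Type u} [Field K] {n : ℕ}
    (g : MvPolynomial ((Fin n × Fin n) ⊕ (Fin n × Fin n)) K)
    (A₀ B₀ A₁ B₁ : Finset (Fin n)) : Prop :=
  ∀ (F : Type u) [Field F] [Algebra K F] (L L' U U' X T : Matrix (Fin n) (Fin n) F),
    (∀ i j, i < j → L i j = 0) → (∀ i j, i < j → L' i j = 0) →
    (∀ i j, j < i → U i j = 0) → (∀ i j, j < i → U' i j = 0) →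
    L * L' = 1 → U * U' = 1 →
    (∀ i j, ¬ (i ∈ A₀ ∧ j ∈ B₀) → X i j = 0) → (∀ i j, ¬ (i ∈ B₁ ∧ j ∈ A₁) → T i j = 0) →
    pairEval (L * X * U) (U' * T * L') g = 0

section
variable {K : Type u} [Field K] {n : ℕ} {g : MvPolynomial ((Fin n × Fin n) ⊕ (Fin n × Fin n)) K}
  {A₀ B₀ A₁ B₁ : Finset (Fin n)}

theorem StratumVanish.mono {A₀' B₀' A₁' B₁' : Finset (Fin n)} (h : StratumVanish g A₀ B₀ A₁ B₁)
    (hA₀ : A₀' ⊆ A₀) (hB₀ : B₀' ⊆ B₀) (hA₁ : A₁' ⊆ A₁) (hB₁ : B₁' ⊆ B₁) :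
    StratumVanish g A₀' B₀' A₁' B₁' := by
  intro F _ _ L L' U U' X T h1 h2 h3 h4 h5 h6 h7 h8
  refine h F L L' U U' X T h1 h2 h3 h4 h5 h6 (fun i j hij => h7 i j ?_) (fun i j hij => h8 i j ?_)
  · exact fun hh => hij ⟨hA₀ hh.1, hB₀ hh.2⟩
  · exact fun hh => hij ⟨hB₁ hh.1, hA₁ hh.2⟩

/-- Interchanging both matrices with their transposes. -/
noncomputable def pairTranspose (g : MvPolynomial ((Fin n × Fin n) ⊕ (Fin n × Fin n)) K) :
    MvPolynomial ((Fin n × Fin n) ⊕ (Fin n × Fin n)) K :=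
  MvPolynomial.rename (Sum.map Prod.swap Prod.swap) g

theorem pairEval_pairTranspose {F : Type*} [CommRing F] [Algebra K F]
    (X T : Matrix (Fin n) (Fin n) F) :
    pairEval X T (pairTranspose g) = pairEval Xᵀ Tᵀ g := by
  unfold pairEval pairTranspose
  rw [MvPolynomial.aeval_rename]
  congr 2
  ext (p | p) <;> rfl

theorem pairTranspose_pairTranspose : pairTranspose (pairTranspose g) = g := by
  unfold pairTranspose
  rw [MvPolynomial.rename_rename]
  have : (Sum.map Prod.swap Prod.swap ∘ Sum.map Prod.swap Prod.swap :
    ((Fin n × Fin n) ⊕ (Fin n × Fin n)) → _) = id := by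
    ext1 (p | p) <;> rfl
  rw [this, MvPolynomial.rename_id_apply]

theorem StratumVanish.transpose (h : StratumVanish g A₀ B₀ A₁ B₁) :
    StratumVanish (pairTranspose g) B₀ A₀ B₁ A₁ := by
  intro F _ _ L L' U U' X T h1 h2 h3 h4 h5 h6 h7 h8
  rw [pairEval_pairTranspose]
  simp only [Matrix.transpose_mul, ← Matrix.mul_assoc]
  refine h F Uᵀ U'ᵀ Lᵀ L'ᵀ Xᵀ Tᵀ (fun i j hij => h3 _ _ hij) (fun i j hij => h4 _ _ hij)
    (fun i j hij => h1 _ _ hij) (fun i j hij => h2 _ _ hij) ?_ ?_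
    (fun i j hij => h7 _ _ fun hh => hij ⟨hh.2, hh.1⟩)
    (fun i j hij => h8 _ _ fun hh => hij ⟨hh.2, hh.1⟩)
  · rw [← Matrix.transpose_mul, mul_eq_one_comm.1 h6, Matrix.transpose_one]
  · rw [← Matrix.transpose_mul, mul_eq_one_comm.1 h5, Matrix.transpose_one]

theorem Matrix.map_transvection {R S : Type*} [CommRing R] [CommRing S] (φ : R →+* S) (i j : Fin n)
    (t : R) : (transvection i j t).map φ = transvection i j (φ t) := by
  rw [transvection, transvection, Matrix.map_add _ (map_add φ),
    Matrix.map_one _ (map_zero φ) (map_one φ), Matrix.map_single]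

/-- Degeneration of a stratum moving the pivot column `c` to the left. -/
theorem StratumVanish.move {c c' : Fin n} (hc'c : c' < c)
    (hc' : c' ∉ B₀) (hc₁ : c ∉ B₁) {B₁' : Finset (Fin n)} (hB₁' : B₁.erase c' ⊆ B₁')
    (hc'₁ : c' ∈ B₁ → c ∈ B₁')
    (h : StratumVanish g A₀ (insert c' (B₀.erase c)) A₁ B₁') :
    StratumVanish g A₀ B₀ A₁ B₁ := by
  intro F _ _ L L' U U' X T h1 h2 h3 h4 h5 h6 h7 h8
  have hne : c' ≠ c := hc'c.ne
  let E := FractionRing (Polynomial F)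
  let s : (Polynomial F) := Polynomial.X
  let ι : F →+* (Polynomial F) := Polynomial.C
  let κ : (Polynomial F) →+* E := algebraMap (Polynomial F) E
  let κι : F →+* E := κ.comp ι
  have hs : κ s ≠ 0 := by
    intro h0
    have := IsFractionRing.injective (Polynomial F) E (h0.trans (map_zero κ).symm)
    exact Polynomial.X_ne_zero this
  let σ : E := κ s
  let Xs : Matrix (Fin n) (Fin n) (Polynomial F) := L.map ι * (X.map ι * transvection c c' s) * U.map ι
  let Ts : Matrix (Fin n) (Fin n) (Polynomial F) := U'.map ι * (transvection c c' (-s) * T.map ι) * L'.map ι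
  have eX : Xs.map (Polynomial.eval 0) = L * X * U := by
    have : Xs.map (Polynomial.eval 0) = Xs.map (Polynomial.evalRingHom (0 : F)) := rfl
    rw [this]
    simp only [Xs, Matrix.map_mul]
    have e : ∀ M : Matrix (Fin n) (Fin n) F, (M.map ι).map (Polynomial.evalRingHom (0 : F)) = M := by
      intro M; ext; simp [ι]
    rw [e, e, e]
    rw [Matrix.map_transvection]
    simp [s]
  have eT : Ts.map (Polynomial.eval 0) = U' * T * L' := by
    have : Ts.map (Polynomial.eval 0) = Ts.map (Polynomial.evalRingHom (0 : F)) := rfl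
    rw [this]
    simp only [Ts, Matrix.map_mul]
    have e : ∀ M : Matrix (Fin n) (Fin n) F, (M.map ι).map (Polynomial.evalRingHom (0 : F)) = M := by
      intro M; ext; simp [ι]
    rw [e, e, e]
    rw [Matrix.map_transvection]
    simp [s]
  rw [← eX, ← eT]
  refine pairEval_curve Xs Ts ?_
  have hmm : ∀ M : Matrix (Fin n) (Fin n) F, (M.map ι).map (algebraMap (Polynomial F) E) = M.map κι :=
    fun M => rfl
  have htv : ∀ t : (Polynomial F), (transvection c c' t).map (algebraMap (Polynomial F) E) = transvection c c' (κ t) := by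
    exact fun t => Matrix.map_transvection _ _ _ _
  let X' : Matrix (Fin n) (Fin n) E := Matrix.of fun i j =>
    if j = c' then σ * κι (X i c) else if j = c then 0 else κι (X i j)
  let T' : Matrix (Fin n) (Fin n) E := Matrix.of fun i j =>
    if i = c' then 0 else if i = c then - σ * κι (T c' j) else κι (T i j)
  have e1 : X.map κι * transvection c c' σ = X' * transvection c' c σ⁻¹ := by
    ext i j
    by_cases hj : j = c'
    · subst hj
      rw [mul_transvection_apply_same, mul_transvection_apply_of_ne _ _ _ _ hne]
      simp [X', h7 i j (by simp [hc'])]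
    · rw [mul_transvection_apply_of_ne _ _ _ _ hj]
      by_cases hj' : j = c
      · subst hj'
        rw [mul_transvection_apply_same]
        simp [X', hj, ← mul_assoc, inv_mul_cancel₀ hs, σ]
      · rw [mul_transvection_apply_of_ne _ _ _ _ hj']
        simp [X', hj, hj']
  have e2 : transvection c c' (-σ) * T.map κι = transvection c' c (-σ⁻¹) * T' := by
    ext i j
    by_cases hi : i = c
    · subst hi
      rw [transvection_mul_apply_same, transvection_mul_apply_of_ne _ _ _ _ (Ne.symm hne)]
      simp [T', h8 i j (by simp [hc₁]), hne.symm]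
    · rw [transvection_mul_apply_of_ne _ _ _ _ hi]
      by_cases hi' : i = c'
      · subst hi'
        rw [transvection_mul_apply_same]
        simp only [T', hne.symm, Matrix.of_apply, Matrix.map_apply, if_true, if_false, σ]
        rw [← mul_assoc, neg_mul_neg, inv_mul_cancel₀ hs, one_mul, zero_add]
      · rw [transvection_mul_apply_of_ne _ _ _ _ hi']
        simp [T', hi, hi']
  have e3 : Xs.map (algebraMap (Polynomial F) E) = L.map κι * X' * (transvection c' c σ⁻¹ * U.map κι) := by
    simp only [Xs, Matrix.map_mul, hmm, htv]
    rw [show κ s = σ from rfl, e1]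
    simp only [Matrix.mul_assoc]
  have e4 : Ts.map (algebraMap (Polynomial F) E) = (U'.map κι * transvection c' c (-σ⁻¹)) * T' * L'.map κι := by
    simp only [Ts, Matrix.map_mul, hmm, htv]
    rw [show κ (-s) = -σ from map_neg κ s, e2]
    simp only [Matrix.mul_assoc]
  rw [e3, e4]
  refine h E _ _ _ _ _ _ ?_ ?_ ?_ ?_ ?_ ?_ ?_ ?_
  · intro i j hij; simp [h1 i j hij]
  · intro i j hij; simp [h2 i j hij]
  · intro i j hij
    by_cases hi : i = c'
    · subst hi
      rw [transvection_mul_apply_same]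
      simp [h3 i j hij, h3 c j (hij.trans hc'c)]
    · rw [transvection_mul_apply_of_ne _ _ _ _ hi]
      simp [h3 i j hij]
  · intro i j hij
    by_cases hj : j = c
    · subst hj
      rw [mul_transvection_apply_same]
      simp [h4 i j hij, h4 i c' (hc'c.trans hij)]
    · rw [mul_transvection_apply_of_ne _ _ _ _ hj]
      simp [h4 i j hij]
  · rw [← Matrix.map_mul, h5, Matrix.map_one _ (map_zero _) (map_one _)]
  · rw [Matrix.mul_assoc, ← Matrix.mul_assoc (U.map κι), ← Matrix.map_mul, h6,
      Matrix.map_one _ (map_zero _) (map_one _), one_mul, transvection_mul_transvection_same _ _ hne]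
    rw [add_neg_cancel, transvection_zero]
  · intro i j hij
    simp only [X', Matrix.of_apply]
    by_cases hj : j = c'
    · simp only [hj, if_true]
      rw [h7 i c, map_zero, mul_zero]
      intro hh
      exact hij ⟨hh.1, by simp [hj]⟩
    · simp only [hj, if_false]
      by_cases hj' : j = c
      · simp [hj']
      · simp only [hj', if_false]
        rw [h7 i j, map_zero]
        intro hh
        exact hij ⟨hh.1, by simp [hj', hh.2]⟩
  · intro i j hij
    simp only [T', Matrix.of_apply]
    by_cases hi : i = c'
    · simp [hi]
    · simp only [hi, if_false]
      by_cases hi' : i = c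
      · simp only [hi', if_true]
        rw [h8 c' j, map_zero, mul_zero]
        intro hh
        exact hij ⟨by rw [hi']; exact hc'₁ hh.1, hh.2⟩
      · simp only [hi', if_false]
        rw [h8 i j, map_zero]
        intro hh
        exact hij ⟨hB₁' (by simp [hi, hh.1]), hh.2⟩

theorem StratumVanish.of_pivots_col {B : Finset (Fin n)} {ρ : ℕ → ℕ}
    (hadm : ∀ i i', i ≤ i' → ρ i ≤ ρ i' + cntGap B i i') (hρ : ρ n = 0)
    (h : ∀ B₁, Disjoint B B₁ → (∀ i, cntGe B₁ i ≤ ρ i) → StratumVanish g A₀ B A₁ B₁)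
    (hdisj : Disjoint B₀ B₁) (hle : ∀ j, cntLt B₀ j ≤ cntLt B j) (hB₁ : ∀ i, cntGe B₁ i ≤ ρ i) :
    StratumVanish g A₀ B₀ A₁ B₁ := by
  refine exchange_induction (fun B₀ B₁ => StratumVanish g A₀ B₀ A₁ B₁) ?_ ?_ ?_ B ρ hadm hρ h B₀ B₁
    hdisj hle hB₁
  · intro B₀ B₁ c c' _ h2 h3 h4 h5 h6
    exact h6.move h2 h3 h4 (Finset.erase_subset _ _) (fun hh => absurd hh h5)
  · intro B₀ B₁ c c' _ h2 h3 h4 h5 h6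
    exact h6.move h2 h3 h4 (Finset.subset_insert _ _) (fun hh => Finset.mem_insert_self _ _)
  · intro B₀ C B₁ h1 h2
    exact h2.mono (Finset.Subset.refl _) h1 (Finset.Subset.refl _) (Finset.Subset.refl _)

theorem StratumVanish.of_pivots {A B : Finset (Fin n)} {ρW ρV : ℕ → ℕ}
    (hadmW : ∀ i i', i ≤ i' → ρW i ≤ ρW i' + cntGap B i i') (hρW : ρW n = 0)
    (hadmV : ∀ i i', i ≤ i' → ρV i ≤ ρV i' + cntGap A i i') (hρV : ρV n = 0)
    (h : ∀ A₁ B₁, Disjoint A A₁ → Disjoint B B₁ → (∀ i, cntGe B₁ i ≤ ρW i) →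
      (∀ i, cntGe A₁ i ≤ ρV i) → StratumVanish g A B A₁ B₁)
    (hA : Disjoint A₀ A₁) (hB : Disjoint B₀ B₁) (hle : MinorLe (A, B) (A₀, B₀))
    (hB₁ : ∀ i, cntGe B₁ i ≤ ρW i) (hA₁ : ∀ i, cntGe A₁ i ≤ ρV i) :
    StratumVanish g A₀ B₀ A₁ B₁ := by
  refine StratumVanish.of_pivots_col hadmW hρW ?_ hB (fun j => (hle j).2) hB₁
  intro B₁' hB' hB₁'
  rw [← pairTranspose_pairTranspose (g := g)]
  refine StratumVanish.transpose ?_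
  refine StratumVanish.of_pivots_col hadmV hρV ?_ hA (fun j => (hle j).1) hA₁
  intro A₁' hA' hA₁'
  exact (h A₁' B₁' hA' hB' hB₁' hA₁').transpose

end

theorem Matrix.det_mul_eq_zero_of_support {F : Type*} [Field F] {n m : ℕ}
    (N : Matrix (Fin m) (Fin n) F) (W : Matrix (Fin n) (Fin m) F) (S : Finset (Fin n))
    (C : Finset (Fin m)) (hW : ∀ k, ∀ l ∈ C, k ∉ S → W k l = 0) (hcard : S.card < C.card) :
    (N * W).det = 0 := by
  obtain ⟨v, hv0, hv⟩ : ∃ v : C → F, v ≠ 0 ∧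
      (W.submatrix (Subtype.val : S → Fin n) (Subtype.val : C → Fin m)) *ᵥ v = 0 := by
    have : LinearMap.ker (Matrix.mulVecLin
        (W.submatrix (Subtype.val : S → Fin n) (Subtype.val : C → Fin m))) ≠ ⊥ :=
      LinearMap.ker_ne_bot_of_finrank_lt (by simpa using hcard)
    obtain ⟨v, hv, hv0⟩ := Submodule.exists_mem_ne_zero_of_ne_bot this
    exact ⟨v, hv0, hv⟩
  rw [← Matrix.exists_mulVec_eq_zero_iff]
  refine ⟨fun l => if h : l ∈ C then v ⟨l, h⟩ else 0, ?_, ?_⟩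
  · intro h
    apply hv0
    ext ⟨l, hl⟩
    have := congr_fun h l
    simpa [hl] using this
  · rw [← Matrix.mulVec_mulVec]
    suffices (W *ᵥ fun l => if h : l ∈ C then v ⟨l, h⟩ else 0) = 0 by
      rw [this, Matrix.mulVec_zero]
    ext k
    have e : (W *ᵥ fun l => if h : l ∈ C then v ⟨l, h⟩ else 0) k = ∑ l : C, W k l * v l := by
      simp only [Matrix.mulVec, dotProduct]
      rw [← Finset.sum_subset (Finset.subset_univ C), ← Finset.sum_coe_sort]
      · refine Finset.sum_congr rfl fun l _ => ?_
        simp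
      · intro l _ hl
        simp [hl]
    rw [e]
    by_cases hk : k ∈ S
    · exact congr_fun hv ⟨k, hk⟩
    · exact Finset.sum_eq_zero fun l _ => by rw [hW k l l.2 hk, zero_mul]

theorem Matrix.det_submatrix_mul_eq_zero_col {F : Type*} [Field F] {n m : ℕ}
    (Y V : Matrix (Fin n) (Fin n) F) (B : Finset (Fin n)) (hY : ∀ i j, j ∉ B → Y i j = 0)
    (p : Fin n → Prop) [DecidablePred p] (hV : ∀ k l, p l → ¬ p k → V k l = 0)
    (a b : Fin m → Fin n) (hb : Function.Injective b)
    (hcard : (B.filter p).card < ((Finset.univ.image b).filter p).card) :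
    ((Y * V).submatrix a b).det = 0 := by
  have e : (Y * V).submatrix a b = Y.submatrix a id *
      (Matrix.of fun k l => if k ∈ B then V k (b l) else 0) := by
    ext i j
    simp only [Matrix.submatrix_apply, Matrix.mul_apply, Matrix.of_apply, id]
    refine Finset.sum_congr rfl fun k _ => ?_
    by_cases hk : k ∈ B
    · simp [hk]
    · simp [hk, hY _ k hk]
  rw [e]
  refine Matrix.det_mul_eq_zero_of_support _ _ (B.filter p) (Finset.univ.filter fun l => p (b l))
    ?_ ?_
  · intro k l hl hk
    simp only [Finset.mem_filter, Finset.mem_univ, true_and, not_and] at hl hk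
    by_cases hkB : k ∈ B
    · simp [hkB, hV k (b l) hl (hk hkB)]
    · simp [hkB]
  · refine hcard.trans_le ?_
    rw [Finset.filter_image, Finset.card_image_of_injective _ hb]

theorem Matrix.det_submatrix_mul_eq_zero_row {F : Type*} [Field F] {n m : ℕ}
    (Y V : Matrix (Fin n) (Fin n) F) (A : Finset (Fin n)) (hY : ∀ i j, i ∉ A → Y i j = 0)
    (p : Fin n → Prop) [DecidablePred p] (hV : ∀ k l, p l → ¬ p k → V l k = 0)
    (a b : Fin m → Fin n) (ha : Function.Injective a)
    (hcard : (A.filter p).card < ((Finset.univ.image a).filter p).card) :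
    ((V * Y).submatrix a b).det = 0 := by
  rw [← Matrix.det_transpose, Matrix.transpose_submatrix, Matrix.transpose_mul]
  exact Matrix.det_submatrix_mul_eq_zero_col Yᵀ Vᵀ A (fun i j hj => hY j i hj) p hV b a ha hcard

/-- `Ω` is closed under passing to smaller minors. -/
def MinorLower {n : ℕ} (Ω : Set (Finset (Fin n) × Finset (Fin n))) : Prop :=
  ∀ d ∈ Ω, ∀ c : Finset (Fin n) × Finset (Fin n), c.1.card = c.2.card → MinorLe c d → c ∈ Ω

/-- Vanishing on all strata cut out by `Ω` and the rank bounds. -/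
def PairVanish {K : Type u} [Field K] {n : ℕ}
    (f : MvPolynomial ((Fin n × Fin n) ⊕ (Fin n × Fin n)) K)
    (Ω : Set (Finset (Fin n) × Finset (Fin n))) (ρW ρV : ℕ → ℕ) : Prop :=
  ∀ A B A₁ B₁ : Finset (Fin n), A.card = B.card → (A, B) ∉ Ω → Disjoint A A₁ → Disjoint B B₁ →
    (∀ i, cntGe B₁ i ≤ ρW i) → (∀ i, cntGe A₁ i ≤ ρV i) → StratumVanish f A B A₁ B₁

theorem Matrix.mul_eq_zero_of_disjoint {F : Type*} [Field F] {n : ℕ}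
    {X T : Matrix (Fin n) (Fin n) F} {B B₁ : Finset (Fin n)} (hdisj : Disjoint B B₁)
    (hX : ∀ i j, j ∉ B → X i j = 0) (hT : ∀ i j, i ∉ B₁ → T i j = 0) : X * T = 0 := by
  ext i j
  rw [Matrix.mul_apply]
  refine Finset.sum_eq_zero fun k _ => ?_
  by_cases hk : k ∈ B
  · rw [hT k j (Finset.disjoint_left.1 hdisj hk), mul_zero]
  · rw [hX i k hk, zero_mul]

theorem pairEval_det_genX {K : Type*} [Field K] {F : Type*} [Field F] [Algebra K F] {n m : ℕ}
    (X T : Matrix (Fin n) (Fin n) F) (a b : Fin m → Fin n) :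
    pairEval X T ((genX K n).submatrix a b).det = (X.submatrix a b).det := by
  rw [AlgHom.map_det]
  congr 1
  ext i j
  simp

theorem pairEval_det_genT {K : Type*} [Field K] {F : Type*} [Field F] [Algebra K F] {n m : ℕ}
    (X T : Matrix (Fin n) (Fin n) F) (a b : Fin m → Fin n) :
    pairEval X T ((genT K n).submatrix a b).det = (T.submatrix a b).det := by
  rw [AlgHom.map_det]
  congr 1
  ext i j
  simp

theorem pairVanish_of_mem {K : Type u} [Field K] {n : ℕ}
    {f : MvPolynomial ((Fin n × Fin n) ⊕ (Fin n × Fin n)) K}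
    {Ω : Set (Finset (Fin n) × Finset (Fin n))} (hΩ : MinorLower Ω) {ρW ρV : ℕ → ℕ}
    (hf : f ∈ pairIdeal (genX K n) (genT K n) Ω ρW ρV) : PairVanish f Ω ρW ρV := by
  intro A B A₁ B₁ hcard hAB hA hB hB₁ hA₁ F _ _ L L' U U' X T h1 h2 h3 h4 h5 h6 h7 h8
  suffices pairIdeal (genX K n) (genT K n) Ω ρW ρV ≤
      RingHom.ker (pairEval (K := K) (L * X * U) (U' * T * L')) from this hf
  have hXB : ∀ i j, j ∉ B → X i j = 0 := fun i j hj => h7 i j fun hh => hj hh.2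
  have hXA : ∀ i j, i ∉ A → X i j = 0 := fun i j hj => h7 i j fun hh => hj hh.1
  have hTB : ∀ i j, i ∉ B₁ → T i j = 0 := fun i j hj => h8 i j fun hh => hj hh.1
  have hTA : ∀ i j, j ∉ A₁ → T i j = 0 := fun i j hj => h8 i j fun hh => hj hh.2
  have eXT : (L * X * U) * (U' * T * L') = 0 := by
    calc _ = L * (X * (U * U') * T) * L' := by simp only [Matrix.mul_assoc]
      _ = 0 := by
        rw [h6, mul_one, Matrix.mul_eq_zero_of_disjoint hB hXB hTB, mul_zero, zero_mul]
  have eTX : (U' * T * L') * (L * X * U) = 0 := by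
    calc _ = U' * (T * (L' * L) * X) * U := by simp only [Matrix.mul_assoc]
      _ = 0 := by
        rw [mul_eq_one_comm.1 h5, mul_one, Matrix.mul_eq_zero_of_disjoint hA.symm hTA hXA, mul_zero,
          zero_mul]
  refine pairIdeal_le ?_ ?_ ?_ ?_
  · intro i j
    rw [RingHom.mem_ker, Matrix.mul_apply, map_sum]
    simp only [map_mul, pairEval_genX, pairEval_genT]
    rw [← Matrix.mul_apply, eXT, Matrix.zero_apply]
  · intro i j
    rw [RingHom.mem_ker, Matrix.mul_apply, map_sum]
    simp only [map_mul, pairEval_genX, pairEval_genT]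
    rw [← Matrix.mul_apply, eTX, Matrix.zero_apply]
  · intro m a b ha hb hab
    rw [RingHom.mem_ker, pairEval_det_genX]
    have : ¬ MinorLe (A, B) (Finset.univ.image a, Finset.univ.image b) :=
      fun hle => hAB (hΩ _ hab _ hcard hle)
    simp only [MinorLe, not_forall, not_and_or, not_le] at this
    obtain ⟨j, hj | hj⟩ := this
    · rw [Matrix.mul_assoc]
      refine Matrix.det_submatrix_mul_eq_zero_row (X * U) L A ?_ (fun x => x.val < j) ?_ a b ha hj
      · intro i k hi
        rw [Matrix.mul_apply]
        exact Finset.sum_eq_zero fun l _ => by rw [hXA i l hi, zero_mul]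
      · intro k l hl hk
        exact h1 l k (by omega)
    · refine Matrix.det_submatrix_mul_eq_zero_col (L * X) U B ?_ (fun x => x.val < j) ?_ a b hb hj
      · intro i k hi
        rw [Matrix.mul_apply]
        exact Finset.sum_eq_zero fun l _ => by rw [hXB l k hi, mul_zero]
      · intro k l hl hk
        exact h3 k l (by omega)
  · intro m b a hb ha hab
    rw [RingHom.mem_ker, pairEval_det_genT]
    obtain ⟨i, hi | hi⟩ := hab
    · rw [Matrix.mul_assoc]
      refine Matrix.det_submatrix_mul_eq_zero_row (T * L') U' B₁ ?_ (fun x => i ≤ x.val) ?_ b a hb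
        ((hB₁ i).trans_lt hi)
      · intro i k hi
        rw [Matrix.mul_apply]
        exact Finset.sum_eq_zero fun l _ => by rw [hTB i l hi, zero_mul]
      · intro k l hl hk
        exact h4 l k (by omega)
    · refine Matrix.det_submatrix_mul_eq_zero_col (U' * T) L' A₁ ?_ (fun x => i ≤ x.val) ?_ b a ha
        ((hA₁ i).trans_lt hi)
      · intro i k hi
        rw [Matrix.mul_apply]
        exact Finset.sum_eq_zero fun l _ => by rw [hTA l k hi, mul_zero]
      · intro k l hl hk
        exact h2 k l (by omega)

theorem Matrix.det_submatrix_ne_zero_of_lower {F : Type*} [Field F] {n m : ℕ}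
    {L L' : Matrix (Fin n) (Fin n) F} (h1 : ∀ i j, i < j → L i j = 0)
    (h2 : ∀ i j, i < j → L' i j = 0) (h : L * L' = 1) (a : Fin m ↪o Fin n) :
    (L.submatrix a a).det ≠ 0 := by
  have hd : ∀ i, L i i ≠ 0 := by
    intro i hi
    have := congr_fun (congr_fun h i) i
    rw [Matrix.mul_apply, Matrix.one_apply_eq] at this
    rw [Finset.sum_eq_zero] at this
    · exact zero_ne_one this
    · intro k _
      rcases lt_trichotomy k i with hk | rfl | hk
      · rw [h2 k i hk, mul_zero]
      · rw [hi, zero_mul]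
      · rw [h1 i k hk, zero_mul]
  rw [Matrix.det_of_isLowerTriangular]
  · exact Finset.prod_ne_zero_iff.2 fun i _ => hd _
  · intro i j hij
    exact h1 _ _ (a.lt_iff_lt.2 hij)

/-- A minor does not vanish identically on the stratum it indexes. -/
theorem StratumVanish.of_minor_mul {K : Type u} [Field K] {n m : ℕ}
    {g : MvPolynomial ((Fin n × Fin n) ⊕ (Fin n × Fin n)) K} {A B A₁ B₁ : Finset (Fin n)}
    {a b : Fin m ↪o Fin n} (hA : Set.range a = A) (hB : Set.range b = B)
    (h : StratumVanish (((genX K n).submatrix a b).det * g) A B A₁ B₁) :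
    StratumVanish g A B A₁ B₁ := by
  intro F _ _ L L' U U' X T h1 h2 h3 h4 h5 h6 h7 h8
  let ι : F →+* Polynomial F := Polynomial.C
  let κ : Polynomial F →+* FractionRing (Polynomial F) := algebraMap _ _
  let κι : F →+* FractionRing (Polynomial F) := κ.comp ι
  let D : Matrix (Fin n) (Fin n) (Polynomial F) := Matrix.of fun i j =>
    if ∃ k, a k = i ∧ b k = j then Polynomial.X else 0
  let Y : Matrix (Fin n) (Fin n) (Polynomial F) := X.map ι + D
  let Xs : Matrix (Fin n) (Fin n) (Polynomial F) := L.map ι * Y * U.map ι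
  let Ts : Matrix (Fin n) (Fin n) (Polynomial F) := U'.map ι * T.map ι * L'.map ι
  have e : ∀ M : Matrix (Fin n) (Fin n) F, (M.map ι).map (Polynomial.evalRingHom (0 : F)) = M := by
    intro M; ext; simp [ι]
  have eX : Xs.map (Polynomial.eval 0) = L * X * U := by
    change Xs.map (Polynomial.evalRingHom (0 : F)) = _
    simp only [Xs, Y, Matrix.map_mul, Matrix.map_add _ (map_add _), e]
    have : D.map (Polynomial.evalRingHom (0 : F)) = 0 := by
      ext i j
      simp only [D, Matrix.map_apply, Matrix.of_apply]
      split_ifs <;> simp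
    rw [this, add_zero]
  have eT : Ts.map (Polynomial.eval 0) = U' * T * L' := by
    change Ts.map (Polynomial.evalRingHom (0 : F)) = _
    simp only [Ts, Matrix.map_mul, e]
  rw [← eX, ← eT]
  refine pairEval_curve Xs Ts ?_
  have e3 : Xs.map (algebraMap (Polynomial F) (FractionRing (Polynomial F))) =
      L.map κι * Y.map κ * U.map κι := by
    simp only [Xs, Matrix.map_mul]; rfl
  have e4 : Ts.map (algebraMap (Polynomial F) (FractionRing (Polynomial F))) =
      U'.map κι * T.map κι * L'.map κι := by
    simp only [Ts, Matrix.map_mul]; rfl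
  have hY : ∀ i j, ¬ (i ∈ A ∧ j ∈ B) → Y i j = 0 := by
    intro i j hij
    simp only [Y, D, Matrix.add_apply, Matrix.map_apply, h7 i j hij, map_zero, zero_add,
      Matrix.of_apply]
    rw [if_neg]
    rintro ⟨k, rfl, rfl⟩
    rw [← Finset.mem_coe, ← Finset.mem_coe, ← hA, ← hB] at hij
    exact hij ⟨⟨k, rfl⟩, ⟨k, rfl⟩⟩
  have hmul : ∀ M M' : Matrix (Fin n) (Fin n) F, M * M' = 1 → M.map κι * M'.map κι = 1 := by
    intro M M' hM
    rw [← Matrix.map_mul, hM, Matrix.map_one _ (map_zero _) (map_one _)]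
  have key := h _ (L.map κι) (L'.map κι) (U.map κι) (U'.map κι) (Y.map κ) (T.map κι)
    (fun i j hij => by simp [h1 i j hij]) (fun i j hij => by simp [h2 i j hij])
    (fun i j hij => by simp [h3 i j hij]) (fun i j hij => by simp [h4 i j hij])
    (hmul _ _ h5) (hmul _ _ h6)
    (fun i j hij => by rw [Matrix.map_apply, hY i j hij, map_zero])
    (fun i j hij => by rw [Matrix.map_apply, h8 i j hij, map_zero])
  rw [e3, e4]
  rw [map_mul] at key
  refine (mul_eq_zero.1 key).resolve_left ?_
  rw [pairEval_det_genX, ← e3, show Xs.map (algebraMap (Polynomial F)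
    (FractionRing (Polynomial F))) = κ.mapMatrix Xs from rfl]
  rw [show (κ.mapMatrix Xs).submatrix a b = κ.mapMatrix (Xs.submatrix a b) from rfl,
    ← RingHom.map_det]
  refine (map_ne_zero_iff κ (IsFractionRing.injective _ _)).2 ?_
  have e5 : Xs.submatrix a b =
      (L.submatrix a a).map ι * Matrix.charmatrix (-(X.submatrix a b)) * (U.submatrix b b).map ι := by
    have e6 : Matrix.charmatrix (-(X.submatrix a b)) = Y.submatrix a b := by
      ext i j : 2
      simp only [Matrix.charmatrix_apply, Y, D, Matrix.submatrix_apply, Matrix.add_apply,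
        Matrix.map_apply, Matrix.neg_apply, map_neg, sub_neg_eq_add, Matrix.of_apply]
      rw [add_comm]
      congr 1
      by_cases hij : i = j
      · subst hij
        rw [Matrix.diagonal_apply_eq, if_pos ⟨i, rfl, rfl⟩]
      · rw [Matrix.diagonal_apply_ne _ hij, if_neg]
        rintro ⟨k, hk, hk'⟩
        exact hij ((a.injective hk).symm.trans (b.injective hk'))
    rw [e6]
    refine Matrix.ext fun i j => ?_
    simp only [Xs, Matrix.submatrix_apply, Matrix.mul_apply, Matrix.map_apply]
    rw [← Finset.sum_subset (Finset.subset_univ (Finset.univ.image b)),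
      Finset.sum_image (fun _ _ _ _ hh => b.injective hh)]
    · refine Finset.sum_congr rfl fun l _ => ?_
      congr 1
      rw [← Finset.sum_subset (Finset.subset_univ (Finset.univ.image a)),
        Finset.sum_image (fun _ _ _ _ hh => a.injective hh)]
      intro k _ hk
      rw [hY, mul_zero]
      rw [← Finset.mem_coe, ← hA]
      rintro ⟨⟨l, hl⟩, -⟩
      exact hk (Finset.mem_image.2 ⟨l, Finset.mem_univ _, hl⟩)
    · intro k _ hk
      rw [Finset.sum_eq_zero, zero_mul]
      intro l _
      rw [hY, mul_zero]
      rw [← Finset.mem_coe (s := B), ← hB]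
      rintro ⟨-, ⟨l, hl⟩⟩
      exact hk (Finset.mem_image.2 ⟨l, Finset.mem_univ _, hl⟩)
  rw [e5, Matrix.det_mul, Matrix.det_mul]
  have hdet : ∀ M : Matrix (Fin m) (Fin m) F, M.det ≠ 0 → (M.map ι).det ≠ 0 := by
    intro M hM
    rw [show M.map ι = ι.mapMatrix M from rfl, ← RingHom.map_det]
    exact Polynomial.C_ne_zero.2 hM
  refine mul_ne_zero (mul_ne_zero (hdet _ ?_) ?_) (hdet _ ?_)
  · exact Matrix.det_submatrix_ne_zero_of_lower h1 h2 h5 a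
  · exact (Matrix.charpoly_monic _).ne_zero
  · rw [← Matrix.det_transpose, Matrix.transpose_submatrix]
    refine Matrix.det_submatrix_ne_zero_of_lower (L := Uᵀ) (L' := U'ᵀ) (fun i j hij => h3 _ _ hij)
      (fun i j hij => h4 _ _ hij) ?_ b
    rw [← Matrix.transpose_mul, mul_eq_one_comm.1 h6, Matrix.transpose_one]

section
attribute [local instance] MvPolynomial.gradedAlgebra

theorem MvPolynomial.homogeneousComponent_mul_of_isHomogeneous {σ R : Type*} [CommRing R]
    {p q : MvPolynomial σ R} {k d : ℕ} (hp : p.IsHomogeneous k) :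
    MvPolynomial.homogeneousComponent d (p * q) =
      if k ≤ d then p * MvPolynomial.homogeneousComponent (d - k) q else 0 := by
  classical
  have := DirectSum.coe_decompose_mul_of_left_mem (MvPolynomial.homogeneousSubmodule σ R)
    (a := p) (b := q) (i := k) d hp
  have hd : ∀ (φ : MvPolynomial σ R) (i : ℕ),
      (DirectSum.decompose (MvPolynomial.homogeneousSubmodule σ R) φ i : MvPolynomial σ R) =
        MvPolynomial.homogeneousComponent i φ :=
    fun φ i => MvPolynomial.decomposition.decompose'_apply φ i
  rwa [hd, hd] at this

theorem MvPolynomial.exists_homogeneous_of_mem_sup {σ R : Type*} [CommRing R]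
    {J : Ideal (MvPolynomial σ R)} {S : Set (MvPolynomial σ R)} (hJ : J = Ideal.span S)
    (hS : ∀ p ∈ S, ∃ k, p.IsHomogeneous k) {δ f : MvPolynomial σ R} {k d : ℕ}
    (hδ : δ.IsHomogeneous k) (hf : f.IsHomogeneous d) (h : f ∈ J ⊔ Ideal.span {δ}) :
    ∃ g : MvPolynomial σ R, g.IsHomogeneous (d - k) ∧ f - δ * g ∈ J ∧ (k ≤ d ∨ g = 0) := by
  obtain ⟨b, hb, c, hc, rfl⟩ := Submodule.mem_sup.1 h
  obtain ⟨c, rfl⟩ := Ideal.mem_span_singleton'.1 hc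
  have hhom : J.IsHomogeneous (MvPolynomial.homogeneousSubmodule σ R) := by
    rw [hJ]
    exact Ideal.homogeneous_span _ _ hS
  have hbd := MvPolynomial.homogeneousComponent_mem_of_mem (R := R) hhom hb d
  have e := MvPolynomial.homogeneousComponent_eq_self hf
  rw [map_add, mul_comm c, MvPolynomial.homogeneousComponent_mul_of_isHomogeneous hδ] at e
  by_cases hkd : k ≤ d
  · refine ⟨MvPolynomial.homogeneousComponent (d - k) c,
      MvPolynomial.homogeneousComponent_isHomogeneous _ _, ?_, Or.inl hkd⟩
    rw [if_pos hkd] at e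
    rw [mul_comm c, ← e, add_sub_cancel_right]
    exact hbd
  · refine ⟨0, MvPolynomial.isHomogeneous_zero _ _ _, ?_, Or.inr rfl⟩
    rw [if_neg hkd, add_zero] at e
    rw [mul_comm c, ← e, mul_zero, sub_zero]
    exact hbd

end

theorem Matrix.det_isHomogeneous {σ R : Type*} [CommRing R] {m : ℕ}
    (M : Matrix (Fin m) (Fin m) (MvPolynomial σ R)) (hM : ∀ i j, (M i j).IsHomogeneous 1) :
    M.det.IsHomogeneous m := by
  rw [Matrix.det_apply]
  refine MvPolynomial.IsHomogeneous.sum _ _ _ fun τ _ => ?_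
  have : (∏ i, M (τ i) i).IsHomogeneous m := by
    simpa using MvPolynomial.IsHomogeneous.prod Finset.univ (fun i => M (τ i) i) (fun _ => 1)
      (fun i _ => hM _ _)
  rcases Int.units_eq_one_or (Equiv.Perm.sign τ) with h | h <;> rw [h]
  · simpa using this
  · simpa using this.neg

theorem Matrix.mul_apply_isHomogeneous {σ R : Type*} [CommRing R] {n : ℕ}
    {M N : Matrix (Fin n) (Fin n) (MvPolynomial σ R)} (hM : ∀ i j, (M i j).IsHomogeneous 1)
    (hN : ∀ i j, (N i j).IsHomogeneous 1) (i j) : ((M * N) i j).IsHomogeneous 2 := by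
  rw [Matrix.mul_apply]
  exact MvPolynomial.IsHomogeneous.sum _ _ _ fun k _ => (hM _ _).mul (hN _ _)

theorem genX_isHomogeneous (K : Type*) [CommRing K] {n : ℕ} (i j) :
    (genX K n i j).IsHomogeneous 1 := MvPolynomial.isHomogeneous_X _ _

theorem genT_isHomogeneous (K : Type*) [CommRing K] {n : ℕ} (i j) :
    (genT K n i j).IsHomogeneous 1 := MvPolynomial.isHomogeneous_X _ _

theorem eq_of_cntLt_eq {n : ℕ} {A B : Finset (Fin n)} (h : ∀ j, cntLt A j = cntLt B j) :
    A = B := by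
  have key : ∀ (C : Finset (Fin n)) (x : Fin n), x ∈ C ↔ cntLt C x < cntLt C (x + 1) := by
    intro C x
    constructor
    · intro hx
      have := cntLt_succ_le hx (j := x + 1) (by omega)
      omega
    · intro hlt
      by_contra hx
      refine hlt.ne (cntLt_eq_of_no_mem (by omega) ?_)
      intro y hy hxy
      have : y ≠ x := by rintro rfl; exact hx hy
      omega
  ext x
  rw [key A, key B, h, h]

theorem cntLt_eq_of_ge {n : ℕ} (A : Finset (Fin n)) {j : ℕ} (h : n ≤ j) :
    cntLt A j = A.card := by
  unfold cntLt
  rw [Finset.filter_true_of_mem]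
  intro x _
  omega

/-- A set of minors missing some nonempty minor has a minimal missing nonempty minor. -/
theorem exists_minimal_minor {n : ℕ} {Ω : Set (Finset (Fin n) × Finset (Fin n))}
    (h : ∃ d : Finset (Fin n) × Finset (Fin n), d.1.card = d.2.card ∧ d.1.card ≠ 0 ∧ d ∉ Ω) :
    ∃ δ : Finset (Fin n) × Finset (Fin n), δ.1.card = δ.2.card ∧ δ.1.card ≠ 0 ∧ δ ∉ Ω ∧
      ∀ d : Finset (Fin n) × Finset (Fin n), d.1.card = d.2.card → MinorLe d δ → d ≠ δ → d ∈ Ω := by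
  classical
  let w : Finset (Fin n) × Finset (Fin n) → ℕ := fun d =>
    ∑ j ∈ Finset.range (n + 1), (cntLt d.1 j + cntLt d.2 j)
  obtain ⟨δ, hδ, hmax⟩ := Finset.exists_max_image (Finset.univ.filter
    fun d : Finset (Fin n) × Finset (Fin n) => d.1.card = d.2.card ∧ d.1.card ≠ 0 ∧ d ∉ Ω) w
    (by obtain ⟨d, hd⟩ := h; exact ⟨d, by simpa using hd⟩)
  simp only [Finset.mem_filter, Finset.mem_univ, true_and] at hδ hmax
  refine ⟨δ, hδ.1, hδ.2.1, hδ.2.2, ?_⟩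
  intro d hd hle hne
  by_contra hdΩ
  have hle' := hmax d ⟨hd, ?_, hdΩ⟩
  · apply hne
    have heq : ∀ j ∈ Finset.range (n + 1), cntLt δ.1 j + cntLt δ.2 j = cntLt d.1 j + cntLt d.2 j :=
      (Finset.sum_eq_sum_iff_of_le fun j _ => add_le_add (hle j).1 (hle j).2).1
        (le_antisymm (Finset.sum_le_sum fun j _ => add_le_add (hle j).1 (hle j).2) hle')
    have heq' : ∀ j, cntLt d.1 j = cntLt δ.1 j ∧ cntLt d.2 j = cntLt δ.2 j := by
      have h0 : ∀ j ≤ n, cntLt d.1 j = cntLt δ.1 j ∧ cntLt d.2 j = cntLt δ.2 j := by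
        intro j hj
        have h1 := heq j (by simp; omega)
        have h2 := hle j
        omega
      intro j
      by_cases hj : j ≤ n
      · exact h0 j hj
      · have h1 := h0 n le_rfl
        rw [cntLt_eq_of_ge _ le_rfl, cntLt_eq_of_ge _ le_rfl, cntLt_eq_of_ge _ le_rfl,
          cntLt_eq_of_ge _ le_rfl] at h1
        rw [cntLt_eq_of_ge _ (by omega), cntLt_eq_of_ge _ (by omega), cntLt_eq_of_ge _ (by omega),
          cntLt_eq_of_ge _ (by omega)]
        exact h1
    exact Prod.ext (eq_of_cntLt_eq fun j => (heq' j).1) (eq_of_cntLt_eq fun j => (heq' j).2)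
  · have h1 := (hle n).1
    rw [cntLt_eq_of_ge _ le_rfl, cntLt_eq_of_ge _ le_rfl] at h1
    have := hδ.2.1
    omega

theorem StratumVanish.sub {K : Type u} [Field K] {n : ℕ}
    {f g : MvPolynomial ((Fin n × Fin n) ⊕ (Fin n × Fin n)) K} {A₀ B₀ A₁ B₁ : Finset (Fin n)}
    (hf : StratumVanish f A₀ B₀ A₁ B₁) (hg : StratumVanish g A₀ B₀ A₁ B₁) :
    StratumVanish (f - g) A₀ B₀ A₁ B₁ := by
  intro F _ _ L L' U U' X T h1 h2 h3 h4 h5 h6 h7 h8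
  rw [map_sub, hf F L L' U U' X T h1 h2 h3 h4 h5 h6 h7 h8,
    hg F L L' U U' X T h1 h2 h3 h4 h5 h6 h7 h8, sub_zero]

theorem pairIdeal_insert_le {Q : Type*} [CommRing Q] {n m : ℕ} {X T : Matrix (Fin n) (Fin n) Q}
    {Ω : Set (Finset (Fin n) × Finset (Fin n))} {ρW ρV : ℕ → ℕ} {a b : Fin m → Fin n}
    (ha : Function.Injective a) (hb : Function.Injective b) :
    pairIdeal X T (insert (Finset.univ.image a, Finset.univ.image b) Ω) ρW ρV ≤
      pairIdeal X T Ω ρW ρV ⊔ Ideal.span {(X.submatrix a b).det} := by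
  refine pairIdeal_le ?_ ?_ ?_ ?_
  · exact fun i j => Ideal.mem_sup_left (mul_mem_pairIdeal i j)
  · exact fun i j => Ideal.mem_sup_left (mul_mem_pairIdeal' i j)
  · intro m' a' b' ha' hb' h
    rcases h with h | h
    · rw [Prod.mk.injEq] at h
      refine Ideal.mem_sup_right ?_
      obtain ⟨ε, hε⟩ := Matrix.det_submatrix_range X ha' hb' ha hb
        (by rw [coe_image_univ, h.1, ← coe_image_univ]) (by rw [coe_image_univ, h.2, ← coe_image_univ])
      rw [hε, Units.smul_def, zsmul_eq_mul]
      exact Ideal.mul_mem_left _ _ (Ideal.mem_span_singleton_self _)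
    · exact Ideal.mem_sup_left (minor_mem_pairIdeal ha' hb' h)
  · exact fun m b a hb ha h => Ideal.mem_sup_left (minor_mem_pairIdeal' hb ha h)

/-- The inductive scheme reducing membership in `pairIdeal` to the case where all nonempty minors
of the first matrix vanish. -/
theorem mem_pairIdeal_of_pairVanish_of_base {K : Type u} [Field K] {n : ℕ}
    (C : (ℕ → ℕ) → (ℕ → ℕ) → Prop)
    (hC : ∀ ρW ρV A B, C ρW ρV → C (rhoStar (n := n) B ρW) (rhoStar (n := n) A ρV))
    (hC0 : ∀ ρW ρV, C ρW ρV → ρW n = 0 ∧ ρV n = 0)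
    (hbase : ∀ ρW ρV, C ρW ρV → ∀ (Ω : Set (Finset (Fin n) × Finset (Fin n))), (∅, ∅) ∉ Ω →
      (∀ d : Finset (Fin n) × Finset (Fin n), d.1.card = d.2.card → d.1.card ≠ 0 → d ∈ Ω) →
      ∀ (d : ℕ) (f : MvPolynomial ((Fin n × Fin n) ⊕ (Fin n × Fin n)) K), f.IsHomogeneous d →
        PairVanish f Ω ρW ρV → f ∈ pairIdeal (genX K n) (genT K n) Ω ρW ρV)
    (d : ℕ) {ρW ρV : ℕ → ℕ} (hρ : C ρW ρV) {Ω : Set (Finset (Fin n) × Finset (Fin n))}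
    (hΩ : MinorLower Ω) (hΩ0 : (∅, ∅) ∉ Ω)
    {f : MvPolynomial ((Fin n × Fin n) ⊕ (Fin n × Fin n)) K} (hf : f.IsHomogeneous d)
    (hvan : PairVanish f Ω ρW ρV) : f ∈ pairIdeal (genX K n) (genT K n) Ω ρW ρV := by
  classical
  induction d using Nat.strong_induction_on generalizing ρW ρV Ω f with
  | _ d ihd =>
  obtain ⟨N, hN⟩ : ∃ N, N = Set.ncard Ωᶜ := ⟨_, rfl⟩
  induction N using Nat.strong_induction_on generalizing Ω with
  | _ N ihN =>
  by_cases hall : ∃ d : Finset (Fin n) × Finset (Fin n), d.1.card = d.2.card ∧ d.1.card ≠ 0 ∧ d ∉ Ω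
  swap
  · push Not at hall
    exact hbase ρW ρV hρ Ω hΩ0 hall d f hf hvan
  obtain ⟨⟨A, B⟩, hcard, hne, hδΩ, hmin⟩ := exists_minimal_minor hall
  simp only at hcard hne
  let a : Fin A.card ↪o Fin n := A.orderEmbOfFin rfl
  let b : Fin A.card ↪o Fin n := B.orderEmbOfFin hcard.symm
  have hA : Set.range a = A := Finset.range_orderEmbOfFin _ _
  have hB : Set.range b = B := Finset.range_orderEmbOfFin _ _
  have hf' : f ∈ pairIdeal (genX K n) (genT K n) (insert (A, B) Ω) ρW ρV := by
    refine ihN (Set.ncard (insert (A, B) Ω)ᶜ) ?_ ?_ ?_ ?_ rfl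
    · rw [hN]
      refine Set.ncard_lt_ncard ?_ (Set.toFinite _)
      exact compl_lt_compl_iff_lt.2 (Set.ssubset_insert hδΩ)
    · rintro d (rfl | hd) d' hd' hle
      · by_cases h : d' = (A, B)
        · exact Or.inl h
        · exact Or.inr (hmin d' hd' hle h)
      · exact Or.inr (hΩ d hd d' hd' hle)
    · rintro (h | h)
      · rw [Prod.mk.injEq] at h
        exact hne (by rw [← h.1]; rfl)
      · exact hΩ0 h
    · intro A' B' A₁ B₁ h1 h2
      exact hvan A' B' A₁ B₁ h1 (fun h => h2 (Or.inr h))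
  have hf'' := pairIdeal_insert_le (Ω := Ω) (ρW := ρW) (ρV := ρV) (X := genX K n) (T := genT K n)
    a.injective b.injective (by rwa [image_univ_eq hA, image_univ_eq hB])
  obtain ⟨g, hg, hfg, hkd⟩ := MvPolynomial.exists_homogeneous_of_mem_sup rfl (by
    rintro p (((⟨i, j, rfl⟩ | ⟨i, j, rfl⟩) | ⟨m, a, b, ha, hb, h, rfl⟩) | ⟨m, a, b, ha, hb, h, rfl⟩)
    · exact ⟨2, Matrix.mul_apply_isHomogeneous (genX_isHomogeneous K) (genT_isHomogeneous K) i j⟩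
    · exact ⟨2, Matrix.mul_apply_isHomogeneous (genT_isHomogeneous K) (genX_isHomogeneous K) i j⟩
    · exact ⟨m, Matrix.det_isHomogeneous _ fun i j => genX_isHomogeneous K _ _⟩
    · exact ⟨m, Matrix.det_isHomogeneous _ fun i j => genT_isHomogeneous K _ _⟩)
    (Matrix.det_isHomogeneous ((genX K n).submatrix a b) fun i j => genX_isHomogeneous K _ _)
    hf hf''
  rcases hkd with hkd | rfl
  swap
  · rw [mul_zero, sub_zero] at hfg
    exact hfg
  have hvg : PairVanish g {d | ¬ MinorLe (A, B) d} (rhoStar B ρW) (rhoStar A ρV) := by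
    intro A' B' A₁' B₁' hc' hle' hA' hB' hB₁' hA₁'
    have hle' : MinorLe (A, B) (A', B') := not_not.1 hle'
    have h0 := hC0 _ _ (hC _ _ A B hρ)
    refine StratumVanish.of_pivots (fun i i' => rhoStar_admissible B ρW) h0.1
      (fun i i' => rhoStar_admissible A ρV) h0.2 ?_ hA' hB' hle' hB₁' hA₁'
    intro A₁ B₁ hAA hBB hB₁ hA₁
    refine StratumVanish.of_minor_mul (a := a) (b := b) hA hB ?_
    have e := (hvan A B A₁ B₁ hcard hδΩ hAA hBB (fun i => (hB₁ i).trans (rhoStar_le _ _ _))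
      (fun i => (hA₁ i).trans (rhoStar_le _ _ _))).sub
      (pairVanish_of_mem hΩ hfg A B A₁ B₁ hcard hδΩ hAA hBB
        (fun i => (hB₁ i).trans (rhoStar_le _ _ _)) (fun i => (hA₁ i).trans (rhoStar_le _ _ _)))
    rwa [sub_sub_cancel] at e
  have hgmem := ihd (d - A.card) (by omega) (hC _ _ A B hρ) (Ω := {d | ¬ MinorLe (A, B) d}) (by
      intro d hd d' _ hle hdd
      exact hd (hdd.trans hle)) (by
      simp only [Set.mem_ofPred_eq, not_not]
      intro j
      simp [cntLt]) hg hvg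
  have := minor_mul_mem_pairIdeal a.injective b.injective A B hA hB hmin hgmem
  have hfg' : f - ((genX K n).submatrix a b).det * g ∈
      pairIdeal (genX K n) (genT K n) Ω ρW ρV := hfg
  have h := add_mem hfg' this
  rwa [sub_add_cancel] at h

section
variable {K : Type*} [CommRing K] {n : ℕ} {F : Type*} [CommRing F] [Algebra K F]

theorem pairEval_sub_mem (J : Ideal F) {X T X' T' : Matrix (Fin n) (Fin n) F}
    (hX : ∀ i j, X i j - X' i j ∈ J) (hT : ∀ i j, T i j - T' i j ∈ J)
    (f : MvPolynomial ((Fin n × Fin n) ⊕ (Fin n × Fin n)) K) :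
    pairEval X T f - pairEval X' T' f ∈ J := by
  rw [← Ideal.Quotient.eq]
  have h1 := map_pairEval (Ideal.Quotient.mkₐ K J) X T f
  have h2 := map_pairEval (Ideal.Quotient.mkₐ K J) X' T' f
  refine h1.trans (Eq.trans ?_ h2.symm)
  congr 2
  · exact Matrix.ext fun i j => Ideal.Quotient.eq.2 (hX i j)
  · exact Matrix.ext fun i j => Ideal.Quotient.eq.2 (hT i j)

theorem pairEval_isHomogeneous {σ : Type*} {X T : Matrix (Fin n) (Fin n) (MvPolynomial σ K)}
    (hX : ∀ i j, (X i j).IsHomogeneous 1) (hT : ∀ i j, (T i j).IsHomogeneous 1)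
    {f : MvPolynomial ((Fin n × Fin n) ⊕ (Fin n × Fin n)) K} {d : ℕ} (hf : f.IsHomogeneous d) :
    (pairEval X T f).IsHomogeneous d := by
  have := hf.aeval (Sum.elim (fun p => X p.1 p.2) (fun p => T p.1 p.2)) (n := 1) (by
    rintro (p | p)
    · exact hX _ _
    · exact hT _ _)
  rwa [one_mul] at this

theorem pairEval_pairEval {F' : Type*} [CommRing F'] [Algebra K F']
    (X T : Matrix (Fin n) (Fin n) F')
    (X' T' : Matrix (Fin n) (Fin n) (MvPolynomial ((Fin n × Fin n) ⊕ (Fin n × Fin n)) K))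
    (f : MvPolynomial ((Fin n × Fin n) ⊕ (Fin n × Fin n)) K) :
    pairEval X T (pairEval X' T' f) = pairEval (X'.map (pairEval X T)) (T'.map (pairEval X T)) f :=
  map_pairEval _ _ _ _

end

section
variable {Q : Type*} [CommRing Q] {n : ℕ} {X T : Matrix (Fin n) (Fin n) Q}
    {Ω : Set (Finset (Fin n) × Finset (Fin n))} {ρW ρV : ℕ → ℕ}

theorem apply_mem_pairIdeal {i j : Fin n} (h : ({i}, {j}) ∈ Ω) :
    X i j ∈ pairIdeal X T Ω ρW ρV := by
  have := minor_mem_pairIdeal (X := X) (T := T) (Ω := Ω) (ρW := ρW) (ρV := ρV) (m := 1)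
    (a := fun _ => i) (b := fun _ => j) (Function.injective_of_subsingleton _)
    (Function.injective_of_subsingleton _) (by simpa using h)
  simpa using this

theorem apply_mem_pairIdeal' {i j : Fin n} (h : ρW i < 1) :
    T i j ∈ pairIdeal X T Ω ρW ρV := by
  have := minor_mem_pairIdeal' (X := X) (T := T) (Ω := Ω) (ρW := ρW) (ρV := ρV) (m := 1)
    (b := fun _ => i) (a := fun _ => j) (Function.injective_of_subsingleton _)
    (Function.injective_of_subsingleton _) ⟨i, Or.inl (by
      simpa [cntGe, Finset.filter_singleton] using h)⟩
  simpa using this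

end

theorem Matrix.submatrix_rev_mul {R : Type*} [CommRing R] {n : ℕ} (M N : Matrix (Fin n) (Fin n) R) :
    (M * N).submatrix Fin.rev Fin.rev =
      M.submatrix Fin.rev Fin.rev * N.submatrix Fin.rev Fin.rev :=
  (Matrix.submatrix_mul_equiv M N _ Fin.revPerm _).symm

theorem Matrix.submatrix_rev_one {R : Type*} [CommRing R] {n : ℕ} :
    (1 : Matrix (Fin n) (Fin n) R).submatrix Fin.rev Fin.rev = 1 :=
  Matrix.submatrix_one_equiv Fin.revPerm

theorem cntGe_image_rev {n : ℕ} (A : Finset (Fin n)) (i : ℕ) :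
    cntGe (A.image Fin.rev) i = cntLt A (n - i) := by
  unfold cntGe cntLt
  rw [Finset.filter_image, Finset.card_image_of_injective _ Fin.rev_injective]
  congr 1
  refine Finset.filter_congr fun x _ => ?_
  rw [Fin.val_rev]
  omega

theorem mem_pairIdeal_of_pairVanish_zero {K : Type u} [Field K] {n d : ℕ}
    {Ω : Set (Finset (Fin n) × Finset (Fin n))} (hΩ : MinorLower Ω) (hΩ0 : (∅, ∅) ∉ Ω)
    {f : MvPolynomial ((Fin n × Fin n) ⊕ (Fin n × Fin n)) K} (hf : f.IsHomogeneous d)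
    (hvan : PairVanish f Ω 0 0) : f ∈ pairIdeal (genX K n) (genT K n) Ω 0 0 := by
  refine mem_pairIdeal_of_pairVanish_of_base (fun ρW ρV => ρW = 0 ∧ ρV = 0) ?_ ?_ ?_ d ⟨rfl, rfl⟩
    hΩ hΩ0 hf hvan
  · rintro _ _ A B ⟨rfl, rfl⟩
    exact ⟨funext fun i => Nat.le_zero.1 (rhoStar_le _ _ _),
      funext fun i => Nat.le_zero.1 (rhoStar_le _ _ _)⟩
  · rintro _ _ ⟨rfl, rfl⟩
    exact ⟨rfl, rfl⟩
  · rintro _ _ ⟨rfl, rfl⟩ Ω h0 hall d f hf hvan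
    have h1 := hvan ∅ ∅ ∅ ∅ rfl h0 (by simp) (by simp) (by simp [cntGe]) (by simp [cntGe])
      K 1 1 1 1 0 0 (fun i j h => Matrix.one_apply_ne h.ne) (fun i j h => Matrix.one_apply_ne h.ne)
      (fun i j h => Matrix.one_apply_ne h.ne') (fun i j h => Matrix.one_apply_ne h.ne')
      (one_mul 1) (one_mul 1) (by simp) (by simp)
    have h2 := map_pairEval (Algebra.ofId K (MvPolynomial ((Fin n × Fin n) ⊕ (Fin n × Fin n)) K))
      (1 * 0 * 1) (1 * 0 * 1) f
    rw [h1, map_zero] at h2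
    have h3 := pairEval_sub_mem (pairIdeal (genX K n) (genT K n) Ω 0 0) (X := genX K n)
      (T := genT K n) (X' := (1 * 0 * 1 : Matrix (Fin n) (Fin n) K).map (Algebra.ofId K _))
      (T' := (1 * 0 * 1 : Matrix (Fin n) (Fin n) K).map (Algebra.ofId K _)) (by
        intro i j
        simpa using apply_mem_pairIdeal (hall _ (by simp) (by simp))) (by
        intro i j
        simpa using apply_mem_pairIdeal' (by simp)) f
    rwa [← h2, sub_zero, pairEval_gen] at h3

theorem mem_pairIdeal_of_pairVanish {K : Type u} [Field K] {n d : ℕ} {ρW ρV : ℕ → ℕ}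
    (hρW : ρW n = 0) (hρV : ρV n = 0)
    {Ω : Set (Finset (Fin n) × Finset (Fin n))} (hΩ : MinorLower Ω) (hΩ0 : (∅, ∅) ∉ Ω)
    {f : MvPolynomial ((Fin n × Fin n) ⊕ (Fin n × Fin n)) K} (hf : f.IsHomogeneous d)
    (hvan : PairVanish f Ω ρW ρV) : f ∈ pairIdeal (genX K n) (genT K n) Ω ρW ρV := by
  classical
  refine mem_pairIdeal_of_pairVanish_of_base (fun ρW ρV => ρW n = 0 ∧ ρV n = 0) ?_ ?_ ?_ d
    ⟨hρW, hρV⟩ hΩ hΩ0 hf hvan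
  · rintro ρW ρV A B ⟨h1, h2⟩
    exact ⟨Nat.le_zero.1 ((rhoStar_le _ _ _).trans h1.le),
      Nat.le_zero.1 ((rhoStar_le _ _ _).trans h2.le)⟩
  · exact fun _ _ h => h
  clear hvan hf f d hΩ0 hΩ Ω hρV hρW ρV ρW
  rintro ρW ρV - Ω h0 hall d f hf hvan
  let Ω' : Set (Finset (Fin n) × Finset (Fin n)) :=
    {e | ∃ i, ρW i < cntGe (e.1.image Fin.rev) i ∨ ρV i < cntGe (e.2.image Fin.rev) i}
  let f' : MvPolynomial ((Fin n × Fin n) ⊕ (Fin n × Fin n)) K :=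
    pairEval 0 ((genX K n).submatrix Fin.rev Fin.rev) f
  have hf' : f'.IsHomogeneous d := pairEval_isHomogeneous
    (fun i j => MvPolynomial.isHomogeneous_zero _ _ _) (fun i j => genX_isHomogeneous K _ _) hf
  have hmem : f' ∈ pairIdeal (genX K n) (genT K n) Ω' 0 0 := by
    refine mem_pairIdeal_of_pairVanish_zero ?_ ?_ hf' ?_
    · rintro e ⟨i, hi⟩ e' _ hle
      refine ⟨i, ?_⟩
      have := hle (n - i)
      simp only [cntGe_image_rev] at hi ⊢
      omega
    · rintro ⟨i, hi⟩
      simp [cntGe] at hi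
    · intro A B A₁ B₁ hAB hΩ' _ _ _ _ F _ _ L L' U U' X T h1 h2 h3 h4 h5 h6 h7 h8
      have hΩ' : ∀ i, cntGe (A.image Fin.rev) i ≤ ρW i ∧ cntGe (B.image Fin.rev) i ≤ ρV i := by
        intro i
        by_contra h
        exact hΩ' ⟨i, by simp only; omega⟩
      have h := hvan ∅ ∅ (B.image Fin.rev) (A.image Fin.rev) rfl h0 (by simp) (by simp)
        (fun i => (hΩ' i).1) (fun i => (hΩ' i).2) F
        (U'.submatrix Fin.rev Fin.rev) (U.submatrix Fin.rev Fin.rev)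
        (L'.submatrix Fin.rev Fin.rev) (L.submatrix Fin.rev Fin.rev)
        0 (X.submatrix Fin.rev Fin.rev)
        (fun i j hij => h4 _ _ (Fin.rev_lt_rev.2 hij)) (fun i j hij => h3 _ _ (Fin.rev_lt_rev.2 hij))
        (fun i j hij => h2 _ _ (Fin.rev_lt_rev.2 hij)) (fun i j hij => h1 _ _ (Fin.rev_lt_rev.2 hij))
        (by rw [← Matrix.submatrix_rev_mul, mul_eq_one_comm.1 h6, Matrix.submatrix_rev_one])
        (by rw [← Matrix.submatrix_rev_mul, mul_eq_one_comm.1 h5, Matrix.submatrix_rev_one]) (by simp) (by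
          intro i j hij
          refine h7 _ _ fun hh => hij ⟨?_, ?_⟩
          · exact Finset.mem_image.2 ⟨_, hh.1, Fin.rev_rev _⟩
          · exact Finset.mem_image.2 ⟨_, hh.2, Fin.rev_rev _⟩)
      rw [pairEval_pairEval]
      refine Eq.trans ?_ h
      congr 2
      · simp
      · rw [← Matrix.submatrix_map, map_pairEval_genX, Matrix.submatrix_rev_mul,
          Matrix.submatrix_rev_mul]
  have hmem' := Ideal.mem_map_of_mem
    (pairEval ((genT K n).submatrix Fin.rev Fin.rev) 0 :
      MvPolynomial ((Fin n × Fin n) ⊕ (Fin n × Fin n)) K →ₐ[K] _).toRingHom hmem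
  replace hmem' := map_pairIdeal_le _ hmem'
  have e1 : (genX K n).map (pairEval ((genT K n).submatrix Fin.rev Fin.rev) 0 :
      MvPolynomial ((Fin n × Fin n) ⊕ (Fin n × Fin n)) K →ₐ[K] _).toRingHom =
      (genT K n).submatrix Fin.rev Fin.rev := map_pairEval_genX _ _
  have e2 : (genT K n).map (pairEval ((genT K n).submatrix Fin.rev Fin.rev) 0 :
      MvPolynomial ((Fin n × Fin n) ⊕ (Fin n × Fin n)) K →ₐ[K] _).toRingHom =
      0 := map_pairEval_genT _ _
  have e3 : (pairEval ((genT K n).submatrix Fin.rev Fin.rev) 0 :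
      MvPolynomial ((Fin n × Fin n) ⊕ (Fin n × Fin n)) K →ₐ[K] _).toRingHom f' =
      pairEval 0 (genT K n) f := by
    refine (pairEval_pairEval _ _ _ _ _).trans ?_
    rw [← Matrix.submatrix_map, map_pairEval_genX, Matrix.submatrix_submatrix,
      Matrix.map_zero _ (map_zero _), Fin.rev_involutive.comp_self, Matrix.submatrix_id_id]
  rw [e1, e2, e3] at hmem'
  have hle : pairIdeal ((genT K n).submatrix Fin.rev Fin.rev) 0 Ω' 0 0 ≤
      pairIdeal (genX K n) (genT K n) Ω ρW ρV := by
    refine pairIdeal_le (by simp) (by simp) ?_ ?_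
    · rintro m a b ha hb ⟨i, hi⟩
      rw [Matrix.submatrix_submatrix]
      refine minor_mem_pairIdeal' (Fin.rev_injective.comp ha) (Fin.rev_injective.comp hb) ⟨i, ?_⟩
      rwa [← Finset.image_image, ← Finset.image_image]
    · rintro m a b ha hb ⟨i, hi⟩
      have hm : Nonempty (Fin m) := by
        by_contra hm
        rw [not_nonempty_iff] at hm
        simp [cntGe] at hi
      rw [Matrix.submatrix_zero, Pi.zero_apply, Pi.zero_apply, Matrix.det_zero]
      exact zero_mem _
  have h3 := pairEval_sub_mem (pairIdeal (genX K n) (genT K n) Ω ρW ρV) (X := genX K n)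
    (T := genT K n) (X' := 0) (T' := genT K n) (by
      intro i j
      simpa using apply_mem_pairIdeal (hall _ (by simp) (by simp))) (by simp) f
  have := add_mem h3 (hle hmem')
  rwa [sub_add_cancel, pairEval_gen] at this

/-- The ideal generated by the entries of the two products of a pair of generic matrices contains
every homogeneous polynomial vanishing on all pairs with zero products. -/
theorem mem_span_of_vanish {K : Type u} [Field K] {n d : ℕ}
    {f : MvPolynomial ((Fin n × Fin n) ⊕ (Fin n × Fin n)) K} (hf : f.IsHomogeneous d)
    (hvan : ∀ (F : Type u) [Field F] [Algebra K F] (X T : Matrix (Fin n) (Fin n) F),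
      X * T = 0 → T * X = 0 → pairEval X T f = 0) :
    f ∈ Ideal.span ({p | ∃ i j, p = (genX K n * genT K n) i j} ∪
      {p | ∃ i j, p = (genT K n * genX K n) i j}) := by
  have h := mem_pairIdeal_of_pairVanish (ρW := fun i => n - i) (ρV := fun i => n - i) (Ω := ∅)
    (by simp) (by simp) (fun d h => h.elim) (fun h => h) hf (by
      intro A B A₁ B₁ _ _ hA hB _ _ F _ _ L L' U U' X T _ _ _ _ hL hU hX hT
      refine hvan F _ _ ?_ ?_
      · have : X * T = 0 := Matrix.mul_eq_zero_of_disjoint hB (fun i j hj => hX i j fun h => hj h.2)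
          (fun i j hi => hT i j fun h => hi h.1)
        calc L * X * U * (U' * T * L') = L * X * (U * U') * T * L' := by
              simp only [Matrix.mul_assoc]
          _ = L * (X * T) * L' := by rw [hU, Matrix.mul_one, Matrix.mul_assoc L]
          _ = 0 := by rw [this]; simp
      · have : T * X = 0 := Matrix.mul_eq_zero_of_disjoint hA.symm
          (fun i j hj => hT i j fun h => hj h.2) (fun i j hi => hX i j fun h => hi h.1)
        calc U' * T * L' * (L * X * U) = U' * T * (L' * L) * X * U := by
              simp only [Matrix.mul_assoc]
          _ = U' * (T * X) * U := by rw [mul_eq_one_comm.1 hL, Matrix.mul_one, Matrix.mul_assoc U']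
          _ = 0 := by rw [this]; simp)
  refine (show pairIdeal (genX K n) (genT K n) ∅ (fun i => n - i) (fun i => n - i) ≤ _ from
    pairIdeal_le (fun i j => Ideal.subset_span (Or.inl ⟨i, j, rfl⟩))
    (fun i j => Ideal.subset_span (Or.inr ⟨i, j, rfl⟩)) (fun m a b _ _ h => h.elim) ?_) h
  rintro m b a hb ha ⟨i, hi⟩
  exfalso
  have key : ∀ B : Finset (Fin n), cntGe B i ≤ n - i := by
    intro B
    have h1 : cntGe B i ≤ cntGe Finset.univ i := Finset.card_le_card
      (Finset.filter_subset_filter _ (Finset.subset_univ _))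
    refine h1.trans ?_
    have h2 := cntGe_image_rev (Finset.univ : Finset (Fin n)) i
    rw [Finset.image_univ_of_surjective Fin.rev_surjective] at h2
    rw [h2]
    unfold cntLt
    simp [Fin.card_filter_val_lt]
  have h1 := key (Finset.univ.image b)
  have h2 := key (Finset.univ.image a)
  omega

theorem Matrix.exists_eq_mul_diagonal_mul {F : Type*} [Field F] {n : ℕ}
    (X : Matrix (Fin n) (Fin n) F) :
    ∃ (G G' H H' : Matrix (Fin n) (Fin n) F) (D : Fin n → F),
      G * G' = 1 ∧ H * H' = 1 ∧ X = G * diagonal D * H := by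
  obtain ⟨L, L', D, h⟩ := Matrix.Pivot.exists_list_transvec_mul_diagonal_mul_list_transvec X
  refine ⟨_, _, _, _, D, Matrix.mul_nonsing_inv _ ?_, Matrix.mul_nonsing_inv _ ?_, h⟩
  · rw [TransvectionStruct.det_toMatrix_prod]
    exact isUnit_one
  · rw [TransvectionStruct.det_toMatrix_prod]
    exact isUnit_one

theorem Matrix.exists_curve {F : Type*} [Field F] {n : ℕ} {X T : Matrix (Fin n) (Fin n) F}
    (hXT : X * T = 0) (hTX : T * X = 0) :
    ∃ (X' T' : Matrix (Fin n) (Fin n) (Polynomial F)) (c : Polynomial F), c ≠ 0 ∧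
      X' * T' = c • 1 ∧ X'.map (Polynomial.eval 0) = X ∧ T'.map (Polynomial.eval 0) = T := by
  classical
  obtain ⟨G, G', H, H', D, hG, hH, rfl⟩ := Matrix.exists_eq_mul_diagonal_mul X
  have hG' := mul_eq_one_comm.1 hG
  have hH' := mul_eq_one_comm.1 hH
  let e : Matrix (Fin n) (Fin n) F := diagonal fun i => if D i = 0 then 1 else 0
  let E : Matrix (Fin n) (Fin n) F := diagonal fun i => (D i)⁻¹
  let S := H * T * G
  have hDS : diagonal D * S = 0 := by
    calc diagonal D * S = G' * (G * diagonal D * H * T) * G := by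
          simp only [S, ← Matrix.mul_assoc, hG', Matrix.one_mul]
      _ = 0 := by rw [hXT]; simp
  have hSD : S * diagonal D = 0 := by
    calc S * diagonal D = H * (T * (G * diagonal D * H)) * H' := by
          simp only [S, Matrix.mul_assoc, hH, Matrix.mul_one]
      _ = 0 := by rw [hTX]; simp
  have heS : e * S = S := by
    refine Matrix.ext fun i j => ?_
    have h := congrFun (congrFun hDS i) j
    simp only [e, Matrix.diagonal_mul, Matrix.zero_apply, mul_eq_zero] at h ⊢
    split_ifs with hi
    · rw [one_mul]
    · rw [h.resolve_left hi, mul_zero]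
  have hSe : S * e = S := by
    refine Matrix.ext fun i j => ?_
    have h := congrFun (congrFun hSD i) j
    simp only [e, Matrix.mul_diagonal, Matrix.zero_apply, mul_eq_zero] at h ⊢
    split_ifs with hi
    · rw [mul_one]
    · rw [h.resolve_right hi, zero_mul]
  have hDe : diagonal D * e = 0 := by
    rw [Matrix.diagonal_mul_diagonal, ← Matrix.diagonal_zero]
    congr 1
    ext i
    by_cases hi : D i = 0 <;> simp [hi]
  have heE : e * E = 0 := by
    rw [Matrix.diagonal_mul_diagonal, ← Matrix.diagonal_zero]
    congr 1
    ext i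
    by_cases hi : D i = 0 <;> simp [hi]
  have hee : e * e = e := by
    rw [Matrix.diagonal_mul_diagonal]
    congr 1
    ext i
    by_cases hi : D i = 0 <;> simp [hi]
  have hDE : diagonal D * E + e = 1 := by
    rw [Matrix.diagonal_mul_diagonal, Matrix.diagonal_add, ← Matrix.diagonal_one]
    congr 1
    ext i
    by_cases hi : D i = 0 <;> simp [hi]
  let κ : Matrix (Fin n) (Fin n) F →+* Matrix (Fin n) (Fin n) (Polynomial F) :=
    (Polynomial.C : F →+* Polynomial F).mapMatrix
  let ν : Matrix (Fin n) (Fin n) (Polynomial F) →+* Matrix (Fin n) (Fin n) F :=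
    (Polynomial.evalRingHom (0 : F)).mapMatrix
  have hνκ : ∀ M, ν (κ M) = M := fun M => Matrix.ext fun i j => by simp [ν, κ]
  have hνs : ∀ (p : Polynomial F) M, ν (p • M) = p.eval 0 • ν M :=
    fun p M => Matrix.ext fun i j => by simp [ν]
  let N : Matrix (Fin n) (Fin n) (Polynomial F) := (Polynomial.X : Polynomial F) • 1 + κ S
  have hN0 : N.det ≠ 0 := by
    have : N = charmatrix (-S) := by
      refine Matrix.ext fun i j => ?_
      simp [N, κ, charmatrix_apply, Matrix.diagonal_apply, Matrix.one_apply]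
    rw [this]
    exact (Matrix.charpoly_monic (-S)).ne_zero
  have hνN : ν N = S := by
    rw [map_add, hνs, hνκ]
    simp
  have heN : κ e * N * κ e = N * κ e := by
    simp only [N, mul_add, add_mul, Matrix.mul_smul, Matrix.smul_mul, mul_one, one_mul, ← map_mul,
      hee, heS]
  have hDN : κ (diagonal D) * N * κ e = 0 := by
    simp only [N, mul_add, Matrix.mul_smul, Matrix.smul_mul, mul_one, ← map_mul,
      hDe, hDS, map_zero, smul_zero, add_zero]
  refine ⟨κ G * (κ (diagonal D) + (Polynomial.X : Polynomial F) • (N.adjugate * κ e)) * κ H,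
    κ H' * (N * κ e + ((Polynomial.X : Polynomial F) * N.det) • κ E) * κ G',
    Polynomial.X * N.det, mul_ne_zero Polynomial.X_ne_zero hN0, ?_, ?_, ?_⟩
  · have key : (κ (diagonal D) + (Polynomial.X : Polynomial F) • (N.adjugate * κ e)) *
        (N * κ e + ((Polynomial.X : Polynomial F) * N.det) • κ E) =
        (Polynomial.X * N.det) • 1 := by
      have h1 : N.adjugate * κ e * (N * κ e) = N.det • κ e := by
        calc N.adjugate * κ e * (N * κ e) = N.adjugate * (κ e * N * κ e) := by
              simp only [Matrix.mul_assoc]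
          _ = N.det • κ e := by
              rw [heN, ← Matrix.mul_assoc, Matrix.adjugate_mul, Matrix.smul_mul, one_mul]
      have h2 : N.adjugate * κ e * κ E = 0 := by
        rw [Matrix.mul_assoc, ← map_mul, heE, map_zero, mul_zero]
      rw [add_mul, mul_add, mul_add, ← Matrix.mul_assoc, hDN, Matrix.smul_mul, h1, Matrix.mul_smul,
        Matrix.mul_smul, Matrix.smul_mul, h2, smul_zero, smul_zero, add_zero, zero_add, ← map_mul,
        smul_smul, ← smul_add, ← map_add, hDE, map_one]
    calc _ = κ G * (κ (diagonal D) + (Polynomial.X : Polynomial F) • (N.adjugate * κ e)) *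
          (κ H * κ H') * (N * κ e + ((Polynomial.X : Polynomial F) * N.det) • κ E) * κ G' := by
            simp only [Matrix.mul_assoc]
      _ = κ G * ((κ (diagonal D) + (Polynomial.X : Polynomial F) • (N.adjugate * κ e)) *
          (N * κ e + ((Polynomial.X : Polynomial F) * N.det) • κ E)) * κ G' := by
            rw [← map_mul κ H, hH, map_one, mul_one, Matrix.mul_assoc (κ G)]
      _ = _ := by
            rw [key, Matrix.mul_smul, mul_one, Matrix.smul_mul, ← map_mul, hG, map_one]
  · change ν _ = _
    simp only [map_mul, map_add, hνs, hνκ, Polynomial.eval_X, zero_smul, add_zero]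
  · change ν _ = _
    simp only [map_mul, map_add, hνs, hνκ, Polynomial.eval_X, Polynomial.eval_mul, zero_mul,
      zero_smul, add_zero, hνN, hSe]
    calc H' * S * G' = (H' * H) * T * (G * G') := by simp only [S, Matrix.mul_assoc]
      _ = T := by rw [hH', hG]; simp

/-- Vanishing on pairs of matrices whose products are equal nonzero scalar matrices. -/
def ScalarVanish {K : Type u} [Field K] {n : ℕ}
    (f : MvPolynomial ((Fin n × Fin n) ⊕ (Fin n × Fin n)) K) : Prop :=
  ∀ (F : Type u) [Field F] [Algebra K F] (X T : Matrix (Fin n) (Fin n) F) (c : F), c ≠ 0 →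
    X * T = c • 1 → T * X = c • 1 → pairEval X T f = 0

theorem Matrix.mul_eq_smul_one_comm {F : Type*} [Field F] {n : ℕ} {X T : Matrix (Fin n) (Fin n) F}
    {c : F} (hc : c ≠ 0) (h : X * T = c • 1) : T * X = c • 1 := by
  have h1 : (c⁻¹ • X) * T = 1 := by
    rw [Matrix.smul_mul, h, smul_smul, inv_mul_cancel₀ hc, one_smul]
  have h2 := mul_eq_one_comm.1 h1
  rw [Matrix.mul_smul] at h2
  rw [← h2, smul_smul, mul_inv_cancel₀ hc, one_smul]

theorem ScalarVanish.pairEval_eq_zero {K : Type u} [Field K] {n : ℕ}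
    {f : MvPolynomial ((Fin n × Fin n) ⊕ (Fin n × Fin n)) K} (hf : ScalarVanish f)
    {F : Type u} [Field F] [Algebra K F] {X T : Matrix (Fin n) (Fin n) F} (hXT : X * T = 0)
    (hTX : T * X = 0) : pairEval X T f = 0 := by
  obtain ⟨X', T', c, hc, hprod, rfl, rfl⟩ := Matrix.exists_curve hXT hTX
  refine pairEval_curve X' T' ?_
  have hcne : algebraMap _ (FractionRing (Polynomial F)) c ≠ 0 :=
    (map_ne_zero_iff _ (IsFractionRing.injective _ _)).2 hc
  have h : X'.map (algebraMap _ (FractionRing (Polynomial F))) *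
      T'.map (algebraMap _ (FractionRing (Polynomial F))) =
      algebraMap _ (FractionRing (Polynomial F)) c • 1 := by
    rw [← Matrix.map_mul, hprod]
    refine Matrix.ext fun i j => ?_
    by_cases hij : i = j <;> simp [hij]
  exact hf _ _ _ _ hcne h (Matrix.mul_eq_smul_one_comm hcne h)

/-- The ideal expressing that both products of two matrices are equal scalar matrices. -/
def scalarIdeal {Q : Type*} [CommRing Q] {n : ℕ} (i₀ : Fin n) (X T : Matrix (Fin n) (Fin n) Q) :
    Ideal Q :=
  Ideal.span ({p | ∃ i j, p = (X * T - (X * T) i₀ i₀ • 1) i j} ∪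
    {p | ∃ i j, p = (T * X - (X * T) i₀ i₀ • 1) i j})

theorem pairEval_eq_zero_of_mem_scalarIdeal {K : Type*} [CommRing K] {n : ℕ} {i₀ : Fin n}
    {f : MvPolynomial ((Fin n × Fin n) ⊕ (Fin n × Fin n)) K}
    (hf : f ∈ scalarIdeal i₀ (genX K n) (genT K n)) {F : Type*} [CommRing F] [Algebra K F]
    {X T : Matrix (Fin n) (Fin n) F} {c : F} (hXT : X * T = c • 1) (hTX : T * X = c • 1) :
    pairEval X T f = 0 := by
  let φ := (pairEval X T : MvPolynomial ((Fin n × Fin n) ⊕ (Fin n × Fin n)) K →ₐ[K] F)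
  have e1 : ∀ i j, φ ((genX K n * genT K n) i j) = c * (1 : Matrix (Fin n) (Fin n) F) i j := by
    intro i j
    have : (genX K n * genT K n).map φ = c • 1 := by
      rw [Matrix.map_mul, map_pairEval_genX, map_pairEval_genT, hXT]
    exact congrFun (congrFun this i) j
  have e2 : ∀ i j, φ ((genT K n * genX K n) i j) = c * (1 : Matrix (Fin n) (Fin n) F) i j := by
    intro i j
    have : (genT K n * genX K n).map φ = c • 1 := by
      rw [Matrix.map_mul, map_pairEval_genX, map_pairEval_genT, hTX]
    exact congrFun (congrFun this i) j
  have hle : scalarIdeal i₀ (genX K n) (genT K n) ≤ RingHom.ker φ := by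
    refine Ideal.span_le.2 ?_
    rintro p (⟨i, j, rfl⟩ | ⟨i, j, rfl⟩)
    · change φ _ = 0
      rw [Matrix.sub_apply, Matrix.smul_apply, map_sub, smul_eq_mul, map_mul, e1, e1,
        Matrix.one_apply_eq, mul_one]
      by_cases hij : i = j <;> simp [Matrix.one_apply, hij]
    · change φ _ = 0
      rw [Matrix.sub_apply, Matrix.smul_apply, map_sub, smul_eq_mul, map_mul, e1, e2,
        Matrix.one_apply_eq, mul_one]
      by_cases hij : i = j <;> simp [Matrix.one_apply, hij]
  exact hle hf

theorem mem_scalarIdeal_of_scalarVanish {K : Type u} [Field K] {n : ℕ} (i₀ : Fin n) (d : ℕ)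
    {f : MvPolynomial ((Fin n × Fin n) ⊕ (Fin n × Fin n)) K} (hd : f.IsHomogeneous d)
    (hf : ScalarVanish f) : f ∈ scalarIdeal i₀ (genX K n) (genT K n) := by
  induction d using Nat.strong_induction_on generalizing f with
  | _ d ih =>
  have h1 := mem_span_of_vanish hd fun F _ _ X T h h' => hf.pairEval_eq_zero h h'
  set l := (genX K n * genT K n) i₀ i₀ with hl
  have hl2 : l.IsHomogeneous 2 :=
    Matrix.mul_apply_isHomogeneous (genX_isHomogeneous K) (genT_isHomogeneous K) i₀ i₀
  have hl1 : ∀ i j, (l • (1 : Matrix (Fin n) (Fin n) 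
      (MvPolynomial ((Fin n × Fin n) ⊕ (Fin n × Fin n)) K))) i j ∈
      Ideal.span {l} := by
    intro i j
    rw [Matrix.smul_apply, smul_eq_mul]
    exact Ideal.mul_mem_right _ _ (Ideal.mem_span_singleton_self l)
  have hl1' : ∀ i j, ((l • (1 : Matrix (Fin n) (Fin n)
      (MvPolynomial ((Fin n × Fin n) ⊕ (Fin n × Fin n)) K))) i j).IsHomogeneous 2 := by
    intro i j
    by_cases hij : i = j
    · subst hij
      simpa using hl2
    · simpa [Matrix.one_apply, hij] using MvPolynomial.isHomogeneous_zero _ _ _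
  have h2 : f ∈ scalarIdeal i₀ (genX K n) (genT K n) ⊔ Ideal.span {l} := by
    refine Ideal.span_le.2 ?_ h1
    rintro p (⟨i, j, rfl⟩ | ⟨i, j, rfl⟩)
    · have := add_mem (Ideal.mem_sup_left (T := Ideal.span {l})
        (Ideal.subset_span (Or.inl ⟨i, j, rfl⟩) :
          _ ∈ scalarIdeal i₀ (genX K n) (genT K n))) (Ideal.mem_sup_right (hl1 i j))
      rwa [Matrix.sub_apply, sub_add_cancel] at this
    · have := add_mem (Ideal.mem_sup_left (T := Ideal.span {l})
        (Ideal.subset_span (Or.inr ⟨i, j, rfl⟩) :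
          _ ∈ scalarIdeal i₀ (genX K n) (genT K n))) (Ideal.mem_sup_right (hl1 i j))
      rwa [Matrix.sub_apply, sub_add_cancel] at this
  obtain ⟨g, hg, hfg, hkd⟩ := MvPolynomial.exists_homogeneous_of_mem_sup
    (J := scalarIdeal i₀ (genX K n) (genT K n)) rfl (by
      rintro p (⟨i, j, rfl⟩ | ⟨i, j, rfl⟩)
      · exact ⟨2, (Matrix.mul_apply_isHomogeneous (genX_isHomogeneous K)
          (genT_isHomogeneous K) i j).sub (hl1' i j)⟩
      · exact ⟨2, (Matrix.mul_apply_isHomogeneous (genT_isHomogeneous K)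
          (genX_isHomogeneous K) i j).sub (hl1' i j)⟩) hl2 hd h2
  rcases hkd with hkd | rfl
  swap
  · rwa [mul_zero, sub_zero] at hfg
  have hgv : ScalarVanish g := by
    intro F _ _ X T c hc hXT hTX
    have e := pairEval_eq_zero_of_mem_scalarIdeal hfg hXT hTX
    rw [map_sub, map_mul, hf F X T c hc hXT hTX, zero_sub, neg_eq_zero] at e
    refine (mul_eq_zero.1 e).resolve_left ?_
    have : (genX K n * genT K n).map (pairEval X T) = c • 1 := by
      rw [Matrix.map_mul, map_pairEval_genX, map_pairEval_genT, hXT]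
    have := congrFun (congrFun this i₀) i₀
    rw [Matrix.map_apply] at this
    rw [hl, this]
    simpa using hc
  have := add_mem hfg (Ideal.mul_mem_left _ l (ih (d - 2) (by omega) hg hgv))
  rwa [sub_add_cancel] at this

theorem scalarVanish_of_adjugate {K : Type u} [Field K] {n : ℕ}
    {f : MvPolynomial ((Fin n × Fin n) ⊕ (Fin n × Fin n)) K}
    (hf : ∀ (F : Type u) [Field F] [Algebra K F] (X : Matrix (Fin n) (Fin n) F) (t : F),
      pairEval X (t • X.adjugate) f = 0) : ScalarVanish f := by
  intro F _ _ X T c hc hXT hTX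
  have hdet : X.det ≠ 0 := by
    intro h0
    have := congrArg Matrix.det hXT
    rw [Matrix.det_mul, h0, zero_mul, Matrix.det_smul, Matrix.det_one, mul_one] at this
    exact pow_ne_zero _ hc this.symm
  have hT : T = (c * X.det⁻¹) • X.adjugate := by
    have h : X.adjugate * (X * T) = c • X.adjugate := by
      rw [hXT, Matrix.mul_smul, Matrix.mul_one]
    rw [← Matrix.mul_assoc, Matrix.adjugate_mul, Matrix.smul_mul, Matrix.one_mul] at h
    rw [mul_comm, mul_smul, ← h, smul_smul, inv_mul_cancel₀ hdet, one_smul]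
  rw [hT]
  exact hf F X _

open IsLocalRing in
/-- In a local ring, an element of `span s = 𝔪` outside `𝔪²` can be exchanged for a generator. -/
theorem IsLocalRing.exists_span_insert_erase {R : Type*} [CommRing R] [IsLocalRing R] [DecidableEq R]
    {s : Finset R} (hs : Ideal.span (s : Set R) = maximalIdeal R) {x : R}
    (hx : x ∈ maximalIdeal R) (hx2 : x ∉ maximalIdeal R ^ 2) :
    ∃ y ∈ s, Ideal.span (insert x (s.erase y : Finset R) : Set R) = maximalIdeal R := by
  have hxs : x ∈ Ideal.span (s : Set R) := hs ▸ hx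
  obtain ⟨c, hc⟩ := Submodule.mem_span_finset'.mp hxs
  have hsm : ∀ y ∈ s, y ∈ maximalIdeal R := fun y hy => hs ▸ Ideal.subset_span hy
  by_cases h : ∃ y : s, IsUnit (c y)
  · obtain ⟨⟨y, hy⟩, hu⟩ := h
    refine ⟨y, hy, le_antisymm ?_ ?_⟩
    · rw [Ideal.span_le]
      rintro z (rfl | hz)
      · exact hx
      · exact hsm z (Finset.mem_of_mem_erase hz)
    · set J := Ideal.span (insert x (s.erase y : Finset R) : Set R) with hJ
      have hyJ : y ∈ J := by
        have hxJ : x ∈ J := Ideal.subset_span (Set.mem_insert _ _)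
        have h1 : c ⟨y, hy⟩ * y ∈ J := by
          have h2 : c ⟨y, hy⟩ * y = x - ∑ a ∈ Finset.univ.erase (⟨y, hy⟩ : s), c a • (a : R) := by
            rw [← hc, ← Finset.add_sum_erase _ _ (Finset.mem_univ (⟨y, hy⟩ : s))]
            simp
          rw [h2]
          refine J.sub_mem hxJ (J.sum_mem fun a ha => J.mul_mem_left _ (Ideal.subset_span ?_))
          refine Set.mem_insert_of_mem _ (Finset.mem_coe.mpr (Finset.mem_erase.mpr ⟨fun h => ?_, a.2⟩))
          exact (Finset.mem_erase.mp ha).1 (Subtype.ext h)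
        exact (Ideal.unit_mul_mem_iff_mem J hu).mp h1
      rw [← hs, Ideal.span_le]
      intro z hz
      by_cases hzy : z = y
      · exact hzy ▸ hyJ
      · exact Ideal.subset_span (Set.mem_insert_of_mem _
          (Finset.mem_coe.mpr (Finset.mem_erase.mpr ⟨hzy, hz⟩)))
  · push Not at h
    refine absurd ?_ hx2
    rw [← hc, pow_two]
    exact Ideal.sum_mem _ fun a _ => Ideal.mul_mem_mul ((mem_maximalIdeal _).mpr (h a)) (hsm a a.2)

open IsLocalRing in
theorem IsLocalRing.exists_mem_maximalIdeal_notMem {R : Type*} [CommRing R] [IsLocalRing R]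
    [IsNoetherianRing R] (hdim : 1 ≤ ringKrullDim R) :
    ∃ x ∈ maximalIdeal R, x ∉ maximalIdeal R ^ 2 ∧ ∀ P ∈ minimalPrimes R, x ∉ P := by
  classical
  by_contra! hcon
  have hfin := minimalPrimes.finite_of_isNoetherianRing R
  have hnf : ¬ Ring.KrullDimLE 0 R := by
    intro h
    have := Order.krullDimLE_iff 0 (PrimeSpectrum R) |>.mp h
    have h2 : (1 : WithBot ℕ∞) ≤ 0 := hdim.trans this
    exact absurd h2 (by decide)
  have key : ((maximalIdeal R : Ideal R) : Set R) ⊆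
      ⋃ i ∈ ((insert (maximalIdeal R ^ 2) hfin.toFinset : Finset (Ideal R)) : Set (Ideal R)),
        ((id i : Ideal R) : Set R) := by
    intro x hx
    simp only [Set.mem_iUnion, exists_prop]
    by_cases h2 : x ∈ maximalIdeal R ^ 2
    · exact ⟨_, by simp, h2⟩
    · obtain ⟨P, hP, hxP⟩ := hcon x hx h2
      exact ⟨P, by simp [hP], hxP⟩
  rw [Ideal.subset_union_prime (maximalIdeal R ^ 2) (maximalIdeal R ^ 2)] at key
  · obtain ⟨P, hP, hle⟩ := key
    rw [Finset.mem_insert, Set.Finite.mem_toFinset] at hP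
    rcases hP with rfl | hP
    · have hbot : maximalIdeal R = ⊥ := by
        refine Submodule.eq_bot_of_le_smul_of_le_jacobson_bot (maximalIdeal R) (maximalIdeal R)
          (IsNoetherian.noetherian _) ?_ (IsLocalRing.maximalIdeal_le_jacobson _)
        rw [smul_eq_mul, ← pow_two]
        exact hle
      have := (isField_iff_maximalIdeal_eq.mpr hbot)
      let _ := this.toField
      exact hnf inferInstance
    · apply hnf
      have hPp : P.IsPrime := Ideal.IsMinimalPrime.isPrime hP
      have hPm : P = maximalIdeal R := le_antisymm (le_maximalIdeal hPp.ne_top) hle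
      refine Ring.krullDimLE_zero_iff.mpr fun I hI => ?_
      have hIm : P ≤ I := hP.2 ⟨hI, bot_le⟩ (hPm ▸ le_maximalIdeal hI.ne_top)
      have : I = maximalIdeal R := le_antisymm (le_maximalIdeal hI.ne_top) (hPm ▸ hIm)
      rw [this]; infer_instance
  · intro i hi h1 _
    rw [Finset.mem_insert, Set.Finite.mem_toFinset] at hi
    exact Ideal.IsMinimalPrime.isPrime (hi.resolve_left h1)

open IsLocalRing RingTheory.Sequence in
/-- A Noetherian local ring whose maximal ideal is generated by `D ≤ dim R` elements is a domain,
and has a regular sequence of length `D`. -/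
theorem IsLocalRing.isDomain_and_exists_isRegular (D : ℕ) : ∀ (R : Type u) [CommRing R] [IsLocalRing R]
    [IsNoetherianRing R] (_ : (D : WithBot ℕ∞) ≤ ringKrullDim R) (s : Finset R) (_ : s.card ≤ D)
    (_ : Ideal.span (s : Set R) = maximalIdeal R),
    IsDomain R ∧ ∃ rs : List R, rs.length = D ∧ (∀ r ∈ rs, r ∈ maximalIdeal R) ∧
      IsWeaklyRegular R rs := by
  classical
  induction D with
  | zero =>
    intro R _ _ _ _ s hs hsm
    have hs0 : s = ∅ := by simpa using hs
    subst hs0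
    have hbot : maximalIdeal R = ⊥ := by rw [← hsm]; simp
    exact ⟨(isField_iff_maximalIdeal_eq.mpr hbot).isDomain, [], rfl, by simp, by simp⟩
  | succ D ih =>
    intro R _ _ _ hdim s hs hsm
    obtain ⟨x, hx, hx2, hxP⟩ := exists_mem_maximalIdeal_notMem (R := R)
      (le_trans (by exact_mod_cast (Nat.le_add_left 1 D)) hdim)
    obtain ⟨y, hy, hspan⟩ := exists_span_insert_erase hsm hx hx2
    have hne : Ideal.span {x} ≠ (⊤ : Ideal R) := fun h =>
      (maximalIdeal.isMaximal R).ne_top (top_le_iff.mp (h ▸ (Ideal.span_singleton_le_iff_mem _).mpr hx))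
    have : Nontrivial (R ⧸ Ideal.span {x}) := Ideal.Quotient.nontrivial_iff.mpr hne
    have : IsLocalRing (R ⧸ Ideal.span {x}) :=
      IsLocalRing.of_surjective' (Ideal.Quotient.mk _) Ideal.Quotient.mk_surjective
    have hmmap : (maximalIdeal R).map (Ideal.Quotient.mk (Ideal.span {x})) =
        maximalIdeal (R ⧸ Ideal.span {x}) :=
      IsLocalRing.map_maximalIdeal_of_surjective _ Ideal.Quotient.mk_surjective
    have hD : (D : WithBot ℕ∞) ≤ ringKrullDim (R ⧸ Ideal.span {x}) := by
      have h1 := ringKrullDim_le_ringKrullDim_quotient_add_encard (R := R) {x}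
        (by simpa [ringJacobson_eq_maximalIdeal R] using hx)
      rw [Set.encard_singleton] at h1
      have h2 : ((D : ℕ) : WithBot ℕ∞) + 1 ≤ ringKrullDim (R ⧸ Ideal.span {x}) + 1 := by
        exact le_trans (by exact_mod_cast hdim) h1
      exact (ENat.WithBot.add_le_add_one_right_iff).mp h2
    have hcard : ((s.erase y).image (Ideal.Quotient.mk (Ideal.span {x}))).card ≤ D := by
      refine Finset.card_image_le.trans ?_
      rw [Finset.card_erase_of_mem hy]; omega
    have hgen : Ideal.span (((s.erase y).image (Ideal.Quotient.mk (Ideal.span {x})) : Finset _) :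
        Set (R ⧸ Ideal.span {x})) = maximalIdeal _ := by
      rw [← hmmap, ← hspan, Ideal.map_span, Set.image_insert_eq, Finset.coe_image,
        Ideal.Quotient.eq_zero_iff_mem.mpr (Ideal.mem_span_singleton_self x), Ideal.span_insert_zero]
    obtain ⟨hdom, rs, hlen, hrm, hreg⟩ := ih _ hD _ hcard hgen
    have hprime : (Ideal.span {x}).IsPrime := (Ideal.Quotient.isDomain_iff_prime _).mp hdom
    obtain ⟨P, hP, hPx⟩ := Ideal.exists_minimalPrimes_le (I := ⊥) (J := Ideal.span {x}) bot_le
    have hPprime : P.IsPrime := Ideal.IsMinimalPrime.isPrime hP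
    have hP0 : P = ⊥ := by
      refine Submodule.eq_bot_of_le_smul_of_le_jacobson_bot (maximalIdeal R) P
        (IsNoetherian.noetherian _) ?_ (IsLocalRing.maximalIdeal_le_jacobson _)
      intro p hp
      obtain ⟨q, rfl⟩ := Ideal.mem_span_singleton.mp (hPx hp)
      exact Ideal.mul_mem_mul hx ((hPprime.mem_or_mem hp).resolve_left (hxP P hP))
    have hbp : (⊥ : Ideal R).IsPrime := hP0 ▸ hPprime
    have hR : IsDomain R := IsDomain.of_bot_isPrime R
    refine ⟨hR, ?_⟩
    obtain ⟨rs', rfl⟩ := List.map_surjective_iff.mpr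
      (Ideal.Quotient.mk_surjective (I := Ideal.span {x})) rs
    refine ⟨x :: rs', by simpa using hlen, ?_, ?_⟩
    · simp only [List.mem_cons, forall_eq_or_imp]
      refine ⟨hx, fun r hr => ?_⟩
      have := hrm _ (List.mem_map_of_mem hr)
      rw [mem_maximalIdeal, mem_nonunits_iff] at this ⊢
      exact fun hu => this (hu.map _)
    · rw [isWeaklyRegular_cons_iff]
      refine ⟨?_, ?_⟩
      · have hx0 : x ≠ 0 := by
          rintro rfl
          exact hxP P hP P.zero_mem
        exact fun a b hab => mul_left_cancel₀ hx0 hab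
      · have e : (R ⧸ Ideal.span {x}) ≃ₗ[R] QuotSMulTop x R :=
          Submodule.quotEquivOfEq _ _ (by
            rw [← Submodule.ideal_span_singleton_smul, smul_eq_mul, Ideal.mul_top])
        rw [← e.isWeaklyRegular_congr]
        exact (isWeaklyRegular_map_algebraMap_iff (R ⧸ Ideal.span {x}) (R ⧸ Ideal.span {x}) rs').mp hreg

theorem ringKrullDim_le_of_surjective_of_height {R S : Type*} [CommRing R] [CommRing S] (φ : R →+* S)
    (hφ : Function.Surjective φ) {N D : ℕ} (hdim : ringKrullDim R ≤ D)
    (hN : ∀ p : PrimeSpectrum R, RingHom.ker φ ≤ p.asIdeal → (N : ℕ∞) ≤ Order.height p) :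
    ringKrullDim S ≤ ((D - N : ℕ) : WithBot ℕ∞) := by
  refine iSup_le fun l => ?_
  have hmono : StrictMono (PrimeSpectrum.comap φ) := by
    refine Monotone.strictMono_of_injective ?_ (PrimeSpectrum.comap_injective_of_surjective φ hφ)
    intro p q hpq
    exact Ideal.comap_mono hpq
  let l' := l.map _ hmono
  have h1 : (N : ℕ∞) ≤ Order.height l'.head := by
    refine hN _ fun x hx => ?_
    change φ x ∈ l.head.asIdeal
    rw [(RingHom.mem_ker).mp hx]
    exact Ideal.zero_mem _
  have h2 : (l.length : ℕ∞) ≤ Order.coheight l'.head := Order.length_le_coheight_head (p := l')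
  have : Nonempty (PrimeSpectrum R) := ⟨l'.head⟩
  have h3 : (((N + l.length : ℕ) : ℕ∞) : WithBot ℕ∞) ≤ D := by
    refine le_trans ?_ hdim
    rw [ringKrullDim, Order.krullDim_eq_iSup_height_add_coheight_of_nonempty]
    refine WithBot.coe_le_coe.mpr (le_trans ?_ (le_iSup (fun a => Order.height a + Order.coheight a)
      l'.head))
    push_cast
    exact add_le_add h1 h2
  have h4 : N + l.length ≤ D := by exact_mod_cast h3
  have h5 : l.length ≤ D - N := by omega
  exact_mod_cast h5

section Associated

open IsLocalRing RingTheory.Sequence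

variable {R : Type u} [CommRing R] [IsLocalRing R] [IsNoetherianRing R]

open Pointwise in
theorem IsAssociatedPrime.exists_quotSMulTop {M : Type*} [AddCommGroup M] [Module R M] [Module.Finite R M]
    {P : Ideal R} (hP : IsAssociatedPrime P M) {x : R} (hx : x ∈ maximalIdeal R)
    (hreg : IsSMulRegular M x) :
    x ∉ P ∧ ∃ Q : Ideal R, IsAssociatedPrime Q (QuotSMulTop x M) ∧ P ≤ Q ∧ x ∈ Q := by
  obtain ⟨hprime, z, hz⟩ := isAssociatedPrime_iff.mp hP
  have hz' : ∀ p, p ∈ P ↔ p • z = 0 := fun p => by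
    rw [hz, Submodule.mem_colon_singleton, Submodule.mem_bot]
  have hz0 : z ≠ 0 := by
    rintro rfl
    exact hprime.ne_top ((Ideal.eq_top_iff_one _).mpr ((hz' 1).mpr (smul_zero _)))
  refine ⟨fun hxP => hz0 (hreg.right_eq_zero_of_smul ((hz' x).mp hxP)), ?_⟩
  let N : Submodule R M :=
    { carrier := {y | ∀ p ∈ P, p • y = 0}
      add_mem' := fun ha hb p hp => by rw [smul_add, ha p hp, hb p hp, add_zero]
      zero_mem' := fun p _ => smul_zero p
      smul_mem' := fun c y hy p hp => by rw [smul_comm, hy p hp, smul_zero] }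
  have hNnot : ∃ y ∈ N, y ∉ x • (⊤ : Submodule R M) := by
    by_contra! hcon
    have : N = ⊥ := by
      refine Submodule.eq_bot_of_le_smul_of_le_jacobson_bot (maximalIdeal R) N
        (IsNoetherian.noetherian _) ?_ (IsLocalRing.maximalIdeal_le_jacobson _)
      intro y hy
      obtain ⟨w, -, rfl⟩ := (Submodule.mem_smul_pointwise_iff_exists _ _ _).mp (hcon y hy)
      refine Submodule.smul_mem_smul hx fun p hp => hreg.right_eq_zero_of_smul ?_
      rw [smul_comm]
      exact hy p hp
    exact hz0 ((Submodule.mem_bot R).mp (this ▸ (fun p hp => (hz' p).mp hp : z ∈ N)))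
  obtain ⟨y, hyN, hy⟩ := hNnot
  obtain ⟨Q, hQ, hle⟩ := exists_le_isAssociatedPrime_of_isNoetherianRing R
    (Submodule.Quotient.mk y : QuotSMulTop x M) (fun h => hy ((Submodule.Quotient.mk_eq_zero _).mp h))
  refine ⟨Q, hQ, fun p hp => hle ?_, hle ?_⟩
  · rw [Submodule.mem_colon_singleton, Submodule.mem_bot, ← Submodule.Quotient.mk_smul, hyN p hp,
      Submodule.Quotient.mk_zero]
  · rw [Submodule.mem_colon_singleton, Submodule.mem_bot, ← Submodule.Quotient.mk_smul,
      Submodule.Quotient.mk_eq_zero]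
    exact Submodule.smul_mem_pointwise_smul _ _ _ trivial

theorem RingTheory.Sequence.IsWeaklyRegular.length_le_coheight {rs : List R} : ∀ {M : Type u}
    [AddCommGroup M] [Module R M] [Module.Finite R M] (_ : IsWeaklyRegular M rs)
    (_ : ∀ r ∈ rs, r ∈ maximalIdeal R) {P : PrimeSpectrum R} (_ : IsAssociatedPrime P.asIdeal M),
    (rs.length : ℕ∞) ≤ Order.coheight P := by
  induction rs with
  | nil => intros; simp
  | cons x rs ih =>
    intro M _ _ _ hreg hm P hP
    rw [isWeaklyRegular_cons_iff] at hreg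
    simp only [List.mem_cons, forall_eq_or_imp] at hm
    obtain ⟨hxP, Q, hQ, hPQ, hxQ⟩ := hP.exists_quotSMulTop hm.1 hreg.1
    have h1 := ih hreg.2 hm.2 (P := ⟨Q, hQ.1⟩) hQ
    have hlt : P < ⟨Q, hQ.1⟩ := lt_of_le_of_ne hPQ (by rintro rfl; exact hxP hxQ)
    have h2 := Order.coheight_add_one_le hlt
    refine le_trans ?_ h2
    push_cast [List.length_cons]
    gcongr

open CategoryTheory Abelian

/-- `M` has depth at least `n`, expressed through vanishing of `Ext`. -/
def DepthGE (n : ℕ) (M : ModuleCat.{u} R) : Prop :=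
  ∀ i < n, Subsingleton (Ext (ModuleCat.of R (R ⧸ maximalIdeal R)) M i)

theorem maximalIdeal_smul_top_lt {M : Type*} [AddCommGroup M] [Module R M] [Module.Finite R M]
    [Nontrivial M] : maximalIdeal R • (⊤ : Submodule R M) < ⊤ := by
  refine lt_of_le_of_ne le_top fun h => ?_
  have := Submodule.eq_bot_of_le_smul_of_le_jacobson_bot (maximalIdeal R) (⊤ : Submodule R M)
        (IsNoetherian.noetherian _) h.ge (IsLocalRing.maximalIdeal_le_jacobson _)
  exact bot_ne_top this.symm

theorem support_residue : Module.support R (ModuleCat.of R (R ⧸ maximalIdeal R)) =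
    PrimeSpectrum.zeroLocus (maximalIdeal R) := by
  rw [Module.support_eq_zeroLocus, Ideal.annihilator_quotient]

theorem DepthGE.of_isWeaklyRegular {M : ModuleCat.{u} R} [Module.Finite R M] [Nontrivial M] {rs : List R}
    (hreg : IsWeaklyRegular M rs) (hm : ∀ r ∈ rs, r ∈ maximalIdeal R) : DepthGE rs.length M :=
  ModuleCat.subsingleton_ext_of_exists_isRegular (maximalIdeal R) _ support_residue.subset M
    maximalIdeal_smul_top_lt rs hm
    ((IsLocalRing.isRegular_iff_isWeaklyRegular_of_subset_maximalIdeal hm).mpr hreg)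

theorem DepthGE.quotSMulTop {M : ModuleCat.{u} R} {n : ℕ} (h : DepthGE (n + 1) M) {x : R}
    (hx : IsSMulRegular M x) : DepthGE n (ModuleCat.of R (QuotSMulTop x M)) := by
  intro i hi
  have zero1 := AddCommGrpCat.isZero_of_iff_subsingleton.mpr (h i (by omega))
  have zero2 := AddCommGrpCat.isZero_of_iff_subsingleton.mpr (h (i + 1) (by omega))
  exact AddCommGrpCat.subsingleton_of_isZero <| ShortComplex.Exact.isZero_of_both_zeros
    ((Ext.covariant_sequence_exact₃' _ hx.smulShortComplex_shortExact) i (i + 1) rfl)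
    (zero1.eq_zero_of_src _) (zero2.eq_zero_of_tgt _)

theorem DepthGE.le_coheight {M : ModuleCat.{u} R} [Module.Finite R M] [Nontrivial M] {n : ℕ}
    (h : DepthGE n M) {P : PrimeSpectrum R} (hP : IsAssociatedPrime P.asIdeal M) :
    (n : ℕ∞) ≤ Order.coheight P := by
  obtain ⟨rs, rfl, hm, hreg⟩ := ModuleCat.exists_isRegular_of_exists_subsingleton_ext
    (maximalIdeal R) n M maximalIdeal_smul_top_lt _ support_residue h
  exact hreg.toIsWeaklyRegular.length_le_coheight hm hP

end Associated

open IsLocalRing in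
theorem le_of_forall_height {R : Type u} [CommRing R] [IsLocalRing R] [IsNoetherianRing R] {D N : ℕ}
    (hdim : ringKrullDim R ≤ D) {a : Fin N → R}
    (ha : ∀ i, a i ∈ maximalIdeal R)
    (hN : ∀ p : PrimeSpectrum R, (∀ i, a i ∈ p.asIdeal) → (N : ℕ∞) ≤ Order.height p) : N ≤ D := by
  have h1 := hN (closedPoint R) ha
  have h2 := (Order.height_le_krullDim (closedPoint R)).trans hdim
  have h3 : ((N : ℕ∞) : WithBot ℕ∞) ≤ D := (WithBot.coe_le_coe.mpr h1).trans h2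
  exact_mod_cast h3

open IsLocalRing in
theorem coheight_le_of_forall_height {R : Type u} [CommRing R] [IsLocalRing R] [IsNoetherianRing R]
    {D N : ℕ} (hdim : ringKrullDim R ≤ D) {a : Fin N → R}
    (ha : ∀ i, a i ∈ maximalIdeal R)
    (hN : ∀ p : PrimeSpectrum R, (∀ i, a i ∈ p.asIdeal) → (N : ℕ∞) ≤ Order.height p)
    (P : PrimeSpectrum R) (i : Fin N) (hP : ∀ j, i ≤ j → a j ∈ P.asIdeal) :
    Order.coheight P ≤ ((D - N + i : ℕ) : ℕ∞) := by
  have hlocal : IsLocalRing (R ⧸ P.asIdeal) :=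
    IsLocalRing.of_surjective' (Ideal.Quotient.mk _) Ideal.Quotient.mk_surjective
  have hco : ringKrullDim (R ⧸ P.asIdeal) = Order.coheight P := by
    rw [ringKrullDim_quotient, Order.coheight_eq_krullDim_Ici]
    congr
  let b : Fin i → R ⧸ P.asIdeal := fun j => Ideal.Quotient.mk _ (a ⟨j, j.2.trans i.2⟩)
  have hbm : Set.range b ⊆ Ring.jacobson (R ⧸ P.asIdeal) := by
    rintro _ ⟨j, rfl⟩
    rw [SetLike.mem_coe, ringJacobson_eq_maximalIdeal, ← IsLocalRing.map_maximalIdeal_of_surjective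
      (Ideal.Quotient.mk P.asIdeal) Ideal.Quotient.mk_surjective]
    exact Ideal.mem_map_of_mem _ (ha _)
  have h1 := ringKrullDim_le_ringKrullDim_quotient_add_encard _ hbm
  have h2 := ringKrullDim_le_of_surjective_of_height (N := N)
    ((Ideal.Quotient.mk (Ideal.span (Set.range b))).comp (Ideal.Quotient.mk P.asIdeal))
    (Ideal.Quotient.mk_surjective.comp Ideal.Quotient.mk_surjective) hdim (fun p hp => hN p fun j => by
      refine hp (RingHom.mem_ker.mpr ?_)
      rw [RingHom.comp_apply]
      rcases lt_or_ge j i with hji | hji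
      · exact Ideal.Quotient.eq_zero_iff_mem.mpr (Ideal.subset_span ⟨⟨j, hji⟩, rfl⟩)
      · rw [Ideal.Quotient.eq_zero_iff_mem.mpr (hP j hji), map_zero])
  have h3 : (Set.range b).encard ≤ i := by
    rw [← Set.image_univ]
    refine (Set.encard_image_le _ _).trans ?_
    simp [Set.encard_univ]
  rw [hco] at h1
  have h4 : (Order.coheight P : WithBot ℕ∞) ≤ (((D - N : ℕ) : ℕ∞) + (i : ℕ) : ℕ∞) := by
    refine h1.trans ?_
    rw [WithBot.coe_add]
    exact add_le_add h2 (WithBot.coe_le_coe.mpr h3)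
  have h5 := WithBot.coe_le_coe.mp h4
  push_cast
  exact h5

open IsLocalRing in
theorem DepthGE.isSMulRegular {R : Type u} [CommRing R] [IsLocalRing R] [IsNoetherianRing R]
    {D N : ℕ} (hdim : ringKrullDim R ≤ D) {a : Fin N → R}
    (ha : ∀ i, a i ∈ maximalIdeal R)
    (hN : ∀ p : PrimeSpectrum R, (∀ i, a i ∈ p.asIdeal) → (N : ℕ∞) ≤ Order.height p)
    {k : ℕ} {i : Fin N} (hik : i + k + 1 = N) {M : ModuleCat.{u} R} [Module.Finite R M]
    (e : M ≃ₗ[R] R ⧸ Ideal.span (a '' Set.Ioi i)) (hM : DepthGE (D - k) M) :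
    IsSMulRegular M (a i) := by
  have hND := le_of_forall_height hdim ha hN
  have hJm : Ideal.span (a '' Set.Ioi i) ≤ maximalIdeal R := by
    rw [Ideal.span_le]
    rintro _ ⟨j, -, rfl⟩
    exact ha j
  have : Nontrivial M := by
    have : Nontrivial (R ⧸ Ideal.span (a '' Set.Ioi i)) := Ideal.Quotient.nontrivial_iff.mpr fun h =>
      (maximalIdeal.isMaximal R).ne_top (top_le_iff.mp (h ▸ hJm))
    exact e.toEquiv.nontrivial
  rw [isSMulRegular_iff_right_eq_zero_of_smul]
  by_contra! hcon
  obtain ⟨m, hm, hm0⟩ := hcon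
  have hmem : a i ∈ { r : R | ∃ x : M, x ≠ 0 ∧ r • x = 0 } := ⟨m, hm0, hm⟩
  rw [← biUnion_associatedPrimes_eq_zero_divisors] at hmem
  simp only [Set.mem_iUnion, exists_prop] at hmem
  obtain ⟨P, hP, haP⟩ := hmem
  have hP' : IsAssociatedPrime P M := hP
  have h1 := hM.le_coheight (P := ⟨P, hP'.1⟩) hP'
  have h2 := coheight_le_of_forall_height hdim ha hN ⟨P, hP'.1⟩ i (fun j hij => by
    rcases hij.eq_or_lt with rfl | hlt
    · exact haP
    · obtain ⟨-, z, hz⟩ := isAssociatedPrime_iff.mp hP'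
      change a j ∈ P
      rw [hz, Submodule.mem_colon_singleton, Submodule.mem_bot]
      apply e.injective
      rw [map_smul, map_zero]
      obtain ⟨w, hw⟩ := Ideal.Quotient.mk_surjective (e z)
      rw [← hw, Algebra.smul_def, Ideal.Quotient.algebraMap_eq, ← map_mul,
        Ideal.Quotient.eq_zero_iff_mem]
      exact Ideal.mul_mem_right _ _ (Ideal.subset_span ⟨j, hlt, rfl⟩))
  have h3 : D - k ≤ D - N + i := by exact_mod_cast h1.trans h2
  omega

open IsLocalRing Pointwise in
theorem exists_depthGE_quotient {R : Type u} [CommRing R] [IsLocalRing R] [IsNoetherianRing R]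
    {D N : ℕ} (hdim : ringKrullDim R ≤ D) (hR : DepthGE D (ModuleCat.of R R)) {a : Fin N → R}
    (ha : ∀ i, a i ∈ maximalIdeal R)
    (hN : ∀ p : PrimeSpectrum R, (∀ i, a i ∈ p.asIdeal) → (N : ℕ∞) ≤ Order.height p) (k : ℕ) :
    ∀ i : Fin N, i + k + 1 = N → ∃ M : ModuleCat.{u} R, Module.Finite R M ∧
      Nonempty (M ≃ₗ[R] R ⧸ Ideal.span (a '' Set.Ioi i)) ∧ DepthGE (D - k) M := by
  have hND := le_of_forall_height hdim ha hN
  induction k with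
  | zero =>
    intro i hi
    refine ⟨ModuleCat.of R R, inferInstance, ⟨?_⟩, hR⟩
    have h0 : Ideal.span (a '' Set.Ioi i) = ⊥ := by
      rw [Ideal.span_eq_bot]
      rintro _ ⟨j, hj, rfl⟩
      have := Fin.lt_def.mp (Set.mem_Ioi.mp hj)
      omega
    exact (Submodule.quotEquivOfEqBot _ h0).symm
  | succ k ih =>
    intro i hi
    let i' : Fin N := ⟨i + 1, by omega⟩
    obtain ⟨M, hfin, ⟨e⟩, hM⟩ := ih i' (by simp only [i']; omega)
    have hreg := hM.isSMulRegular hdim ha hN (i := i') (by simp only [i']; omega) e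
    refine ⟨ModuleCat.of R (QuotSMulTop (a i') M), inferInstance, ⟨?_⟩, ?_⟩
    · set J := Ideal.span (a '' Set.Ioi i') with hJ
      have hset : Set.Ioi i = insert i' (Set.Ioi i') := by
        ext j
        simp only [Set.mem_Ioi, Set.mem_insert_iff, Fin.lt_def, Fin.ext_iff, i']
        omega
      have hJ' : Ideal.span (a '' Set.Ioi i) = J ⊔ Ideal.span {a i'} := by
        rw [hset, Set.image_insert_eq, Ideal.span_insert, sup_comm]
      have e1 : QuotSMulTop (a i') M ≃ₗ[R] QuotSMulTop (a i') (R ⧸ J) := QuotSMulTop.congr (a i') e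
      have h2 : (a i' • (⊤ : Submodule R (R ⧸ J))) = Submodule.map (Submodule.mkQ J) (Ideal.span {a i'}) := by
        rw [← Submodule.ideal_span_singleton_smul, ← Submodule.range_mkQ J, LinearMap.range_eq_map,
          ← Submodule.map_smul'', smul_eq_mul, Ideal.mul_top]
      have h3 : Submodule.map (Submodule.mkQ J) (Ideal.span {a i'}) =
          Submodule.map (Submodule.mkQ J) (J ⊔ Ideal.span {a i'}) := by
        rw [Submodule.map_sup, Submodule.mkQ_map_self, bot_sup_eq]
      have e2 : QuotSMulTop (a i') (R ⧸ J) ≃ₗ[R]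
          ((R ⧸ J) ⧸ Submodule.map (Submodule.mkQ J) (J ⊔ Ideal.span {a i'})) :=
        Submodule.quotEquivOfEq _ _ (h2.trans h3)
      exact e1.trans <| e2.trans ((Submodule.quotientQuotientEquivQuotient J (J ⊔ Ideal.span {a i'})
        le_sup_left).trans (Submodule.quotEquivOfEq _ _ hJ'.symm))
    · refine DepthGE.quotSMulTop (n := D - (k + 1)) ?_ hreg
      convert hM using 1
      omega

open IsLocalRing in
/-- A system of `N` elements of a Cohen–Macaulay local ring generating an ideal of height `≥ N` is
a regular sequence (taken in reverse order). -/
theorem mem_span_of_mul_mem_span {R : Type u} [CommRing R] [IsLocalRing R] [IsNoetherianRing R]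
    {D N : ℕ} (hdim : ringKrullDim R ≤ D) (hR : DepthGE D (ModuleCat.of R R)) {a : Fin N → R}
    (ha : ∀ i, a i ∈ maximalIdeal R)
    (hN : ∀ p : PrimeSpectrum R, (∀ i, a i ∈ p.asIdeal) → (N : ℕ∞) ≤ Order.height p) (i : Fin N) (x : R)
    (hx : a i * x ∈ Ideal.span (a '' Set.Ioi i)) : x ∈ Ideal.span (a '' Set.Ioi i) := by
  obtain ⟨M, hfin, ⟨e⟩, hM⟩ := exists_depthGE_quotient hdim hR ha hN (N - 1 - i) i (by omega)
  have hreg := hM.isSMulRegular hdim ha hN (i := i) (by omega) e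
  rw [e.isSMulRegular_congr] at hreg
  rw [← Ideal.Quotient.eq_zero_iff_mem] at hx ⊢
  refine hreg.right_eq_zero_of_smul ?_
  rw [Algebra.smul_def, Ideal.Quotient.algebraMap_eq, ← map_mul, hx]

/-- In a regular local ring, `N` elements generating an ideal of height `≥ N` form a regular
sequence (taken in reverse order). -/
theorem IsRegularLocalRing.mem_span_of_mul_mem_span {R : Type u} [CommRing R] [IsRegularLocalRing R]
    {N : ℕ} {a : Fin N → R} (ha : ∀ i, a i ∈ IsLocalRing.maximalIdeal R)
    (hN : ∀ p : PrimeSpectrum R, (∀ i, a i ∈ p.asIdeal) → (N : ℕ∞) ≤ Order.height p) (i : Fin N) (x : R)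
    (hx : a i * x ∈ Ideal.span (a '' Set.Ioi i)) : x ∈ Ideal.span (a '' Set.Ioi i) := by
  have hdim := IsRegularLocalRing.spanFinrank_maximalIdeal (R := R)
  obtain ⟨s, hs, hspan⟩ := (IsNoetherian.noetherian
    (IsLocalRing.maximalIdeal R)).exists_span_finset_card_eq_spanFinrank
  obtain ⟨-, rs, hlen, hm, hreg⟩ := IsLocalRing.isDomain_and_exists_isRegular _ R hdim.le s hs.le hspan
  have hdepth : DepthGE rs.length (ModuleCat.of R R) := DepthGE.of_isWeaklyRegular hreg hm
  rw [hlen] at hdepth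
  exact _root_.mem_span_of_mul_mem_span hdim.ge hdepth ha hN i x hx

section

open MvPolynomial

/-- Splitting off the first variable of a form. -/
theorem MvPolynomial.IsHomogeneous.exists_eq_rename_succ_add {R : Type*} [CommRing R] {N k : ℕ}
    {F : MvPolynomial (Fin (N + 1)) R} (hF : F.IsHomogeneous (k + 1)) :
    ∃ (G : MvPolynomial (Fin N) R) (H : MvPolynomial (Fin (N + 1)) R), G.IsHomogeneous (k + 1) ∧
      H.IsHomogeneous k ∧ F = rename Fin.succ G + X 0 * H := by
  have hG : ((finSuccEquiv R N F).coeff 0).IsHomogeneous (k + 1) :=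
    hF.finSuccEquiv_coeff_isHomogeneous 0 (k + 1) (by omega)
  have hren : ∀ G : MvPolynomial (Fin N) R, finSuccEquiv R N (rename Fin.succ G) = Polynomial.C G := by
    intro G
    induction G using MvPolynomial.induction_on with
    | C r => rw [rename_C, ← algebraMap_eq, AlgEquiv.commutes]; rfl
    | add p q hp hq => rw [map_add, map_add, map_add, hp, hq]
    | mul_X p i hp => rw [map_mul, map_mul, map_mul, hp, rename_X, finSuccEquiv_X_succ]
  have heq : F = rename Fin.succ ((finSuccEquiv R N F).coeff 0) +
      X 0 * (finSuccEquiv R N).symm (finSuccEquiv R N F).divX := by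
    apply (finSuccEquiv R N).injective
    rw [map_add, map_mul, AlgEquiv.apply_symm_apply, finSuccEquiv_X_zero, hren]
    conv_lhs => rw [← Polynomial.divX_mul_X_add (finSuccEquiv R N F)]
    ring
  refine ⟨_, _, hG, fun d hd => ?_, heq⟩
  have hX : (X 0 * (finSuccEquiv R N).symm (finSuccEquiv R N F).divX).IsHomogeneous (k + 1) := by
    rw [← sub_eq_iff_eq_add'.mpr heq]
    exact hF.sub hG.rename_isHomogeneous
  have h1 := hX (d := Finsupp.single 0 1 + d) (by rwa [coeff_X_mul])
  rw [map_add] at h1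
  simp only [Finsupp.weight_single, Pi.one_apply, smul_eq_mul, mul_one] at h1
  omega

/-- Elements of `J * (a)^k` are values of forms of degree `k` with coefficients in `J`. -/
theorem Ideal.exists_isHomogeneous_of_mem_mul_pow {R ι : Type*} [CommRing R] {a : ι → R} {J : Ideal R}
    {k : ℕ} {x : R} (hx : x ∈ J * Ideal.span (Set.range a) ^ k) :
    ∃ h : MvPolynomial ι R, h.IsHomogeneous k ∧ h ∈ J.map C ∧ eval a h = x := by
  induction hx using Submodule.mul_induction_on' with
  | mem_mul_mem j hj y hy =>
    obtain ⟨p, hp, rfl⟩ := (Ideal.mem_span_pow_iff_exists_isHomogeneous a y).mp hy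
    exact ⟨C j * p, hp.C_mul j, Ideal.mul_mem_right _ _ (Ideal.mem_map_of_mem _ hj), by simp⟩
  | add x _ y _ hx hy =>
    obtain ⟨p, hp, hpJ, rfl⟩ := hx
    obtain ⟨q, hq, hqJ, rfl⟩ := hy
    exact ⟨p + q, hp.add hq, Ideal.add_mem _ hpJ hqJ, by simp⟩

theorem Ideal.eval_mem_mul_pow {R ι : Type*} [CommRing R] {a : ι → R} {J : Ideal R}
    {k : ℕ} {h : MvPolynomial ι R} (hh : h.IsHomogeneous k) (hJ : h ∈ J.map C) :
    eval a h ∈ J * Ideal.span (Set.range a) ^ k := by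
  rw [eval_eq]
  refine Ideal.sum_mem _ fun d hd => Ideal.mul_mem_mul (MvPolynomial.mem_map_C_iff.mp hJ d) ?_
  have := hh (mem_support_iff.mp hd)
  rw [Ideal.mem_span_pow_iff_exists_isHomogeneous]
  exact ⟨monomial d 1, isHomogeneous_monomial _ (by rw [← this, Finsupp.degree_eq_weight_one]; rfl), by
    rw [eval_monomial, one_mul]; rfl⟩

/-- `a` is quasi-regular: forms vanishing at `a` have coefficients in the ideal of `a`. -/
def QuasiRegular {R ι : Type*} [CommRing R] (a : ι → R) : Prop :=
  ∀ (k : ℕ) (F : MvPolynomial ι R), F.IsHomogeneous k → eval a F = 0 →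
    F ∈ (Ideal.span (Set.range a)).map C

theorem QuasiRegular.mem_pow_of_mul_mem_pow {R ι : Type*} [CommRing R] {a : ι → R}
    (ha : QuasiRegular a) {b : R}
    (hb : ∀ x, b * x ∈ Ideal.span (Set.range a) → x ∈ Ideal.span (Set.range a)) (k : ℕ) :
    ∀ x, b * x ∈ Ideal.span (Set.range a) ^ k → x ∈ Ideal.span (Set.range a) ^ k := by
  induction k with
  | zero => simp
  | succ k ih =>
    intro x hx
    obtain ⟨g, hg, rfl⟩ := (Ideal.mem_span_pow_iff_exists_isHomogeneous a x).mp
      (ih x (Ideal.pow_le_pow_right (Nat.le_succ k) hx))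
    rw [pow_succ'] at hx ⊢
    obtain ⟨h, hh, hhI, hhx⟩ := Ideal.exists_isHomogeneous_of_mem_mul_pow hx
    have h1 := ha k (C b * g - h) ((hg.C_mul b).sub hh) (by simp [hhx])
    have h2 : C b * g ∈ (Ideal.span (Set.range a)).map C := by
      simpa using Ideal.add_mem _ h1 hhI
    refine Ideal.eval_mem_mul_pow hg (mem_map_C_iff.mpr fun d => hb _ ?_)
    simpa using mem_map_C_iff.mp h2 d

/-- Regular sequences (in reverse order) are quasi-regular. -/
theorem quasiRegular_of_forall {R : Type*} [CommRing R] {N : ℕ} : ∀ {a : Fin N → R}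
    (_ : ∀ i x, a i * x ∈ Ideal.span (a '' Set.Ioi i) → x ∈ Ideal.span (a '' Set.Ioi i)),
    QuasiRegular a := by
  induction N with
  | zero =>
    intro a _ k F _ hF0
    rw [eq_C_of_isEmpty F] at hF0 ⊢
    rw [eval_C] at hF0
    simp [hF0]
  | succ N ih =>
    intro a ha
    have ha' : QuasiRegular (fun i : Fin N => a i.succ) := by
      refine ih fun i x hx => ?_
      have hset : (fun i : Fin N => a i.succ) '' Set.Ioi i = a '' Set.Ioi i.succ := by
        rw [← Fin.image_succ_Ioi, Set.image_image]
      rw [hset] at hx ⊢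
      exact ha _ x hx
    set I' := Ideal.span (Set.range fun i : Fin N => a i.succ) with hI'
    set I := Ideal.span (Set.range a) with hI
    have hI'I : I' ≤ I := Ideal.span_mono (by rintro _ ⟨i, rfl⟩; exact ⟨_, rfl⟩)
    have h0I : a 0 ∈ I := Ideal.subset_span ⟨0, rfl⟩
    have h0 : ∀ x, a 0 * x ∈ I' → x ∈ I' := by
      have hset : a '' Set.Ioi 0 = Set.range fun i : Fin N => a i.succ := by
        ext y
        constructor
        · rintro ⟨j, hj, rfl⟩
          obtain ⟨i, rfl⟩ := Fin.exists_succ_eq.mpr (Fin.pos_iff_ne_zero.mp hj)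
          exact ⟨i, rfl⟩
        · rintro ⟨i, rfl⟩
          exact ⟨i.succ, Fin.succ_pos i, rfl⟩
      have := ha 0
      rwa [hset] at this
    intro k
    induction k with
    | zero =>
      intro F hF hF0
      rw [totalDegree_eq_zero_iff_eq_C.mp (Nat.le_zero.mp hF.totalDegree_le)] at hF0 ⊢
      rw [eval_C] at hF0
      simp [hF0]
    | succ k ihk =>
      intro F hF hF0
      obtain ⟨G, H, hG, hH, rfl⟩ := hF.exists_eq_rename_succ_add
      have hev : eval (fun i : Fin N => a i.succ) G + a 0 * eval a H = 0 := by
        simpa [eval_rename, Function.comp_def] using hF0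
      have hHk : eval a H ∈ I' ^ (k + 1) := by
        refine ha'.mem_pow_of_mul_mem_pow h0 (k + 1) _ ?_
        rw [eq_neg_of_add_eq_zero_right hev]
        exact neg_mem ((Ideal.mem_span_pow_iff_exists_isHomogeneous _ _).mpr ⟨G, hG, rfl⟩)
      obtain ⟨h, hh, hhe⟩ := (Ideal.mem_span_pow_iff_exists_isHomogeneous _ _).mp hHk
      have hG1 := ha' (k + 1) (G + C (a 0) * h) (hG.add (hh.C_mul _)) (by simp [hhe, hev])
      have hGI : G ∈ I.map C := by
        have h1 := Ideal.sub_mem _ (Ideal.map_mono hI'I hG1)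
          (Ideal.mul_mem_right h _ (Ideal.mem_map_of_mem C h0I))
        simpa using h1
      have hHk' : eval a H ∈ I * I ^ k := by
        rw [← pow_succ']
        exact Ideal.pow_right_mono hI'I _ hHk
      obtain ⟨h2, hh2, hhI, hhe2⟩ := Ideal.exists_isHomogeneous_of_mem_mul_pow hHk'
      have hHI : H ∈ I.map C := by
        have h1 := Ideal.add_mem _ (ihk (H - h2) (hH.sub hh2) (by simp [hhe2])) hhI
        simpa using h1
      refine Ideal.add_mem _ ?_ (Ideal.mul_mem_left _ _ hHI)
      have h3 := Ideal.mem_map_of_mem (rename Fin.succ : MvPolynomial (Fin N) R →ₐ[R] _).toRingHom hGI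
      rw [Ideal.map_map] at h3
      have h4 : ((rename Fin.succ : MvPolynomial (Fin N) R →ₐ[R]
          MvPolynomial (Fin (N + 1)) R).toRingHom.comp C) = C := by
        ext x; simp
      rw [h4] at h3
      exact h3

theorem QuasiRegular.of_equiv {R ι κ : Type*} [CommRing R] (e : ι ≃ κ) {a : κ → R}
    (ha : QuasiRegular (a ∘ e)) : QuasiRegular a := by
  intro k F hF hF0
  have h1 := ha k (rename e.symm F) (hF.rename_isHomogeneous) (by
    rw [eval_rename, Function.comp_assoc, Equiv.self_comp_symm, Function.comp_id, hF0])
  rw [e.surjective.range_comp a] at h1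
  have h3 := Ideal.mem_map_of_mem (rename e : MvPolynomial ι R →ₐ[R] _).toRingHom h1
  rw [Ideal.map_map] at h3
  have h4 : ((rename e : MvPolynomial ι R →ₐ[R] MvPolynomial κ R).toRingHom.comp C) = C := by
    ext x; simp
  rw [h4] at h3
  simpa [rename_rename] using h3

end

/-- Rescaling the variables according to a weight extracts the weighted homogeneous components. -/
theorem MvPolynomial.coeff_aeval_C_mul_X_pow {R S σ : Type*} [CommRing R] [CommRing S] [Algebra R S]
    (w : σ → ℕ) (x : σ → S) (k : ℕ) (p : MvPolynomial σ R) :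
    (MvPolynomial.aeval (fun i => Polynomial.C (x i) * Polynomial.X ^ w i) p).coeff k =
      MvPolynomial.aeval x (MvPolynomial.weightedHomogeneousComponent w k p) := by
  induction p using MvPolynomial.induction_on' with
  | add p q hp hq => rw [map_add, map_add, map_add, Polynomial.coeff_add, hp, hq]
  | monomial m r =>
    have h1 : MvPolynomial.aeval (fun i => Polynomial.C (x i) * Polynomial.X ^ w i)
        (MvPolynomial.monomial m r) = Polynomial.C (MvPolynomial.aeval x (MvPolynomial.monomial m r)) *
          Polynomial.X ^ (Finsupp.weight w m) := by
      rw [MvPolynomial.aeval_monomial, MvPolynomial.aeval_monomial, map_mul, mul_assoc]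
      congr 1
      simp only [Finsupp.prod, mul_pow, Finset.prod_mul_distrib, map_prod, map_pow]
      congr 1
      simp only [← pow_mul, Finset.prod_pow_eq_pow_sum, Finsupp.weight_apply, Finsupp.sum,
        smul_eq_mul, mul_comm]
    have h2 := MvPolynomial.isWeightedHomogeneous_monomial w m r rfl
    rw [h1, Polynomial.coeff_C_mul_X_pow]
    split_ifs with h
    · subst h
      rw [h2.weightedHomogeneousComponent_same]
    · rw [h2.weightedHomogeneousComponent_ne k h, map_zero]

theorem MvPolynomial.IsWeightedHomogeneous.isHomogeneous_aeval {R σ τ : Type*} [CommRing R]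
    {w : σ → ℕ} {x : σ → MvPolynomial τ R} (hx : ∀ i, (x i).IsHomogeneous (w i)) {k : ℕ}
    {p : MvPolynomial σ R} (hp : MvPolynomial.IsWeightedHomogeneous w p k) :
    (MvPolynomial.aeval x p).IsHomogeneous k := by
  rw [MvPolynomial.aeval_eq_eval₂Hom, MvPolynomial.coe_eval₂Hom, MvPolynomial.eval₂_eq]
  refine MvPolynomial.IsHomogeneous.sum _ _ _ fun d hd => ?_
  rw [← hp (MvPolynomial.mem_support_iff.mp hd), ← zero_add (Finsupp.weight w d)]
  refine MvPolynomial.IsHomogeneous.mul (MvPolynomial.isHomogeneous_C _ _) ?_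
  rw [Finsupp.weight_apply, Finsupp.sum]
  refine MvPolynomial.IsHomogeneous.prod _ _ _ fun i _ => ?_
  rw [smul_eq_mul, mul_comm]
  exact (hx i).pow _

theorem MvPolynomial.IsWeightedHomogeneous.weightedHomogeneousComponent {R σ : Type*} [CommRing R]
    {w v : σ → ℕ} {k l : ℕ} {p : MvPolynomial σ R} (hp : MvPolynomial.IsWeightedHomogeneous w p k) :
    MvPolynomial.IsWeightedHomogeneous w (MvPolynomial.weightedHomogeneousComponent v l p) k := by
  classical
  intro d hd
  rw [MvPolynomial.coeff_weightedHomogeneousComponent] at hd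
  split_ifs at hd with h
  · exact hp hd
  · exact absurd rfl hd

open TensorProduct in
/-- The kernel of a substitution over a field commutes with base change. -/
theorem MvPolynomial.mem_map_ker_aeval {K B σ τ : Type*} [Field K] [CommRing B] [Algebra K B]
    (x : σ → MvPolynomial τ K) {p : MvPolynomial σ B}
    (hp : MvPolynomial.aeval (fun i => MvPolynomial.map (algebraMap K B) (x i)) p = 0) :
    p ∈ (RingHom.ker (MvPolynomial.aeval x : MvPolynomial σ K →ₐ[K] MvPolynomial τ K)).map
      (MvPolynomial.map (algebraMap K B)) := by
  set ψ : MvPolynomial σ K →ₐ[K] MvPolynomial τ K := MvPolynomial.aeval x with hψ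
  have hcomm : ∀ z : B ⊗[K] MvPolynomial σ K,
      MvPolynomial.algebraTensorAlgEquiv K B (ψ.toLinearMap.lTensor B z) =
        MvPolynomial.aeval (fun i => MvPolynomial.map (algebraMap K B) (x i))
          (MvPolynomial.algebraTensorAlgEquiv K B z) := by
    intro z
    induction z using TensorProduct.induction_on with
    | zero => simp
    | add y z hy hz => rw [map_add, map_add, map_add, map_add, hy, hz]
    | tmul b q =>
      rw [LinearMap.lTensor_tmul, MvPolynomial.algebraTensorAlgEquiv_tmul,
        MvPolynomial.algebraTensorAlgEquiv_tmul, map_smul]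
      congr 1
      induction q using MvPolynomial.induction_on with
      | C r => simp [hψ]
      | add p q hp hq => simp only [map_add, hp, hq]
      | mul_X p i hp =>
        simp only [AlgHom.toLinearMap_apply] at hp
        simp only [AlgHom.toLinearMap_apply, map_mul, hp]
        simp [hψ]
  let V : Submodule K (MvPolynomial σ K) := LinearMap.ker ψ.toLinearMap
  have hex : Function.Exact (V.subtype.lTensor B) (ψ.toLinearMap.lTensor B) :=
    Module.Flat.lTensor_exact (R := K) B (LinearMap.exact_subtype_ker_map _)
  obtain ⟨z, rfl⟩ := (MvPolynomial.algebraTensorAlgEquiv (σ := σ) K B).surjective p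
  rw [← hcomm, map_eq_zero_iff _ (MvPolynomial.algebraTensorAlgEquiv (σ := τ) K B).injective] at hp
  obtain ⟨y, rfl⟩ := (hex z).1 hp
  clear hp
  induction y using TensorProduct.induction_on with
  | zero => simp
  | add y z hy hz => rw [map_add, map_add]; exact Ideal.add_mem _ hy hz
  | tmul b q =>
    rw [LinearMap.lTensor_tmul, MvPolynomial.algebraTensorAlgEquiv_tmul, Algebra.smul_def]
    exact Ideal.mul_mem_left _ _ (Ideal.mem_map_of_mem _ q.2)

theorem mem_scalarIdeal_of_scalarVanish' {K : Type u} [Field K] {n : ℕ} (i₀ : Fin n)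
    {f : MvPolynomial ((Fin n × Fin n) ⊕ (Fin n × Fin n)) K}
    (hf : ScalarVanish f) : f ∈ scalarIdeal i₀ (genX K n) (genT K n) := by
  rw [← MvPolynomial.sum_homogeneousComponent f]
  refine Ideal.sum_mem _ fun d _ => ?_
  refine mem_scalarIdeal_of_scalarVanish i₀ d (MvPolynomial.homogeneousComponent_isHomogeneous d f) ?_
  intro F _ _ X T c hc hXT hTX
  have h0 : pairEval (X.map fun a => Polynomial.C a * Polynomial.X)
      (T.map fun a => Polynomial.C a * Polynomial.X) f = 0 := by
    have hinj := IsFractionRing.injective (Polynomial F) (FractionRing (Polynomial F))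
    apply hinj
    let φ : Polynomial F →ₐ[K] FractionRing (Polynomial F) := IsScalarTower.toAlgHom K _ _
    change φ _ = _
    rw [map_pairEval, map_zero]
    have hmul : ∀ {X T : Matrix (Fin n) (Fin n) F}, X * T = c • 1 →
        (X.map fun a => Polynomial.C a * Polynomial.X) *
        (T.map fun a => Polynomial.C a * Polynomial.X) =
        (Polynomial.C c * Polynomial.X ^ 2 : Polynomial F) • 1 := by
      intro X T h
      refine Matrix.ext fun i j => ?_
      have := congrFun (congrFun h i) j
      rw [Matrix.mul_apply] at this ⊢
      simp only [Matrix.map_apply]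
      have e : ∀ k, Polynomial.C (X i k) * Polynomial.X * (Polynomial.C (T k j) * Polynomial.X) =
          Polynomial.C (X i k * T k j) * Polynomial.X ^ 2 := fun k => by rw [Polynomial.C_mul]; ring
      simp only [e]
      rw [← Finset.sum_mul, ← map_sum, this]
      by_cases hij : i = j <;> simp [hij]
    have hφ : ∀ {X T : Matrix (Fin n) (Fin n) (Polynomial F)} {c : Polynomial F}, X * T = c • 1 →
        X.map φ * T.map φ = φ c • 1 := by
      intro X T c h
      rw [← Matrix.map_mul, h]
      refine Matrix.ext fun i j => ?_
      by_cases hij : i = j <;> simp [hij]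
    refine hf _ _ _ (φ (Polynomial.C c * Polynomial.X ^ 2)) ?_ (hφ (hmul hXT)) (hφ (hmul hTX))
    exact (map_ne_zero_iff _ hinj).2 (mul_ne_zero (Polynomial.C_ne_zero.2 hc)
      (pow_ne_zero _ Polynomial.X_ne_zero))
  have h1 := MvPolynomial.coeff_aeval_C_mul_X_pow 1
    (Sum.elim (fun p => X p.1 p.2) (fun p => T p.1 p.2)) d f
  change _ = pairEval X T (MvPolynomial.homogeneousComponent d f) at h1
  rw [← h1, ← Polynomial.coeff_zero d, ← h0]
  congr 2
  unfold pairEval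
  congr 1
  funext p
  rcases p with p | p <;> simp

/-- The generic matrix together with one further variable. -/
noncomputable def genY (K : Type*) [CommRing K] (n : ℕ) :
    Matrix (Fin n) (Fin n) (MvPolynomial (Option (Fin n × Fin n)) K) :=
  Matrix.of fun i j => MvPolynomial.X (some (i, j))

/-- A relation between a generic matrix and its scaled adjugate holds for every pair of matrices
whose products are the same scalar matrix. -/
theorem pairEval_eq_zero_of_genY {K : Type u} [Field K] {n : ℕ} (i₀ : Fin n)
    {f : MvPolynomial ((Fin n × Fin n) ⊕ (Fin n × Fin n)) K}
    (hf : pairEval (genY K n) ((MvPolynomial.X none : MvPolynomial (Option (Fin n × Fin n)) K) •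
      (genY K n).adjugate) f = 0)
    {F : Type*} [CommRing F] [Algebra K F]
    {X T : Matrix (Fin n) (Fin n) F} {c : F} (hXT : X * T = c • 1) (hTX : T * X = c • 1) :
    pairEval X T f = 0 := by
  refine pairEval_eq_zero_of_mem_scalarIdeal
    (mem_scalarIdeal_of_scalarVanish' i₀ (scalarVanish_of_adjugate ?_)) hXT hTX
  intro F _ _ X t
  let φ : MvPolynomial (Option (Fin n × Fin n)) K →ₐ[K] F :=
    MvPolynomial.aeval fun o => o.elim t fun p => X p.1 p.2
  have hX : (genY K n).map φ = X := Matrix.ext fun i j => by simp [φ, genY]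
  have h := map_pairEval φ (genY K n) ((MvPolynomial.X none :
    MvPolynomial (Option (Fin n × Fin n)) K) • (genY K n).adjugate) f
  rw [hf, map_zero, hX] at h
  rw [h]
  congr 2
  have hadj : (genY K n).adjugate.map φ = X.adjugate := by
    rw [← hX]
    exact AlgHom.map_adjugate φ _
  rw [← hadj]
  refine Matrix.ext fun i j => ?_
  simp [φ]

/-- Relations among the entries of the adjugate of `A` hold for every matrix whose products with `A`
are the same scalar matrix. -/
def AdjLinear {R : Type u} [CommRing R] {n : ℕ} (A : Matrix (Fin n) (Fin n) R) : Prop :=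
  ∀ (b : ℕ) (f : MvPolynomial (Fin n × Fin n) R), f.IsHomogeneous b →
    MvPolynomial.aeval (fun p => A.adjugate p.1 p.2) f = 0 →
    ∀ (S : Type u) [CommRing S] [Algebra R S] (M : Matrix (Fin n) (Fin n) S) (c : S),
      A.map (algebraMap R S) * M = c • 1 → M * A.map (algebraMap R S) = c • 1 →
      MvPolynomial.aeval (fun p => M p.1 p.2) f = 0

/-- Vanishing on pairs of matrices with equal scalar products, over all algebras. -/
def PairVanishOn {R : Type u} [CommRing R] {n : ℕ}
    (G : MvPolynomial ((Fin n × Fin n) ⊕ (Fin n × Fin n)) R) : Prop :=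
  ∀ (S : Type u) [CommRing S] [Algebra R S] (X T : Matrix (Fin n) (Fin n) S) (c : S),
    X * T = c • 1 → T * X = c • 1 → pairEval X T G = 0

theorem PairVanishOn.weightedHomogeneousComponent {R : Type u} [CommRing R] {n : ℕ}
    {G : MvPolynomial ((Fin n × Fin n) ⊕ (Fin n × Fin n)) R} (hG : PairVanishOn G) (v w k : ℕ) :
    PairVanishOn (MvPolynomial.weightedHomogeneousComponent
      (Sum.elim (fun _ => v) (fun _ => w)) k G) := by
  intro S _ _ X T c hXT hTX
  have hmul : ∀ {X T : Matrix (Fin n) (Fin n) S} {v w : ℕ}, X * T = c • 1 →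
      (X.map fun a => Polynomial.C a * Polynomial.X ^ v) *
      (T.map fun a => Polynomial.C a * Polynomial.X ^ w) =
      (Polynomial.C c * Polynomial.X ^ (v + w) : Polynomial S) • 1 := by
    intro X T v w h
    refine Matrix.ext fun i j => ?_
    have := congrFun (congrFun h i) j
    rw [Matrix.mul_apply] at this ⊢
    simp only [Matrix.map_apply]
    have e : ∀ k, Polynomial.C (X i k) * Polynomial.X ^ v * (Polynomial.C (T k j) * Polynomial.X ^ w) =
        Polynomial.C (X i k * T k j) * Polynomial.X ^ (v + w) := fun k => by
      rw [Polynomial.C_mul]; ring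
    simp only [e]
    rw [← Finset.sum_mul, ← map_sum, this]
    by_cases hij : i = j <;> simp [hij]
  have h0 := hG (Polynomial S) _ _ _ (hmul (v := v) (w := w) hXT)
    (by rw [add_comm]; exact hmul (v := w) (w := v) hTX)
  have h1 := MvPolynomial.coeff_aeval_C_mul_X_pow (Sum.elim (fun _ => v) (fun _ => w))
    (Sum.elim (fun p => X p.1 p.2) (fun p => T p.1 p.2)) k G
  change _ = pairEval X T _ at h1
  rw [← h1, ← Polynomial.coeff_zero k, ← h0]
  congr 2
  unfold pairEval
  congr 1
  funext p
  rcases p with p | p <;> simp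

theorem MvPolynomial.IsWeightedHomogeneous.aeval_pow_mul {R S σ : Type*} [CommRing R] [CommRing S]
    [Algebra R S] {w : σ → ℕ} {k : ℕ} {p : MvPolynomial σ R}
    (hp : MvPolynomial.IsWeightedHomogeneous w p k) (t : S) (x : σ → S) :
    MvPolynomial.aeval (fun i => t ^ w i * x i) p = t ^ k * MvPolynomial.aeval x p := by
  rw [MvPolynomial.aeval_eq_eval₂Hom, MvPolynomial.aeval_eq_eval₂Hom, MvPolynomial.coe_eval₂Hom,
    MvPolynomial.coe_eval₂Hom, MvPolynomial.eval₂_eq, MvPolynomial.eval₂_eq, Finset.mul_sum]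
  refine Finset.sum_congr rfl fun d hd => ?_
  rw [← hp (MvPolynomial.mem_support_iff.mp hd), Finsupp.weight_apply, Finsupp.sum]
  simp only [mul_pow, Finset.prod_mul_distrib, ← pow_mul, Finset.prod_pow_eq_pow_sum, smul_eq_mul,
    mul_comm (w _)]
  ring

theorem Matrix.adjugate_mvPolynomialX_isHomogeneous (R : Type*) [CommRing R] (n : ℕ)
    (i j : Fin (n + 1)) :
    ((mvPolynomialX (Fin (n + 1)) (Fin (n + 1)) R).adjugate i j).IsHomogeneous n := by
  rw [adjugate_fin_succ_eq_det_submatrix]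
  have h1 : ((mvPolynomialX (Fin (n + 1)) (Fin (n + 1)) R).submatrix j.succAbove
      i.succAbove).det.IsHomogeneous n := by
    have := Matrix.det_isHomogeneous (M := (mvPolynomialX (Fin (n + 1)) (Fin (n + 1)) R).submatrix
      j.succAbove i.succAbove) (fun i j => by
        rw [submatrix_apply, mvPolynomialX_apply]; exact MvPolynomial.isHomogeneous_X _ _)
    simpa using this
  rcases neg_one_pow_eq_or (MvPolynomial (Fin (n + 1) × Fin (n + 1)) R) (j + i : ℕ) with h | h
  · rw [h, one_mul]; exact h1
  · rw [h, neg_one_mul]; exact h1.neg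

theorem IsWeightedHomogeneous.weight_elim {R σ τ : Type*} [CommRing R]
    {F : MvPolynomial (σ ⊕ τ) R} {k b : ℕ}
    (hX : MvPolynomial.IsWeightedHomogeneous (Sum.elim (fun _ => 1) (fun _ => 0)) F k)
    (hT : MvPolynomial.IsWeightedHomogeneous (Sum.elim (fun _ => 0) (fun _ => 1)) F b) (m : ℕ) :
    MvPolynomial.IsWeightedHomogeneous (Sum.elim (fun _ => 1) (fun _ => m)) F (k + m * b) := by
  intro d hd
  rw [← hX hd, ← hT hd]
  simp only [Finsupp.weight_apply, Finsupp.sum, Finset.mul_sum, ← Finset.sum_add_distrib]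
  refine Finset.sum_congr rfl fun p _ => ?_
  rcases p with p | p <;> simp [mul_comm]

theorem mul_pairEval_smul {R S : Type*} [CommRing R] [CommRing S] [Algebra R S] {n b : ℕ}
    {F : MvPolynomial ((Fin n × Fin n) ⊕ (Fin n × Fin n)) R}
    (hT : MvPolynomial.IsWeightedHomogeneous (Sum.elim (fun _ => 0) (fun _ => 1)) F b)
    (X T : Matrix (Fin n) (Fin n) S) (t : S) :
    pairEval X (t • T) F = t ^ b * pairEval X T F := by
  unfold pairEval
  rw [← hT.aeval_pow_mul]
  congr 2
  funext p
  rcases p with p | p <;> simp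

section
variable {R : Type u} [CommRing R] {n k b : ℕ}

theorem pairVanishOn_of_mem_map {K : Type u} [Field K] [Algebra K R]
    {G : MvPolynomial ((Fin (n + 1) × Fin (n + 1)) ⊕ (Fin (n + 1) × Fin (n + 1))) R}
    (hG : G ∈ (RingHom.ker (pairEval (genY K (n + 1))
      ((MvPolynomial.X none : MvPolynomial (Option (Fin (n + 1) × Fin (n + 1))) K) •
        (genY K (n + 1)).adjugate) :
        MvPolynomial ((Fin (n + 1) × Fin (n + 1)) ⊕ (Fin (n + 1) × Fin (n + 1))) K →ₐ[K] _)).map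
      (MvPolynomial.map (algebraMap K R))) : PairVanishOn G := by
  intro S _ _ X T c hXT hTX
  let _ : Algebra K S := ((algebraMap R S).comp (algebraMap K R)).toAlgebra
  have _ : IsScalarTower K R S := IsScalarTower.of_algebraMap_eq fun _ => rfl
  have hle : (RingHom.ker (pairEval (genY K (n + 1))
      ((MvPolynomial.X none : MvPolynomial (Option (Fin (n + 1) × Fin (n + 1))) K) •
        (genY K (n + 1)).adjugate) :
        MvPolynomial ((Fin (n + 1) × Fin (n + 1)) ⊕ (Fin (n + 1) × Fin (n + 1))) K →ₐ[K] _)).map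
      (MvPolynomial.map (algebraMap K R)) ≤ RingHom.ker (pairEval X T :
        MvPolynomial ((Fin (n + 1) × Fin (n + 1)) ⊕ (Fin (n + 1) × Fin (n + 1))) R →ₐ[R] S) := by
    rw [Ideal.map_le_iff_le_comap]
    intro f hf
    change pairEval X T (MvPolynomial.map (algebraMap K R) f) = 0
    have h := pairEval_eq_zero_of_genY 0 hf hXT hTX
    rw [← h]
    exact MvPolynomial.aeval_map_algebraMap R _ f
  exact hle hG

/-- A relation between a quasi-regular matrix and its adjugate holds up to coefficients in the ideal
of the entries. -/
theorem exists_mem_map_of_quasiRegular (K : Type u) [Field K] [Algebra K R]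
    {a : Matrix (Fin (n + 1)) (Fin (n + 1)) R}
    (ha : QuasiRegular fun p : Fin (n + 1) × Fin (n + 1) => a p.1 p.2)
    {F : MvPolynomial ((Fin (n + 1) × Fin (n + 1)) ⊕ (Fin (n + 1) × Fin (n + 1))) R}
    (hX : MvPolynomial.IsWeightedHomogeneous (Sum.elim (fun _ => 1) (fun _ => 0)) F k)
    (hT : MvPolynomial.IsWeightedHomogeneous (Sum.elim (fun _ => 0) (fun _ => 1)) F b)
    (hF : pairEval a a.adjugate F = 0) :
    ∃ e, e ∈ (Ideal.span (Set.range fun p : Fin (n + 1) × Fin (n + 1) => a p.1 p.2)).map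
      (MvPolynomial.C : R →+* MvPolynomial ((Fin (n + 1) × Fin (n + 1)) ⊕
        (Fin (n + 1) × Fin (n + 1))) R) ∧ PairVanishOn (F - e) := by
  classical
  set I := Ideal.span (Set.range fun p : Fin (n + 1) × Fin (n + 1) => a p.1 p.2) with hI
  set Z := mvPolynomialX (Fin (n + 1)) (Fin (n + 1)) R with hZ
  have h1 : pairEval Z Z.adjugate F ∈ I.map MvPolynomial.C := by
    refine ha (k + n * b) _ ?_ ?_
    · refine (IsWeightedHomogeneous.weight_elim hX hT n).isHomogeneous_aeval ?_
      rintro (p | p)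
      · exact MvPolynomial.isHomogeneous_X _ _
      · exact Matrix.adjugate_mvPolynomialX_isHomogeneous R n _ _
    · let φ : MvPolynomial (Fin (n + 1) × Fin (n + 1)) R →ₐ[R] R :=
        MvPolynomial.aeval fun p => a p.1 p.2
      change φ _ = 0
      have hZa : Z.map φ = a := Matrix.ext fun i j => by simp [φ, hZ, mvPolynomialX_apply]
      rw [map_pairEval, hZa, ← hF]
      congr 2
      rw [← hZa]
      exact AlgHom.map_adjugate φ _
  let B := R ⧸ I
  let Y := genY B (n + 1)
  have h2 : pairEval Y Y.adjugate F = 0 := by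
    let ψ : MvPolynomial (Fin (n + 1) × Fin (n + 1)) R →ₐ[R]
      MvPolynomial (Option (Fin (n + 1) × Fin (n + 1))) B :=
        MvPolynomial.aeval fun p => MvPolynomial.X (some p)
    have hZa : Z.map ψ = Y := Matrix.ext fun i j => by simp [ψ, hZ, mvPolynomialX_apply, Y, genY]
    have hadj : Z.adjugate.map ψ = Y.adjugate := by
      rw [← hZa]
      exact AlgHom.map_adjugate ψ _
    have hle : I.map (MvPolynomial.C : R →+* MvPolynomial (Fin (n + 1) × Fin (n + 1)) R) ≤
        RingHom.ker ψ := by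
      rw [Ideal.map_le_iff_le_comap]
      intro r hr
      change ψ (MvPolynomial.C r) = 0
      rw [MvPolynomial.aeval_C, IsScalarTower.algebraMap_apply R B]
      have : algebraMap R B r = 0 := Ideal.Quotient.eq_zero_iff_mem.2 hr
      rw [this, map_zero]
    have h := map_pairEval ψ Z Z.adjugate F
    rw [hZa, hadj] at h
    rw [← h]
    exact hle h1
  have h3 : pairEval Y ((MvPolynomial.X none :
      MvPolynomial (Option (Fin (n + 1) × Fin (n + 1))) B) • Y.adjugate) F = 0 := by
    rw [mul_pairEval_smul hT, h2, mul_zero]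
  set 𝒦 := RingHom.ker (pairEval (genY K (n + 1))
      ((MvPolynomial.X none : MvPolynomial (Option (Fin (n + 1) × Fin (n + 1))) K) •
        (genY K (n + 1)).adjugate) :
        MvPolynomial ((Fin (n + 1) × Fin (n + 1)) ⊕ (Fin (n + 1) × Fin (n + 1))) K →ₐ[K] _) with h𝒦
  have h4 : MvPolynomial.map (algebraMap R B) F ∈ 𝒦.map (MvPolynomial.map (algebraMap K B)) := by
    refine MvPolynomial.mem_map_ker_aeval _ ?_
    rw [MvPolynomial.aeval_map_algebraMap, ← h3]
    unfold pairEval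
    congr 2
    let φ : MvPolynomial (Option (Fin (n + 1) × Fin (n + 1))) K →+*
      MvPolynomial (Option (Fin (n + 1) × Fin (n + 1))) B := MvPolynomial.map (algebraMap K B)
    have hY : (genY K (n + 1)).map φ = Y := Matrix.ext fun i j => by simp [φ, Y, genY]
    have hadj : (genY K (n + 1)).adjugate.map φ = Y.adjugate := by
      rw [← hY]
      exact RingHom.map_adjugate φ _
    funext p
    rcases p with p | p
    · exact congrFun (congrFun hY p.1) p.2
    · have := congrFun (congrFun hadj p.1) p.2
      simp only [Sum.elim_inr, Matrix.smul_apply, smul_eq_mul, map_mul, MvPolynomial.map_X]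
      rw [← this]
      rfl
  have h5 : (MvPolynomial.map (algebraMap K B) :
      MvPolynomial ((Fin (n + 1) × Fin (n + 1)) ⊕ (Fin (n + 1) × Fin (n + 1))) K →+* _) =
      (MvPolynomial.map (algebraMap R B)).comp (MvPolynomial.map (algebraMap K R)) := by
    refine MvPolynomial.ringHom_ext (fun r => ?_) fun i => ?_
    · simp [IsScalarTower.algebraMap_apply K R B]
    · simp
  rw [h5, ← Ideal.map_map, Ideal.mem_map_iff_of_surjective _
    (MvPolynomial.map_surjective _ Ideal.Quotient.mk_surjective)] at h4
  obtain ⟨G, hG, hGF⟩ := h4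
  refine ⟨F - G, ?_, ?_⟩
  · rw [MvPolynomial.mem_map_C_iff]
    intro m
    have : MvPolynomial.map (algebraMap R B) (F - G) = 0 := by rw [map_sub, hGF, sub_self]
    have := congrArg (MvPolynomial.coeff m) this
    rw [MvPolynomial.coeff_map, MvPolynomial.coeff_zero] at this
    exact Ideal.Quotient.eq_zero_iff_mem.1 this
  · rw [sub_sub_cancel]
    exact pairVanishOn_of_mem_map hG

/-- The entries of the ideal can be absorbed into the degree in the first matrix. -/
theorem exists_isWeightedHomogeneous_succ {a : Matrix (Fin n) (Fin n) R}
    {e : MvPolynomial ((Fin n × Fin n) ⊕ (Fin n × Fin n)) R}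
    (hX : MvPolynomial.IsWeightedHomogeneous (Sum.elim (fun _ => 1) (fun _ => 0)) e k)
    (hT : MvPolynomial.IsWeightedHomogeneous (Sum.elim (fun _ => 0) (fun _ => 1)) e b)
    (he : e ∈ (Ideal.span (Set.range fun p : Fin n × Fin n => a p.1 p.2)).map
      (MvPolynomial.C : R →+* MvPolynomial ((Fin n × Fin n) ⊕ (Fin n × Fin n)) R)) :
    ∃ F : MvPolynomial ((Fin n × Fin n) ⊕ (Fin n × Fin n)) R,
      MvPolynomial.IsWeightedHomogeneous (Sum.elim (fun _ => 1) (fun _ => 0)) F (k + 1) ∧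
      MvPolynomial.IsWeightedHomogeneous (Sum.elim (fun _ => 0) (fun _ => 1)) F b ∧
      ∀ (S : Type u) [CommRing S] [Algebra R S] (M : Matrix (Fin n) (Fin n) S),
        pairEval (a.map (algebraMap R S)) M F = pairEval (a.map (algebraMap R S)) M e := by
  have h : ∀ m, ∃ r : Fin n × Fin n → R, ∑ p, r p * a p.1 p.2 = e.coeff m := fun m => by
    have := MvPolynomial.mem_map_C_iff.1 he m
    rw [Ideal.mem_span_range_iff_exists_fun] at this
    exact this
  choose r hr using h
  refine ⟨∑ m ∈ e.support, (∑ p, MvPolynomial.C (r m p) * MvPolynomial.X (Sum.inl p)) *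
    MvPolynomial.monomial m 1, ?_, ?_, ?_⟩
  · refine MvPolynomial.IsWeightedHomogeneous.sum _ _ _ fun m hm => ?_
    rw [add_comm]
    refine MvPolynomial.IsWeightedHomogeneous.mul ?_ (MvPolynomial.isWeightedHomogeneous_monomial _ _ _
      (hX (MvPolynomial.mem_support_iff.1 hm)))
    exact MvPolynomial.IsWeightedHomogeneous.sum _ _ _ fun p _ =>
      (MvPolynomial.isWeightedHomogeneous_X _ _ _).C_mul _
  · refine MvPolynomial.IsWeightedHomogeneous.sum _ _ _ fun m hm => ?_
    rw [← zero_add b]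
    refine MvPolynomial.IsWeightedHomogeneous.mul ?_ (MvPolynomial.isWeightedHomogeneous_monomial _ _ _
      (hT (MvPolynomial.mem_support_iff.1 hm)))
    exact MvPolynomial.IsWeightedHomogeneous.sum _ _ _ fun p _ =>
      (MvPolynomial.isWeightedHomogeneous_X _ _ _).C_mul _
  · intro S _ _ M
    conv_rhs => rw [← MvPolynomial.support_sum_monomial_coeff e]
    rw [map_sum, map_sum]
    refine Finset.sum_congr rfl fun m _ => ?_
    have e1 : MvPolynomial.monomial m (e.coeff m) =
        MvPolynomial.C (e.coeff m) * MvPolynomial.monomial m 1 := by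
      rw [MvPolynomial.C_mul_monomial, mul_one]
    rw [e1, map_mul, map_mul]
    congr 1
    rw [← hr]
    simp only [pairEval, map_sum, map_mul, MvPolynomial.aeval_C, MvPolynomial.aeval_X, Sum.elim_inl,
      Matrix.map_apply]

theorem exists_isWeightedHomogeneous_aeval_eq {a : Matrix (Fin (n + 1)) (Fin (n + 1)) R}
    (K : Type u) [Field K] [Algebra K R]
    (ha : QuasiRegular fun p : Fin (n + 1) × Fin (n + 1) => a p.1 p.2)
    {f : MvPolynomial (Fin (n + 1) × Fin (n + 1)) R} (hf : f.IsHomogeneous b)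
    (hfa : MvPolynomial.aeval (fun p => a.adjugate p.1 p.2) f = 0) (k : ℕ) :
    ∃ F : MvPolynomial ((Fin (n + 1) × Fin (n + 1)) ⊕ (Fin (n + 1) × Fin (n + 1))) R,
      MvPolynomial.IsWeightedHomogeneous (Sum.elim (fun _ => 1) (fun _ => 0)) F k ∧
      MvPolynomial.IsWeightedHomogeneous (Sum.elim (fun _ => 0) (fun _ => 1)) F b ∧
      pairEval a a.adjugate F = 0 ∧
      ∀ (S : Type u) [CommRing S] [Algebra R S] (M : Matrix (Fin (n + 1)) (Fin (n + 1)) S) (c : S),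
        a.map (algebraMap R S) * M = c • 1 → M * a.map (algebraMap R S) = c • 1 →
        pairEval (a.map (algebraMap R S)) M F = MvPolynomial.aeval (fun p => M p.1 p.2) f := by
  induction k with
  | zero =>
    have hpair : ∀ (S : Type u) [CommRing S] [Algebra R S]
        (X M : Matrix (Fin (n + 1)) (Fin (n + 1)) S),
        pairEval X M (MvPolynomial.rename Sum.inr f) =
          MvPolynomial.aeval (fun p => M p.1 p.2) f := by
      intro S _ _ X M
      unfold pairEval
      rw [MvPolynomial.aeval_rename]
      rfl
    refine ⟨MvPolynomial.rename Sum.inr f, ?_, ?_, ?_, fun S _ _ M c _ _ => hpair S _ M⟩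
    · rw [← MvPolynomial.support_sum_monomial_coeff f, map_sum]
      refine MvPolynomial.IsWeightedHomogeneous.sum _ _ _ fun m hm => ?_
      rw [MvPolynomial.rename_monomial]
      refine MvPolynomial.isWeightedHomogeneous_monomial _ _ _ ?_
      rw [Finsupp.weight_apply, Finsupp.sum_mapDomain_index (by simp) (by simp [add_mul])]
      simp
    · rw [← MvPolynomial.support_sum_monomial_coeff f, map_sum]
      refine MvPolynomial.IsWeightedHomogeneous.sum _ _ _ fun m hm => ?_
      rw [MvPolynomial.rename_monomial]
      refine MvPolynomial.isWeightedHomogeneous_monomial _ _ _ ?_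
      rw [← hf (MvPolynomial.mem_support_iff.1 hm), Finsupp.weight_apply, Finsupp.weight_apply,
        Finsupp.sum_mapDomain_index (by simp) (by simp [add_mul])]
      simp
    · rw [hpair, hfa]
  | succ k ih =>
    obtain ⟨F, hX, hT, hF, hM⟩ := ih
    obtain ⟨e, he, hv⟩ := exists_mem_map_of_quasiRegular K ha hX hT hF
    have hv' := (hv.weightedHomogeneousComponent 1 0 k).weightedHomogeneousComponent 0 1 b
    rw [map_sub, hX.weightedHomogeneousComponent_same, map_sub,
      hT.weightedHomogeneousComponent_same] at hv'
    set e₁ := MvPolynomial.weightedHomogeneousComponent (Sum.elim (fun _ => 0) (fun _ => 1)) b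
      (MvPolynomial.weightedHomogeneousComponent (Sum.elim (fun _ => 1) (fun _ => 0)) k e) with he₁
    have hmem : ∀ {e : MvPolynomial ((Fin (n + 1) × Fin (n + 1)) ⊕ (Fin (n + 1) × Fin (n + 1))) R}
        {I : Ideal R} (w : _ → ℕ) (k : ℕ), e ∈ I.map MvPolynomial.C →
        MvPolynomial.weightedHomogeneousComponent w k e ∈ I.map MvPolynomial.C := by
      intro e I w k he
      rw [MvPolynomial.mem_map_C_iff] at he ⊢
      intro m
      rw [MvPolynomial.coeff_weightedHomogeneousComponent]
      split_ifs
      · exact he m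
      · exact I.zero_mem
    obtain ⟨F', hX', hT', hF'⟩ := exists_isWeightedHomogeneous_succ (e := e₁) (a := a)
      (MvPolynomial.IsWeightedHomogeneous.weightedHomogeneousComponent
        (MvPolynomial.weightedHomogeneousComponent_isWeightedHomogeneous _ _))
      (MvPolynomial.weightedHomogeneousComponent_isWeightedHomogeneous _ _)
      (hmem _ _ (hmem _ _ he))
    have key : ∀ (S : Type u) [CommRing S] [Algebra R S]
        (M : Matrix (Fin (n + 1)) (Fin (n + 1)) S) (c : S),
        a.map (algebraMap R S) * M = c • 1 → M * a.map (algebraMap R S) = c • 1 →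
        pairEval (a.map (algebraMap R S)) M F' = pairEval (a.map (algebraMap R S)) M F := by
      intro S _ _ M c h1 h2
      rw [hF']
      have := hv' S _ _ c h1 h2
      rw [map_sub, sub_eq_zero] at this
      exact this.symm
    refine ⟨F', hX', hT', ?_, fun S _ _ M c h1 h2 => (key S M c h1 h2).trans (hM S M c h1 h2)⟩
    have ha1 : a.map (algebraMap R R) = a := Matrix.ext fun i j => rfl
    have := key R a.adjugate a.det (by rw [ha1, mul_adjugate]) (by rw [ha1, adjugate_mul])
    rw [ha1, hF] at this
    exact this

end

theorem adjLinear_of_quasiRegular (K : Type u) [Field K] {R : Type u} [CommRing R] [Algebra K R]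
    [IsLocalRing R] [IsNoetherianRing R] {n : ℕ} {a : Matrix (Fin (n + 1)) (Fin (n + 1)) R}
    (ham : ∀ i j, a i j ∈ IsLocalRing.maximalIdeal R)
    (ha : QuasiRegular fun p : Fin (n + 1) × Fin (n + 1) => a p.1 p.2) : AdjLinear a := by
  intro b f hf hfa S _ _ M c hl hr
  set I := Ideal.span (Set.range fun p : Fin (n + 1) × Fin (n + 1) => a p.1 p.2) with hI
  have hItop : I ≠ ⊤ := by
    intro h
    have hle : I ≤ IsLocalRing.maximalIdeal R := Ideal.span_le.2 (by
      rintro _ ⟨p, rfl⟩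
      exact ham _ _)
    rw [h, top_le_iff] at hle
    exact Ideal.IsPrime.ne_top' hle
  let N : Submodule R S := (MvPolynomial.weightedHomogeneousSubmodule R
    (fun _ : Fin (n + 1) × Fin (n + 1) => 1) b).map
    (MvPolynomial.aeval (fun p => M p.1 p.2) : MvPolynomial (Fin (n + 1) × Fin (n + 1)) R →ₐ[R] S).toLinearMap
  have hN : N.FG := (MvPolynomial.weightedHomogeneousSubmodule_fg R _ (fun _ => one_ne_zero) b).map _
  have hfin : Module.Finite R N := Module.Finite.iff_fg.2 hN
  have hfN : MvPolynomial.aeval (fun p => M p.1 p.2) f ∈ N := ⟨f, hf, rfl⟩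
  have hall : ∀ k, MvPolynomial.aeval (fun p => M p.1 p.2) f ∈ I ^ k • N := by
    intro k
    obtain ⟨F, hX, hT, -, hM⟩ := exists_isWeightedHomogeneous_aeval_eq K ha hf hfa k
    rw [← hM S M c hl hr]
    unfold pairEval
    rw [MvPolynomial.aeval_eq_eval₂Hom, MvPolynomial.coe_eval₂Hom, MvPolynomial.eval₂_eq']
    refine Submodule.sum_mem _ fun m hm => ?_
    rw [Fintype.prod_sum_type]
    simp only [Sum.elim_inl, Sum.elim_inr, Matrix.map_apply, ← map_pow, ← map_prod]
    rw [← mul_assoc, ← map_mul, ← Algebra.smul_def]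
    have hmX := hX (MvPolynomial.mem_support_iff.1 hm)
    have hmT := hT (MvPolynomial.mem_support_iff.1 hm)
    rw [Finsupp.weight_apply, Finsupp.sum_fintype _ _ (by simp), Fintype.sum_sum_type] at hmX hmT
    simp only [Sum.elim_inl, Sum.elim_inr, smul_eq_mul, mul_one, mul_zero, Finset.sum_const_zero,
      add_zero, zero_add] at hmX hmT
    refine Submodule.smul_mem_smul (Ideal.mul_mem_left _ _ ?_) ?_
    · rw [← hmX, ← Finset.prod_pow_eq_pow_sum]
      exact Ideal.prod_mem_prod fun p _ => Ideal.pow_mem_pow (Ideal.subset_span (Set.mem_range_self p)) _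
    · refine ⟨∏ p : Fin (n + 1) × Fin (n + 1), MvPolynomial.X p ^ m (Sum.inr p), ?_, by simp⟩
      change MvPolynomial.IsWeightedHomogeneous _ _ _
      rw [← hmT]
      refine MvPolynomial.IsWeightedHomogeneous.prod _ _ _ fun p _ => ?_
      have := (MvPolynomial.isWeightedHomogeneous_X R
        (fun _ : Fin (n + 1) × Fin (n + 1) => 1) p).pow (m (Sum.inr p))
      simpa using this
  have hbot := Ideal.iInf_pow_smul_eq_bot_of_isLocalRing (M := N) I hItop
  have hz : (⟨_, hfN⟩ : N) ∈ (⨅ i : ℕ, I ^ i • ⊤ : Submodule R N) := by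
    rw [Submodule.mem_iInf]
    intro k
    rw [Submodule.mem_smul_top_iff]
    exact hall k
  rw [hbot, Submodule.mem_bot] at hz
  exact congrArg Subtype.val hz

theorem Matrix.map_smul_one {R S : Type*} [CommRing R] [CommRing S] {n : ℕ} (φ : R →+* S) (r : R) :
    (r • (1 : Matrix (Fin n) (Fin n) R)).map φ = φ r • 1 := by
  refine Matrix.ext fun i j => ?_
  by_cases hij : i = j <;> simp [hij]

theorem AdjLinear.mul_mul {R : Type u} [CommRing R] {n : ℕ} {A : Matrix (Fin n) (Fin n) R}
    (hA : AdjLinear A) {G H : Matrix (Fin n) (Fin n) R} (hG : IsUnit G.det) (hH : IsUnit H.det) :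
    AdjLinear (G * A * H) := by
  obtain ⟨G', hGG', hG'G⟩ : ∃ G', G * G' = 1 ∧ G' * G = 1 :=
    ⟨G⁻¹, Matrix.mul_nonsing_inv _ hG, Matrix.nonsing_inv_mul _ hG⟩
  obtain ⟨H', hHH', hH'H⟩ : ∃ H', H * H' = 1 ∧ H' * H = 1 :=
    ⟨H⁻¹, Matrix.mul_nonsing_inv _ hH, Matrix.nonsing_inv_mul _ hH⟩
  have hadj : ∀ {G G' : Matrix (Fin n) (Fin n) R}, G * G' = 1 → G' = G'.det • G.adjugate := by
    intro G G' h
    have h1 : G'.det * G.det = 1 := by rw [mul_comm, ← det_mul, h, det_one]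
    calc G' = (G'.det * G.det) • G' := by rw [h1, one_smul]
      _ = G'.det • (G.adjugate * G * G') := by
        rw [adjugate_mul, mul_smul, Matrix.smul_mul, Matrix.one_mul]
      _ = _ := by rw [Matrix.mul_assoc, h, Matrix.mul_one]
  intro b f hf hfa S _ _ M c hl hr
  let Q : Matrix (Fin n) (Fin n) (MvPolynomial (Fin n × Fin n) R) :=
    H'.map MvPolynomial.C * mvPolynomialX (Fin n) (Fin n) R * G'.map MvPolynomial.C
  let f₀ : MvPolynomial (Fin n × Fin n) R := MvPolynomial.aeval (fun p => Q p.1 p.2) f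
  have hQ : ∀ i j, (Q i j).IsHomogeneous 1 := by
    intro i j
    simp only [Q, Matrix.mul_apply, Finset.sum_mul]
    refine MvPolynomial.IsHomogeneous.sum _ _ _ fun k _ =>
      MvPolynomial.IsHomogeneous.sum _ _ _ fun l _ => ?_
    simp only [Matrix.map_apply, mvPolynomialX_apply]
    rw [mul_comm]
    exact ((MvPolynomial.isHomogeneous_X _ _).C_mul _).C_mul _
  have hf₀ : f₀.IsHomogeneous b := by
    have := hf.aeval (fun p => Q p.1 p.2) (n := 1) fun p => hQ _ _
    rwa [one_mul] at this
  have hval : ∀ (S : Type u) [CommRing S] [Algebra R S] (N : Matrix (Fin n) (Fin n) S),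
      MvPolynomial.aeval (fun p => N p.1 p.2) f₀ =
        MvPolynomial.aeval (fun p : Fin n × Fin n =>
          (H'.map (algebraMap R S) * N * G'.map (algebraMap R S)) p.1 p.2) f := by
    intro S _ _ N
    simp only [f₀]
    rw [← AlgHom.comp_apply, MvPolynomial.comp_aeval]
    congr 2
    funext p
    simp only [Q, Matrix.mul_apply, map_sum, map_mul, Matrix.map_apply, mvPolynomialX_apply,
      MvPolynomial.aeval_X, MvPolynomial.aeval_C]
  have h0 : MvPolynomial.aeval (fun p => A.adjugate p.1 p.2) f₀ = 0 := by
    rw [hval]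
    have h1 : H'.map (algebraMap R R) * A.adjugate * G'.map (algebraMap R R) =
        (H'.det * G'.det) • (G * A * H).adjugate := by
      change H' * A.adjugate * G' = _
      conv_lhs => rw [hadj hHH', hadj hGG']
      rw [adjugate_mul_distrib, adjugate_mul_distrib, Matrix.smul_mul, Matrix.smul_mul,
        Matrix.mul_smul, smul_smul, Matrix.mul_assoc]
    rw [h1]
    have h2 := MvPolynomial.IsWeightedHomogeneous.aeval_pow_mul hf (H'.det * G'.det)
      (fun p : Fin n × Fin n => (G * A * H).adjugate p.1 p.2)
    simp only [Pi.one_apply, pow_one] at h2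
    rw [hfa, mul_zero] at h2
    exact h2
  have hmap : ∀ {X Y : Matrix (Fin n) (Fin n) R}, X * Y = 1 →
      X.map (algebraMap R S) * Y.map (algebraMap R S) = 1 := by
    intro X Y h
    rw [← Matrix.map_mul, h, Matrix.map_one _ (map_zero _) (map_one _)]
  rw [Matrix.map_mul, Matrix.map_mul] at hl hr
  set g := G.map (algebraMap R S)
  set g' := G'.map (algebraMap R S)
  set h := H.map (algebraMap R S)
  set h' := H'.map (algebraMap R S)
  set α := A.map (algebraMap R S) with hα
  have h1 := hA b f₀ hf₀ h0 S (h * M * g) c (by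
    calc α * (h * M * g) = (g' * g) * (α * (h * M * g)) := by rw [hmap hG'G, Matrix.one_mul]
      _ = g' * (g * α * h * M) * g := by simp only [Matrix.mul_assoc]
      _ = c • 1 := by
        rw [hl, Matrix.mul_smul, Matrix.mul_one, Matrix.smul_mul, hmap hG'G]) (by
    calc h * M * g * α = h * M * g * α * (h * h') := by rw [hmap hHH', Matrix.mul_one]
      _ = h * (M * (g * α * h)) * h' := by simp only [Matrix.mul_assoc]
      _ = c • 1 := by
        rw [hr, Matrix.mul_smul, Matrix.mul_one, Matrix.smul_mul, hmap hHH'])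
  rw [hval] at h1
  have h2 : h' * (h * M * g) * g' = M := by
    calc h' * (h * M * g) * g' = (h' * h) * M * (g * g') := by simp only [Matrix.mul_assoc]
      _ = M := by rw [hmap hH'H, hmap hGG', Matrix.one_mul, Matrix.mul_one]
  rw [← h1]
  change _ = MvPolynomial.aeval (fun p : Fin n × Fin n => (h' * (h * M * g) * g') p.1 p.2) f
  rw [h2]

/-- The block matrix with a leading `1` and remaining diagonal block `A`. -/
def blockOne {R : Type*} [CommRing R] {n : ℕ} (A : Matrix (Fin n) (Fin n) R) :
    Matrix (Fin (n + 1)) (Fin (n + 1)) R :=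
  Matrix.of (Fin.cons (Fin.cons 1 0) fun i => Fin.cons 0 (A i))

section
variable {R : Type*} [CommRing R] {n : ℕ} (A : Matrix (Fin n) (Fin n) R)

@[simp] theorem blockOne_zero_zero : blockOne A 0 0 = 1 := rfl

@[simp] theorem blockOne_zero_succ (j : Fin n) : blockOne A 0 j.succ = 0 := rfl

@[simp] theorem blockOne_succ_zero (i : Fin n) : blockOne A i.succ 0 = 0 := rfl

@[simp] theorem blockOne_succ_succ (i j : Fin n) : blockOne A i.succ j.succ = A i j := rfl

theorem det_blockOne : (blockOne A).det = A.det := by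
  rw [det_succ_row_zero, Fin.sum_univ_succ]
  simp only [blockOne_zero_succ, blockOne_zero_zero, mul_zero, zero_mul, Finset.sum_const_zero,
    add_zero, Fin.val_zero, pow_zero, one_mul]
  congr 1

theorem map_blockOne {S : Type*} [CommRing S] (φ : R →+* S) :
    (blockOne A).map φ = blockOne (A.map φ) := by
  refine Matrix.ext fun i j => ?_
  refine Fin.cases ?_ (fun i => ?_) i <;> refine Fin.cases ?_ (fun j => ?_) j <;> simp

theorem adjugate_blockOne_succ_succ (A : Matrix (Fin (n + 1)) (Fin (n + 1)) R) (i j : Fin (n + 1)) :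
    (blockOne A).adjugate i.succ j.succ = A.adjugate i j := by
  rw [adjugate_fin_succ_eq_det_submatrix, adjugate_fin_succ_eq_det_submatrix]
  congr 1
  · rw [Fin.val_succ, Fin.val_succ, show (j : ℕ) + 1 + (i + 1) = j + i + 2 by ring, pow_add]
    simp
  · rw [← det_blockOne (A.submatrix j.succAbove i.succAbove)]
    congr 1
    refine Matrix.ext fun k l => ?_
    refine Fin.cases ?_ (fun k => ?_) k <;> refine Fin.cases ?_ (fun l => ?_) l <;> simp

end

section
variable {S : Type*} [CommRing S] {n : ℕ} {A : Matrix (Fin (n + 1)) (Fin (n + 1)) S}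
  {M : Matrix (Fin (n + 2)) (Fin (n + 2)) S} {c : S}

theorem blockOne_mul_zero (h : blockOne A * M = c • 1) (j : Fin (n + 2)) :
    M 0 j = c * (1 : Matrix (Fin (n + 2)) (Fin (n + 2)) S) 0 j := by
  have := congrFun (congrFun h 0) j
  rw [Matrix.mul_apply, Fin.sum_univ_succ] at this
  simpa using this

theorem mul_blockOne_zero (h : M * blockOne A = c • 1) (i : Fin (n + 2)) :
    M i 0 = c * (1 : Matrix (Fin (n + 2)) (Fin (n + 2)) S) i 0 := by
  have := congrFun (congrFun h i) 0
  rw [Matrix.mul_apply, Fin.sum_univ_succ] at this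
  simpa using this

theorem blockOne_mul_submatrix (h : blockOne A * M = c • 1) :
    A * M.submatrix Fin.succ Fin.succ = c • 1 := by
  refine Matrix.ext fun i j => ?_
  have := congrFun (congrFun h i.succ) j.succ
  rw [Matrix.mul_apply, Fin.sum_univ_succ] at this
  rw [Matrix.mul_apply]
  simpa [Matrix.one_apply] using this

theorem submatrix_mul_blockOne (h : M * blockOne A = c • 1) :
    M.submatrix Fin.succ Fin.succ * A = c • 1 := by
  refine Matrix.ext fun i j => ?_
  have := congrFun (congrFun h i.succ) j.succ
  rw [Matrix.mul_apply, Fin.sum_univ_succ] at this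
  rw [Matrix.mul_apply]
  simpa [Matrix.one_apply] using this

end

theorem AdjLinear.blockOne {R : Type u} [CommRing R] {n : ℕ}
    {A : Matrix (Fin (n + 1)) (Fin (n + 1)) R} (hA : AdjLinear A) : AdjLinear (blockOne A) := by
  intro b f hf hfa S _ _ M c hl hr
  let l : MvPolynomial (Fin (n + 1) × Fin (n + 1)) R :=
    ∑ k, MvPolynomial.C (A 0 k) * MvPolynomial.X (k, 0)
  let Q : Matrix (Fin (n + 2)) (Fin (n + 2)) (MvPolynomial (Fin (n + 1) × Fin (n + 1)) R) :=
    Matrix.of (Fin.cons (Fin.cons l 0) fun i => Fin.cons 0 fun j => MvPolynomial.X (i, j))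
  let f₀ : MvPolynomial (Fin (n + 1) × Fin (n + 1)) R := MvPolynomial.aeval (fun p => Q p.1 p.2) f
  have hQ : ∀ i j, (Q i j).IsHomogeneous 1 := by
    intro i j
    refine Fin.cases ?_ (fun i => ?_) i <;> refine Fin.cases ?_ (fun j => ?_) j
    · exact MvPolynomial.IsHomogeneous.sum Finset.univ _ _ fun k _ =>
        (MvPolynomial.isHomogeneous_X R (k, (0 : Fin (n + 1)))).C_mul (A 0 k)
    · exact MvPolynomial.isHomogeneous_zero _ _ _
    · exact MvPolynomial.isHomogeneous_zero _ _ _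
    · exact MvPolynomial.isHomogeneous_X _ _
  have hf₀ : f₀.IsHomogeneous b := by
    have := hf.aeval (fun p => Q p.1 p.2) (n := 1) fun p => hQ _ _
    rwa [one_mul] at this
  have hval : ∀ (S : Type u) [CommRing S] [Algebra R S] (M : Matrix (Fin (n + 2)) (Fin (n + 2)) S)
      (c : S), (_root_.blockOne A).map (algebraMap R S) * M = c • 1 →
      M * (_root_.blockOne A).map (algebraMap R S) = c • 1 →
      MvPolynomial.aeval (fun p => M p.1 p.2) f =
        MvPolynomial.aeval (fun p : Fin (n + 1) × Fin (n + 1) =>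
          (M.submatrix Fin.succ Fin.succ) p.1 p.2) f₀ := by
    intro S _ _ M c hl hr
    rw [map_blockOne] at hl hr
    simp only [f₀]
    rw [← AlgHom.comp_apply, MvPolynomial.comp_aeval]
    congr 2
    funext ⟨i, j⟩
    refine Fin.cases ?_ (fun i => ?_) i <;> refine Fin.cases ?_ (fun j => ?_) j
    · have h1 := congrFun (congrFun (blockOne_mul_submatrix hl) 0) 0
      rw [Matrix.mul_apply] at h1
      simp only [Matrix.smul_apply, Matrix.one_apply_eq, smul_eq_mul, mul_one, Matrix.map_apply,
        Matrix.submatrix_apply] at h1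
      rw [blockOne_mul_zero hl, Matrix.one_apply_eq, mul_one, ← h1]
      simp [Q, l]
    · rw [blockOne_mul_zero hl, Matrix.one_apply_ne (Fin.succ_ne_zero j).symm, mul_zero]
      simp [Q]
    · rw [mul_blockOne_zero hr, Matrix.one_apply_ne (Fin.succ_ne_zero i), mul_zero]
      simp [Q]
    · simp [Q]
  rw [hval S M c hl hr]
  rw [map_blockOne] at hl hr
  refine hA b f₀ hf₀ ?_ S _ c (blockOne_mul_submatrix hl) (submatrix_mul_blockOne hr)
  have hid : ∀ m (X : Matrix (Fin m) (Fin m) R), X.map (algebraMap R R) = X := fun _ _ => rfl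
  have h1 := hval R (_root_.blockOne A).adjugate (_root_.blockOne A).det (by rw [hid, mul_adjugate])
    (by rw [hid, adjugate_mul])
  rw [hfa] at h1
  rw [h1]
  congr 2
  funext p
  exact (adjugate_blockOne_succ_succ A p.1 p.2).symm

theorem adjLinear_fin_one {R : Type u} [CommRing R] (A : Matrix (Fin 1) (Fin 1) R) :
    AdjLinear A := by
  intro b f hf hfa S _ _ M c hl hr
  have h := MvPolynomial.IsWeightedHomogeneous.aeval_pow_mul hf (M 0 0)
    (fun p : Fin 1 × Fin 1 => algebraMap R S (A.adjugate p.1 p.2))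
  have h2 : MvPolynomial.aeval (fun p : Fin 1 × Fin 1 => algebraMap R S (A.adjugate p.1 p.2)) f =
      algebraMap R S (MvPolynomial.aeval (fun p => A.adjugate p.1 p.2) f) :=
    MvPolynomial.aeval_algebraMap_apply _ _ _
  rw [h2, hfa, map_zero, mul_zero] at h
  rw [← h]
  congr 2
  funext ⟨i, j⟩
  rw [Subsingleton.elim i 0, Subsingleton.elim j 0]
  simp [adjugate_subsingleton]

theorem Matrix.exists_eq_mul_blockOne_mul {R : Type*} [CommRing R] {n : ℕ}
    {A : Matrix (Fin (n + 1)) (Fin (n + 1)) R} {p q : Fin (n + 1)} (h : IsUnit (A p q)) :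
    ∃ (G H : Matrix (Fin (n + 1)) (Fin (n + 1)) R) (B : Matrix (Fin n) (Fin n) R),
      IsUnit G.det ∧ IsUnit H.det ∧ A = G * blockOne B * H := by
  obtain ⟨v, hv⟩ := h.exists_right_inv
  let σ := Equiv.swap 0 p
  let τ := Equiv.swap 0 q
  let A' := A.submatrix σ τ
  have h00 : A' 0 0 = A p q := by simp [A', σ, τ]
  let L : Matrix (Fin (n + 1)) (Fin (n + 1)) R :=
    Matrix.of fun i => Fin.cons (A' i 0) fun j => (1 : Matrix (Fin (n + 1)) (Fin (n + 1)) R) i j.succ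
  let U : Matrix (Fin (n + 1)) (Fin (n + 1)) R :=
    Matrix.of (Fin.cons (fun j => v * A' 0 j) fun i => (1 : Matrix (Fin (n + 1)) (Fin (n + 1)) R) i.succ)
  let B : Matrix (Fin n) (Fin n) R :=
    Matrix.of fun i j => A' i.succ j.succ - A' i.succ 0 * v * A' 0 j.succ
  have hL : L.det = A p q := by
    rw [det_succ_row_zero, Fin.sum_univ_succ]
    have h1 : L.submatrix Fin.succ Fin.succ = 1 := by
      refine Matrix.ext fun i j => ?_
      simp [L, Matrix.one_apply]
    have h2 : ∀ j : Fin n, L 0 j.succ = 0 := fun j => by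
      simp [L, Matrix.one_apply, (Fin.succ_ne_zero j).symm]
    have h4 : L 0 0 = A p q := h00
    simp [h2, h1, h4]
  have hU : U.det = v * A p q := by
    rw [det_succ_column_zero, Fin.sum_univ_succ]
    have h1 : U.submatrix Fin.succ Fin.succ = 1 := by
      refine Matrix.ext fun i j => ?_
      simp [U, Matrix.one_apply]
    have h2 : ∀ j : Fin n, U j.succ 0 = 0 := fun j => by
      simp [U]
    have h4 : U 0 0 = v * A p q := by rw [← h00]; rfl
    simp [h2, h1, h4]
  have hprod : A' = L * blockOne B * U := by
    refine Matrix.ext fun i j => ?_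
    have hLB : ∀ i, (L * blockOne B) i 0 = A' i 0 := fun i => by
      rw [Matrix.mul_apply, Fin.sum_univ_succ]
      simp [L]
    have hLB0 : ∀ j : Fin n, (L * blockOne B) 0 j.succ = 0 := fun j => by
      rw [Matrix.mul_apply, Fin.sum_univ_succ]
      simp [L, Matrix.one_apply, (Fin.succ_ne_zero _).symm]
    have hLB1 : ∀ i j : Fin n, (L * blockOne B) i.succ j.succ = B i j := fun i j => by
      rw [Matrix.mul_apply, Fin.sum_univ_succ]
      simp [L, Matrix.one_apply]
    have hU0 : ∀ j, U 0 j = v * A' 0 j := fun j => rfl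
    have hU1 : ∀ i j, U (Fin.succ i) j = (1 : Matrix (Fin (n + 1)) (Fin (n + 1)) R) i.succ j :=
      fun i j => rfl
    have hv' : A' 0 0 * v = 1 := by rw [h00, hv]
    rw [Matrix.mul_apply, Fin.sum_univ_succ, hLB]
    refine Fin.cases ?_ (fun i => ?_) i
    · simp only [hLB0, zero_mul, Finset.sum_const_zero, add_zero, hU0]
      rw [← mul_assoc, hv', one_mul]
    · simp only [hLB1, hU0, hU1]
      refine Fin.cases ?_ (fun j => ?_) j
      · simp only [Matrix.one_apply, Fin.succ_ne_zero, if_false, mul_zero, Finset.sum_const_zero,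
          add_zero]
        linear_combination -A' i.succ 0 * hv'
      · simp [Matrix.one_apply, B, mul_assoc]
  refine ⟨L.submatrix σ id, U.submatrix id τ, B, ?_, ?_, ?_⟩
  · rw [det_permute, hL]
    exact ((Equiv.Perm.sign σ).isUnit.map (Int.castRingHom R)).mul h
  · rw [det_permute', hU]
    refine ((Equiv.Perm.sign τ).isUnit.map (Int.castRingHom R)).mul (IsUnit.mul ?_ h)
    exact IsUnit.of_mul_eq_one _ (by rw [mul_comm]; exact hv)
  · have h1 : A = A'.submatrix σ τ := by
      refine Matrix.ext fun i j => ?_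
      simp [A', σ, τ]
    rw [h1, hprod]
    rfl

/-- Every prime at which the rank drops below `j` has height at least `(n - j + 1)²`. -/
def RankHeight {R : Type*} [CommRing R] {n : ℕ} (A : Matrix (Fin n) (Fin n) R) : Prop :=
  ∀ (P : PrimeSpectrum R) (j : ℕ), 1 ≤ j → j + 1 ≤ n →
    (A.map (algebraMap R P.asIdeal.ResidueField)).rank < j →
    (((n - j + 1) ^ 2 : ℕ) : ℕ∞) ≤ Order.height P

theorem Matrix.rank_add_le_add {F m n : Type*} [Field F] [Finite m] [Fintype n] (A B : Matrix m n F) :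
    (A + B).rank ≤ A.rank + B.rank := by
  unfold rank
  refine (Submodule.finrank_mono (t := LinearMap.range A.mulVecLin ⊔ LinearMap.range B.mulVecLin) ?_).trans
    (Submodule.finrank_add_le_finrank_add_finrank _ _)
  rintro _ ⟨x, rfl⟩
  rw [mulVecLin_apply, add_mulVec]
  exact Submodule.add_mem_sup ⟨x, rfl⟩ ⟨x, rfl⟩

theorem rank_blockOne_le {F : Type*} [Field F] {n : ℕ} (B : Matrix (Fin n) (Fin n) F) :
    (blockOne B).rank ≤ 1 + B.rank := by
  let D : Matrix (Fin (n + 1)) (Fin n) F := Matrix.of fun i j => if i = j.succ then 1 else 0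
  have h : blockOne B = vecMulVec (Pi.single 0 1) (Pi.single 0 1) + D * B * Dᵀ := by
    refine Matrix.ext fun i j => ?_
    refine Fin.cases ?_ (fun i => ?_) i <;> refine Fin.cases ?_ (fun j => ?_) j
    · simp [vecMulVec_apply, Matrix.mul_apply, D, (Fin.succ_ne_zero _).symm]
    · simp [vecMulVec_apply, Matrix.mul_apply, D, (Fin.succ_ne_zero _).symm]
    · simp [vecMulVec_apply, Matrix.mul_apply, D, (Fin.succ_ne_zero _).symm]
    · simp [vecMulVec_apply, Matrix.mul_apply, D]
  rw [h]
  refine (rank_add_le_add _ _).trans (add_le_add (rank_vecMulVec_le _ _) ?_)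
  exact (rank_mul_le_left _ _).trans (rank_mul_le_right _ _)

theorem RankHeight.of_mul_blockOne_mul {R : Type*} [CommRing R] {n : ℕ}
    {G H : Matrix (Fin (n + 1)) (Fin (n + 1)) R} {B : Matrix (Fin n) (Fin n) R}
    (h : RankHeight (G * blockOne B * H)) : RankHeight B := by
  intro P j h1 hjn hr
  have := h P (j + 1) (by omega) (by omega) (by
    rw [Matrix.map_mul, Matrix.map_mul, map_blockOne]
    have h2 := (rank_mul_le_left (G.map (algebraMap R P.asIdeal.ResidueField) *
      blockOne (B.map (algebraMap R P.asIdeal.ResidueField)))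
      (H.map (algebraMap R P.asIdeal.ResidueField))).trans (rank_mul_le_right _ _)
    have h3 := rank_blockOne_le (B.map (algebraMap R P.asIdeal.ResidueField))
    omega)
  rwa [Nat.add_sub_add_right] at this

theorem quasiRegular_of_rankHeight {R : Type u} [CommRing R] [IsRegularLocalRing R] {n : ℕ} (hn : 2 ≤ n)
    {A : Matrix (Fin n) (Fin n) R} (hA : ∀ i j, A i j ∈ IsLocalRing.maximalIdeal R)
    (h : RankHeight A) : QuasiRegular fun p : Fin n × Fin n => A p.1 p.2 := by
  refine QuasiRegular.of_equiv finProdFinEquiv.symm (quasiRegular_of_forall fun i x hx => ?_)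
  refine IsRegularLocalRing.mem_span_of_mul_mem_span (fun i => hA _ _) (fun P hP => ?_) i x hx
  have h0 : A.map (algebraMap R P.asIdeal.ResidueField) = 0 := by
    refine Matrix.ext fun i j => ?_
    have := hP (finProdFinEquiv (i, j))
    simpa using this
  have := h P 1 le_rfl hn (by rw [h0, rank_zero]; exact one_pos)
  rwa [Nat.sub_add_cancel (by omega), pow_two] at this

theorem adjLinear_of_rankHeight (K : Type u) [Field K] {R : Type u} [CommRing R] [Algebra K R]
    [IsRegularLocalRing R] {n : ℕ} {A : Matrix (Fin (n + 1)) (Fin (n + 1)) R} (h : RankHeight A) :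
    AdjLinear A := by
  induction n with
  | zero => exact adjLinear_fin_one A
  | succ n ih =>
    by_cases hA : ∀ i j, A i j ∈ IsLocalRing.maximalIdeal R
    · exact adjLinear_of_quasiRegular K hA (quasiRegular_of_rankHeight (by omega) hA h)
    · push Not at hA
      obtain ⟨p, q, hpq⟩ := hA
      obtain ⟨G, H, B, hG, hH, rfl⟩ :=
        Matrix.exists_eq_mul_blockOne_mul (IsLocalRing.notMem_maximalIdeal.1 hpq)
      exact (ih h.of_mul_blockOne_mul).blockOne.mul_mul hG hH

theorem adjLinear_of_localization {R : Type u} [CommRing R] {n : ℕ} {A : Matrix (Fin n) (Fin n) R}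
    (h : ∀ (p : Ideal R) [p.IsMaximal], AdjLinear (A.map (algebraMap R (Localization.AtPrime p)))) :
    AdjLinear A := by
  intro b f hf hfa S _ _ M c hl hr
  set y := MvPolynomial.aeval (fun p => M p.1 p.2) f with hy
  by_contra hy0
  let J : Ideal R := LinearMap.ker (LinearMap.toSpanSingleton R S y)
  have hJ : J ≠ ⊤ := by
    intro hJ
    have h1 : (1 : R) ∈ J := by rw [hJ]; trivial
    have h1 : (1 : R) • y = 0 := h1
    rw [one_smul] at h1
    exact hy0 h1
  obtain ⟨p, hp, hJp⟩ := Ideal.exists_le_maximal J hJ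
  let W := Algebra.algebraMapSubmonoid S p.primeCompl
  let φ : Localization.AtPrime p →+* Localization W :=
    IsLocalization.lift (M := p.primeCompl) (g := (algebraMap S (Localization W)).comp (algebraMap R S))
      fun s => IsLocalization.map_units (Localization W)
        (⟨algebraMap R S s, Algebra.mem_algebraMapSubmonoid_of_mem s⟩ : W)
  let _ : Algebra (Localization.AtPrime p) (Localization W) := φ.toAlgebra
  have hφ : ∀ r, algebraMap (Localization.AtPrime p) (Localization W)
      (algebraMap R (Localization.AtPrime p) r) = algebraMap S (Localization W) (algebraMap R S r) :=
    fun r => IsLocalization.lift_eq _ r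
  have hA : (A.map (algebraMap R (Localization.AtPrime p))).map
      (algebraMap (Localization.AtPrime p) (Localization W)) =
      (A.map (algebraMap R S)).map (algebraMap S (Localization W)) :=
    Matrix.ext fun i j => hφ _
  have h0 := h p b (MvPolynomial.map (algebraMap R (Localization.AtPrime p)) f) (hf.map _) (by
      have hadj : (A.map (algebraMap R (Localization.AtPrime p))).adjugate =
          A.adjugate.map (algebraMap R (Localization.AtPrime p)) :=
        (RingHom.map_adjugate (algebraMap R (Localization.AtPrime p)) A).symm
      rw [MvPolynomial.aeval_map_algebraMap, hadj]
      have := MvPolynomial.aeval_algebraMap_apply (Localization.AtPrime p)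
        (fun p : Fin n × Fin n => A.adjugate p.1 p.2) f
      rw [hfa, map_zero] at this
      exact this) (Localization W) (M.map (algebraMap S (Localization W)))
    (algebraMap S (Localization W) c)
    (by rw [hA, ← Matrix.map_mul, hl, Matrix.map_smul_one])
    (by rw [hA, ← Matrix.map_mul, hr, Matrix.map_smul_one])
  have h1 : algebraMap S (Localization W) y = 0 := by
    rw [← h0, hy, MvPolynomial.aeval_def, MvPolynomial.aeval_def, MvPolynomial.eval₂_map]
    rw [← MvPolynomial.coe_eval₂Hom, ← MvPolynomial.coe_eval₂Hom, ← RingHom.comp_apply,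
      MvPolynomial.comp_eval₂Hom]
    congr 2
    exact RingHom.ext fun r => (hφ r).symm
  rw [IsLocalization.map_eq_zero_iff W] at h1
  obtain ⟨⟨_, s, hs, rfl⟩, hsy⟩ := h1
  refine hs (hJp ?_)
  change s • y = 0
  rw [Algebra.smul_def]
  exact hsy

theorem minorsIdeal_le_comap {R S : Type*} [CommRing R] [CommRing S] {n j : ℕ}
    {A : Matrix (Fin n) (Fin n) R} (φ : R →+* S) (P : PrimeSpectrum S)
    (h : ((A.map φ).map (algebraMap S P.asIdeal.ResidueField)).rank < j) :
    minorsIdeal j A ≤ P.asIdeal.comap φ := by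
  refine Ideal.span_le.2 ?_
  rintro _ ⟨f, g, -, -, rfl⟩
  have h1 : (((A.map φ).map (algebraMap S P.asIdeal.ResidueField)).submatrix f g).det = 0 := by
    by_contra hne
    have h2 := rank_of_det_ne_zero hne
    have h3 := rank_submatrix_le ((A.map φ).map (algebraMap S P.asIdeal.ResidueField)) f g
    rw [Fintype.card_fin] at h2
    omega
  have h4 : algebraMap S P.asIdeal.ResidueField (φ (A.submatrix f g).det) = 0 := by
    rw [RingHom.map_det, RingHom.map_det, ← h1]
    rfl
  rwa [Ideal.algebraMap_residueField_eq_zero] at h4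

theorem rankHeight_localization {R : Type u} [CommRing R] {n : ℕ} {A : Matrix (Fin n) (Fin n) R}
    (h : ∀ j : ℕ, 1 ≤ j → j + 1 ≤ n →
      (((n - j + 1) ^ 2 : ℕ) : ℕ∞) ≤ idealHeight (minorsIdeal j A)) (p : Ideal R) [p.IsPrime] :
    RankHeight (A.map (algebraMap R (Localization.AtPrime p))) := by
  intro P j h1 hjn hr
  have hle := minorsIdeal_le_comap _ P hr
  let Q : PrimeSpectrum R := ⟨P.asIdeal.comap (algebraMap R (Localization.AtPrime p)), inferInstance⟩
  have h2 : idealHeight (minorsIdeal j A) ≤ Order.height Q := iInf₂_le Q hle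
  have h3 : Order.height Q = Order.height P := by
    rw [← PrimeSpectrum.height_eq_orderHeight, ← PrimeSpectrum.height_eq_orderHeight]
    exact IsLocalization.height_under p.primeCompl P.asIdeal
  exact (h j h1 hjn).trans (h2.trans h3.le)

theorem adjLinear_of_idealHeight {K : Type u} [Field K] {d n : ℕ}
    {A : Matrix (Fin (n + 1)) (Fin (n + 1)) (MvPolynomial (Fin d) K)}
    (h : ∀ j : ℕ, 1 ≤ j → j + 1 ≤ n + 1 →
      (((n + 1 - j + 1) ^ 2 : ℕ) : ℕ∞) ≤ idealHeight (minorsIdeal j A)) : AdjLinear A :=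
  adjLinear_of_localization fun p _ =>
    adjLinear_of_rankHeight K (rankHeight_localization h p)

theorem Fin.exists_eq_succAboveOrderEmb {m : ℕ} (g : Fin m ↪o Fin (m + 1)) :
    ∃ i : Fin (m + 1), i.succAboveOrderEmb = g := by
  obtain ⟨i, hi⟩ : ∃ i, i ∉ Set.range g := by
    by_contra! hall
    have := Fintype.card_le_of_surjective g hall
    simp at this
  refine ⟨i, ?_⟩
  have hr : Set.range g = Set.range i.succAbove := by
    rw [Fin.range_succAbove]
    refine Set.eq_of_subset_of_ncard_le (fun x hx => ?_) ?_
    · rintro rfl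
      exact hi hx
    · rw [Set.ncard_compl, Set.ncard_singleton, ← Set.image_univ, Set.ncard_image_of_injective _ g.injective,
        Set.ncard_univ]
      simp
  have := (g.strictMono.range_inj (Fin.strictMono_succAbove i)).1 hr
  ext x
  rw [this]
  rfl

theorem mem_reesDefIdeal_iff {R ι : Type*} [CommRing R] {f : ι → R} {p : MvPolynomial ι R} :
    p ∈ reesDefIdeal f ↔ ∀ b, MvPolynomial.aeval f (MvPolynomial.homogeneousComponent b p) = 0 := by
  have h : ∀ b, (MvPolynomial.aeval (fun i => Polynomial.C (f i) * Polynomial.X) p).coeff b =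
      MvPolynomial.aeval f (MvPolynomial.homogeneousComponent b p) := fun b => by
    have := MvPolynomial.coeff_aeval_C_mul_X_pow 1 f b p
    simp only [Pi.one_apply, pow_one] at this
    exact this
  refine ⟨fun hp b => ?_, fun hp => ?_⟩
  · rw [← h, show MvPolynomial.aeval (fun i => Polynomial.C (f i) * Polynomial.X) p = 0 from hp,
      Polynomial.coeff_zero]
  · refine Polynomial.ext fun b => (h b).trans ?_
    rw [hp, Polynomial.coeff_zero]

theorem mem_reesDefIdeal_of_isHomogeneous {R ι : Type*} [CommRing R] {f : ι → R} {p : MvPolynomial ι R}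
    {b : ℕ} (hp : p.IsHomogeneous b) (h : MvPolynomial.aeval f p = 0) : p ∈ reesDefIdeal f := by
  classical
  rw [mem_reesDefIdeal_iff]
  intro k
  rw [MvPolynomial.homogeneousComponent_of_mem hp]
  split_ifs
  · exact h
  · exact map_zero _

theorem AdjLinear.isLinearType {R : Type u} [CommRing R] {m : ℕ}
    {A : Matrix (Fin (m + 1)) (Fin (m + 1)) R} (hA : AdjLinear A) :
    IsLinearType (fun q : (Fin m ↪o Fin (m + 1)) × (Fin m ↪o Fin (m + 1)) =>
      (A.submatrix ⇑q.1 ⇑q.2).det) := by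
  set f := fun q : (Fin m ↪o Fin (m + 1)) × (Fin m ↪o Fin (m + 1)) => (A.submatrix ⇑q.1 ⇑q.2).det
    with hf
  set L : Ideal (MvPolynomial ((Fin m ↪o Fin (m + 1)) × (Fin m ↪o Fin (m + 1))) R) :=
    Ideal.span {p | p ∈ reesDefIdeal f ∧ p.IsHomogeneous 1} with hL
  have hinj : Function.Injective (Fin.succAboveOrderEmb : Fin (m + 1) → (Fin m ↪o Fin (m + 1))) := by
    intro i j hij
    refine Fin.succAbove_left_injective (funext fun x => ?_)
    exact DFunLike.congr_fun hij x
  let e : Fin (m + 1) ≃ (Fin m ↪o Fin (m + 1)) :=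
    Equiv.ofBijective _ ⟨hinj, Fin.exists_eq_succAboveOrderEmb⟩
  let N : Matrix (Fin (m + 1)) (Fin (m + 1))
      (MvPolynomial ((Fin m ↪o Fin (m + 1)) × (Fin m ↪o Fin (m + 1))) R) :=
    Matrix.of fun i j => MvPolynomial.C ((-1) ^ (j + i : ℕ)) * MvPolynomial.X (e j, e i)
  have hN : ∀ i j, (N i j).IsHomogeneous 1 := fun i j => (MvPolynomial.isHomogeneous_X _ _).C_mul _
  have hNf : N.map (MvPolynomial.aeval f) = A.adjugate := by
    refine Matrix.ext fun i j => ?_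
    rw [adjugate_fin_succ_eq_det_submatrix]
    simp only [Matrix.map_apply, N, Matrix.of_apply, map_mul, MvPolynomial.aeval_C,
      MvPolynomial.aeval_X]
    rfl
  let AC : Matrix (Fin (m + 1)) (Fin (m + 1))
      (MvPolynomial ((Fin m ↪o Fin (m + 1)) × (Fin m ↪o Fin (m + 1))) R) := A.map MvPolynomial.C
  have hmulN : ∀ i j, ((AC * N) i j).IsHomogeneous 1 := fun i j => by
    rw [Matrix.mul_apply]
    exact MvPolynomial.IsHomogeneous.sum _ _ _ fun k _ => (hN _ _).C_mul _
  have hNmul : ∀ i j, ((N * AC) i j).IsHomogeneous 1 := fun i j => by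
    rw [Matrix.mul_apply]
    exact MvPolynomial.IsHomogeneous.sum _ _ _ fun k _ => by
      rw [mul_comm]; exact (hN _ _).C_mul _
  have hAC : AC.map (MvPolynomial.aeval f) = A :=
    Matrix.ext fun i j => MvPolynomial.aeval_C f (A i j)
  have hmulNf : (AC * N).map (MvPolynomial.aeval f) =
      A.det • (1 : Matrix (Fin (m + 1)) (Fin (m + 1)) R) := by
    rw [Matrix.map_mul, hAC, hNf, mul_adjugate]
  have hNmulf : (N * AC).map (MvPolynomial.aeval f) =
      A.det • (1 : Matrix (Fin (m + 1)) (Fin (m + 1)) R) := by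
    rw [Matrix.map_mul, hAC, hNf, adjugate_mul]
  set c := (AC * N) 0 0 with hc
  have hcf : MvPolynomial.aeval f c = A.det := by
    have := congrFun (congrFun hmulNf 0) 0
    rw [Matrix.smul_apply, Matrix.one_apply_eq, smul_eq_mul, mul_one] at this
    exact this
  have hscalar : ∀ B : Matrix (Fin (m + 1)) (Fin (m + 1))
      (MvPolynomial ((Fin m ↪o Fin (m + 1)) × (Fin m ↪o Fin (m + 1))) R),
      (∀ i j, (B i j).IsHomogeneous 1) →
      B.map (MvPolynomial.aeval f) = A.det • (1 : Matrix (Fin (m + 1)) (Fin (m + 1)) R) →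
      B.map (Ideal.Quotient.mk L) = Ideal.Quotient.mk L c • 1 := by
    intro B hB hBf
    rw [← Matrix.map_smul_one]
    refine Matrix.ext fun i j => ?_
    rw [Matrix.map_apply, Matrix.map_apply, Ideal.Quotient.eq]
    have hh : ((c • (1 : Matrix (Fin (m + 1)) (Fin (m + 1))
        (MvPolynomial ((Fin m ↪o Fin (m + 1)) × (Fin m ↪o Fin (m + 1))) R))) i j).IsHomogeneous 1 := by
      rw [Matrix.smul_apply, Matrix.one_apply, smul_eq_mul]
      split_ifs
      · rw [mul_one]; exact hmulN 0 0
      · rw [mul_zero]; exact MvPolynomial.isHomogeneous_zero _ _ _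
    have hd : (B i j - (c • (1 : Matrix (Fin (m + 1)) (Fin (m + 1))
        (MvPolynomial ((Fin m ↪o Fin (m + 1)) × (Fin m ↪o Fin (m + 1))) R))) i j).IsHomogeneous 1 :=
      (hB i j).sub hh
    refine Ideal.subset_span ⟨mem_reesDefIdeal_of_isHomogeneous hd ?_, hd⟩
    have := congrFun (congrFun hBf i) j
    rw [Matrix.map_apply] at this
    rw [map_sub, this, Matrix.smul_apply, Matrix.smul_apply, Matrix.one_apply, Matrix.one_apply,
      smul_eq_mul, smul_eq_mul, map_mul, hcf]
    split_ifs <;> simp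
  refine le_antisymm (fun p hp => ?_) (Ideal.span_le.2 fun p hp => hp.1)
  rw [mem_reesDefIdeal_iff] at hp
  rw [← MvPolynomial.sum_homogeneousComponent p]
  refine Ideal.sum_mem _ fun b _ => ?_
  have hb := MvPolynomial.homogeneousComponent_isHomogeneous b p
  have hpb := hp b
  generalize MvPolynomial.homogeneousComponent b p = p at hb hpb
  let s : (Fin m ↪o Fin (m + 1)) × (Fin m ↪o Fin (m + 1)) → R := fun q =>
    (-1) ^ ((e.symm q.1 : ℕ) + (e.symm q.2 : ℕ))
  let p' : MvPolynomial (Fin (m + 1) × Fin (m + 1)) R :=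
    MvPolynomial.aeval (fun q => MvPolynomial.C (s q) *
      MvPolynomial.X (e.symm q.2, e.symm q.1)) p
  have hp' : p'.IsHomogeneous b := by
    have := hb.aeval (R := R) (n := 1) (fun q => MvPolynomial.C (s q) *
      (MvPolynomial.X (e.symm q.2, e.symm q.1) : MvPolynomial (Fin (m + 1) × Fin (m + 1)) R))
      fun q => (MvPolynomial.isHomogeneous_X _ _).C_mul _
    rwa [one_mul] at this
  have hXN : ∀ q, MvPolynomial.C (s q) * N (e.symm q.2) (e.symm q.1) = MvPolynomial.X q := by
    intro q
    simp only [N, Matrix.of_apply, s, Equiv.apply_symm_apply]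
    rw [← mul_assoc, ← map_mul, ← mul_pow, neg_one_mul, neg_neg, one_pow, map_one, one_mul]
  have haev : ∀ (S : Type u) [CommRing S] [Algebra R S]
      (φ : MvPolynomial ((Fin m ↪o Fin (m + 1)) × (Fin m ↪o Fin (m + 1))) R →ₐ[R] S),
      MvPolynomial.aeval (fun r => N.map φ r.1 r.2) p' = φ p := by
    intro S _ _ φ
    have : ((MvPolynomial.aeval (fun r => N.map φ r.1 r.2)).comp
        (MvPolynomial.aeval (fun q => MvPolynomial.C (s q) *
          (MvPolynomial.X (e.symm q.2, e.symm q.1) : MvPolynomial (Fin (m + 1) × Fin (m + 1)) R)))) =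
        φ := by
      refine MvPolynomial.algHom_ext fun q => ?_
      rw [AlgHom.comp_apply, MvPolynomial.aeval_X, map_mul, MvPolynomial.aeval_C,
        MvPolynomial.aeval_X, Matrix.map_apply, ← hXN q, map_mul]
      congr 1
      exact (φ.commutes _).symm
    exact DFunLike.congr_fun this p
  have h0 := hA b p' hp' (by
      rw [← hNf]
      exact (haev R (MvPolynomial.aeval f)).trans hpb) _ (N.map (Ideal.Quotient.mkₐ R L))
    (Ideal.Quotient.mk L c) (by
      rw [← hscalar _ hmulN hmulNf, Matrix.map_mul]; rfl) (by
      rw [← hscalar _ hNmul hNmulf, Matrix.map_mul]; rfl)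
  rw [haev] at h0
  exact Ideal.Quotient.eq_zero_iff_mem.1 h0

theorem statement_17 (K : Type*) [Field K] (d : ℕ) (hd : 0 < d)
    (n : ℕ) (h2n : 2 ≤ n)
    (A : Matrix (Fin n) (Fin n) (MvPolynomial (Fin d) K))
    (hgen : idealHeight (minorsIdeal (n - 1) A) = (4 : ℕ∞))
    (hj : ∀ j : ℕ, 1 ≤ j → j ≤ n - 2 →
      (((n - j + 1) ^ 2 : ℕ) : ℕ∞) ≤ idealHeight (minorsIdeal j A)) :
    IsLinearType (fun q : (Fin (n - 1) ↪o Fin n) × (Fin (n - 1) ↪o Fin n) =>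
      (A.submatrix ⇑q.1 ⇑q.2).det) := by
  obtain ⟨m, rfl⟩ : ∃ m, n = m + 1 := ⟨n - 1, by omega⟩
  refine AdjLinear.isLinearType (adjLinear_of_idealHeight fun j h1 hjm => ?_)
  by_cases hjn : j ≤ m + 1 - 2
  · exact hj j h1 hjn
  · obtain rfl : j = m := by omega
    rw [show j + 1 - j + 1 = 2 by omega]
    exact hgen.ge
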